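/- For all integers n ≥ 2, r with 0 ≤ r ≤ n−1, and ε ∈ {1, −1}, there exists a unique ℚ(v)-algebra homomorphism Φ_{r,ε} : U(ŝl_n) → U(ŝl_{n+1}) such that Φ_{r,ε}(E_i) = e_i, Φ_{r,ε}(F_i) = f_i and Φ_{r,ε}(K_i^{±1}) = k_i^{±1} for all i ∈ ℤ/nℤ; moreover Φ_{r,ε} is injective. -/

import Mathlib

noncomputable section

/-- The field ℚ(v) of rational functions over ℚ. -/
abbrev Qv : Type := RatFunc ℚ

/-- The indeterminate v. -/
def vv : Qv := RatFunc.X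

/-- The quantum integer [a] = (v^a - v^{-a})/(v - v⁻¹). -/
def qint (a : ℕ) : Qv := (vv ^ (a : ℤ) - vv ^ (-(a : ℤ))) / (vv - vv⁻¹)

/-- The quantum factorial [a]! = [a][a-1]⋯[1]. -/
def qfact : ℕ → Qv
  | 0 => 1
  | n + 1 => qint (n + 1) * qfact n

/-- Divided power x^{(p)} = x^p / [p]!. -/
def dp {A : Type} [Ring A] [Algebra Qv A] (x : A) (p : ℕ) : A :=
  (qfact p)⁻¹ • x ^ p

/-- The affine type A Cartan matrix entries c_{ij} = 2δ_{i,j} - δ_{i,j+1} - δ_{i,j-1}. -/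
def cartan {m : ℕ} (i j : ZMod m) : ℤ :=
  (if i = j then 2 else 0) - (if i = j + 1 then 1 else 0) - (if i = j - 1 then 1 else 0)

/-- Generators of the quantum affine algebra U(ŝl_m). -/
inductive Gen (m : ℕ) : Type
  | E : ZMod m → Gen m
  | F : ZMod m → Gen m
  | K : ZMod m → Gen m
  | Kinv : ZMod m → Gen m

abbrev FA (m : ℕ) := FreeAlgebra Qv (Gen m)

def fE {m : ℕ} (i : ZMod m) : FA m := FreeAlgebra.ι Qv (Gen.E i)
def fF {m : ℕ} (i : ZMod m) : FA m := FreeAlgebra.ι Qv (Gen.F i)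
def fK {m : ℕ} (i : ZMod m) : FA m := FreeAlgebra.ι Qv (Gen.K i)
def fKinv {m : ℕ} (i : ZMod m) : FA m := FreeAlgebra.ι Qv (Gen.Kinv i)

/-- The defining relations of the quantum affine algebra U(ŝl_m). -/
inductive URel (m : ℕ) : FA m → FA m → Prop
  | KK : ∀ i j, URel m (fK i * fK j) (fK j * fK i)
  | KKinv : ∀ i, URel m (fK i * fKinv i) 1
  | KinvK : ∀ i, URel m (fKinv i * fK i) 1
  | KE : ∀ i j, URel m (fK i * fE j) (vv ^ cartan i j • (fE j * fK i))
  | KF : ∀ i j, URel m (fK i * fF j) (vv ^ (-cartan i j) • (fF j * fK i))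
  | EF : ∀ i j, URel m (fE i * fF j - fF j * fE i)
      (if i = j then (vv - vv⁻¹)⁻¹ • (fK i - fKinv i) else 0)
  | serreE : ∀ i j, i ≠ j →
      URel m (∑ p ∈ Finset.range ((1 - cartan i j).toNat + 1),
        ((-1 : Qv) ^ p) • (dp (fE i) p * fE j * dp (fE i) ((1 - cartan i j).toNat - p))) 0
  | serreF : ∀ i j, i ≠ j →
      URel m (∑ p ∈ Finset.range ((1 - cartan i j).toNat + 1),
        ((-1 : Qv) ^ p) • (dp (fF i) p * fF j * dp (fF i) ((1 - cartan i j).toNat - p))) 0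

/-- The quantum affine algebra U(ŝl_m), presented by generators and relations. -/
abbrev U (m : ℕ) := RingQuot (URel m)

def UE {m : ℕ} (i : ZMod m) : U m := RingQuot.mkAlgHom Qv (URel m) (fE i)
def UF {m : ℕ} (i : ZMod m) : U m := RingQuot.mkAlgHom Qv (URel m) (fF i)
def UK {m : ℕ} (i : ZMod m) : U m := RingQuot.mkAlgHom Qv (URel m) (fK i)
def UKinv {m : ℕ} (i : ZMod m) : U m := RingQuot.mkAlgHom Qv (URel m) (fKinv i)

/-- The element e_r = Ĕ_r Ĕ_{r+1} − v^ε Ĕ_{r+1} Ĕ_r in U(ŝl_{n+1}). -/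
def er (n r : ℕ) (ε : ℤ) : U (n + 1) :=
  UE (r : ZMod (n + 1)) * UE ((r : ZMod (n + 1)) + 1) -
    vv ^ ε • (UE ((r : ZMod (n + 1)) + 1) * UE (r : ZMod (n + 1)))

/-- The element f_r = F̆_{r+1} F̆_r − v^{−ε} F̆_r F̆_{r+1} in U(ŝl_{n+1}). -/
def fr (n r : ℕ) (ε : ℤ) : U (n + 1) :=
  UF ((r : ZMod (n + 1)) + 1) * UF (r : ZMod (n + 1)) -
    vv ^ (-ε) • (UF (r : ZMod (n + 1)) * UF ((r : ZMod (n + 1)) + 1))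

/-- The element k_r = K̆_r K̆_{r+1} in U(ŝl_{n+1}). -/
def kr (n r : ℕ) : U (n + 1) :=
  UK (r : ZMod (n + 1)) * UK ((r : ZMod (n + 1)) + 1)

/-- The image e_i ∈ U(ŝl_{n+1}) of the generator E_i, i ∈ ℤ/nℤ. -/
def eElt (n r : ℕ) (ε : ℤ) (i : ZMod n) : U (n + 1) :=
  if i.val < r then UE ((i.val : ZMod (n + 1)))
  else if i.val = r then er n r ε
  else UE ((i.val + 1 : ℕ) : ZMod (n + 1))

def fElt (n r : ℕ) (ε : ℤ) (i : ZMod n) : U (n + 1) :=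
  if i.val < r then UF ((i.val : ZMod (n + 1)))
  else if i.val = r then fr n r ε
  else UF ((i.val + 1 : ℕ) : ZMod (n + 1))

def kElt (n r : ℕ) (i : ZMod n) : U (n + 1) :=
  if i.val < r then UK ((i.val : ZMod (n + 1)))
  else if i.val = r then kr n r
  else UK ((i.val + 1 : ℕ) : ZMod (n + 1))

def kinvElt (n r : ℕ) (i : ZMod n) : U (n + 1) :=
  if i.val < r then UKinv ((i.val : ZMod (n + 1)))
  else if i.val = r then UKinv (r : ZMod (n + 1)) * UKinv ((r : ZMod (n + 1)) + 1)
  else UKinv ((i.val + 1 : ℕ) : ZMod (n + 1))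


/-! ### Quantum Serre sums and representations -/

theorem vv_zpow_ne_one {k : ℤ} (hk : k ≠ 0) : vv ^ k ≠ 1 := by
  have key : ∀ m : ℕ, 0 < m → vv ^ m ≠ 1 := by
    intro m hm h
    have h1 : algebraMap (Polynomial ℚ) (RatFunc ℚ) (Polynomial.X ^ m) =
        algebraMap (Polynomial ℚ) (RatFunc ℚ) 1 := by
      rw [map_pow, RatFunc.algebraMap_X, map_one]
      exact h
    have h2 := congrArg Polynomial.natDegree (RatFunc.algebraMap_injective ℚ h1)
    simp only [Polynomial.natDegree_pow, Polynomial.natDegree_X, Polynomial.natDegree_one] at h2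
    omega
  intro h
  obtain ⟨m, rfl | rfl⟩ := k.eq_nat_or_neg
  · exact key m (by omega) (by simpa using h)
  · exact key m (by omega) (by simpa using h)

theorem vv_ne_zero : vv ≠ 0 := RatFunc.X_ne_zero

theorem vv_sub_inv_ne_zero : vv - vv⁻¹ ≠ 0 := by
  intro h
  apply vv_zpow_ne_one (k := 2) (by norm_num)
  have h0 := vv_ne_zero
  field_simp at h
  rw [zpow_ofNat]
  linear_combination h

theorem qint_ne_zero {a : ℕ} (ha : 0 < a) : qint a ≠ 0 := by
  refine div_ne_zero ?_ vv_sub_inv_ne_zero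
  intro h
  apply vv_zpow_ne_one (k := a + a) (by omega)
  rw [zpow_add₀ vv_ne_zero]
  have h0 : vv ^ (a : ℤ) ≠ 0 := zpow_ne_zero _ vv_ne_zero
  rw [zpow_neg] at h
  field_simp at h
  linear_combination h

theorem qint_one : qint 1 = 1 := by
  have := vv_sub_inv_ne_zero
  simp [qint, div_self this]

theorem qint_two : qint 2 = vv + vv⁻¹ := by
  rw [qint, div_eq_iff vv_sub_inv_ne_zero, zpow_neg]
  have := vv_ne_zero
  field_simp
  norm_cast
  ring

theorem qint_three : qint 3 = vv ^ 2 + 1 + (vv⁻¹) ^ 2 := by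
  rw [qint, div_eq_iff vv_sub_inv_ne_zero, zpow_neg]
  have := vv_ne_zero
  field_simp
  norm_cast
  ring

theorem qfact_two : qfact 2 = qint 2 := by simp [qfact, qint_one]

section Serre

variable {A : Type} [Ring A] [Algebra Qv A]

/-- The quantum Serre expression of order `s`. -/
def serreSum (x y : A) (s : ℕ) : A :=
  ∑ p ∈ Finset.range (s + 1), ((-1 : Qv) ^ p) • (dp x p * y * dp x (s - p))

theorem serreSum_map {B : Type} [Ring B] [Algebra Qv B] (f : A →ₐ[Qv] B) (x y : A) (s : ℕ) :
    f (serreSum x y s) = serreSum (f x) (f y) s := by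
  simp [serreSum, dp]

theorem serreSum_one (x y : A) : serreSum x y 1 = y * x - x * y := by
  simp [serreSum, dp, Finset.sum_range_succ, qfact, qint_one, sub_eq_add_neg]

theorem serre_two_expand {k A : Type} [Field k] [Ring A] [Algebra k A] {c : k} (hc : c ≠ 0)
    (x y : A) :
    c • ((-1 : k) ^ 0 • (y * c⁻¹ • (x * x)) + (-1 : k) ^ 1 • (x * (y * x)) +
      (-1 : k) ^ 2 • (c⁻¹ • (x * x) * y)) =
    x * x * y - c • (x * y * x) + y * x * x := by
  simp only [smul_mul_assoc, mul_smul_comm, mul_assoc]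
  match_scalars <;> field_simp

theorem serre_three_expand {k A : Type} [Field k] [Ring A] [Algebra k A] {c d : k} (hc : c ≠ 0)
    (hd : d ≠ 0) (x y : A) :
    (c * d) • ((-1 : k) ^ 0 • (y * (d * c)⁻¹ • (x * (x * x))) +
      (-1 : k) ^ 1 • (x * (y * c⁻¹ • (x * x))) + (-1 : k) ^ 2 • (c⁻¹ • (x * x) * (y * x)) +
      (-1 : k) ^ 3 • ((d * c)⁻¹ • (x * (x * x)) * y)) =
    y * x * x * x - d • (x * y * x * x) + d • (x * x * y * x) - x * x * x * y := by
  simp only [smul_mul_assoc, mul_smul_comm, mul_assoc]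
  match_scalars <;> field_simp

theorem dp_zero (x : A) : dp x 0 = 1 := by simp [dp, qfact]

theorem dp_one (x : A) : dp x 1 = x := by simp [dp, qfact, qint_one]

theorem dp_two (x : A) : dp x 2 = (qint 2)⁻¹ • (x * x) := by simp [dp, qfact_two, pow_two]

theorem dp_three (x : A) : dp x 3 = (qint 3 * qint 2)⁻¹ • (x * (x * x)) := by
  simp [dp, show qfact 3 = qint 3 * qfact 2 from rfl, qfact_two, pow_succ, mul_assoc]

theorem serreSum_two (x y : A) : qint 2 • serreSum x y 2 =
    x * x * y - (vv + vv⁻¹) • (x * y * x) + y * x * x := by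
  rw [← qint_two, ← serre_two_expand (qint_ne_zero (by norm_num))]
  simp only [serreSum, Finset.sum_range_succ, Finset.range_zero, Finset.sum_empty, dp_zero,
    dp_one, dp_two, Nat.sub_zero, Nat.sub_self, show 2 - 1 = 1 from rfl, one_mul, mul_one,
    zero_add, mul_assoc]

theorem serreSum_three (x y : A) : (qint 2 * qint 3) • serreSum x y 3 =
    y * x * x * x - (vv ^ 2 + 1 + (vv⁻¹) ^ 2) • (x * y * x * x) +
      (vv ^ 2 + 1 + (vv⁻¹) ^ 2) • (x * x * y * x) - x * x * x * y := by
  rw [← qint_three, ← serre_three_expand (qint_ne_zero (a := 2) (by norm_num)) (qint_ne_zero (by norm_num))]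
  simp only [serreSum, Finset.sum_range_succ, Finset.range_zero, Finset.sum_empty, dp_zero,
    dp_one, dp_two, dp_three, Nat.sub_zero, Nat.sub_self, show 3 - 1 = 2 from rfl,
    show 3 - 2 = 1 from rfl, one_mul, mul_one, zero_add, mul_assoc]

theorem serreSum_one_eq_zero {x y : A} : serreSum x y 1 = 0 ↔ x * y = y * x := by
  rw [serreSum_one, sub_eq_zero, eq_comm]

theorem serreSum_two_eq_zero {x y : A} : serreSum x y 2 = 0 ↔
    x * x * y - (vv + vv⁻¹) • (x * y * x) + y * x * x = 0 := by
  rw [← serreSum_two, smul_eq_zero_iff_right (qint_ne_zero (by norm_num))]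

theorem serreSum_three_eq_zero {x y : A} : serreSum x y 3 = 0 ↔
    y * x * x * x - (vv ^ 2 + 1 + (vv⁻¹) ^ 2) • (x * y * x * x) +
      (vv ^ 2 + 1 + (vv⁻¹) ^ 2) • (x * x * y * x) - x * x * x * y = 0 := by
  rw [← serreSum_three, smul_eq_zero_iff_right
    (mul_ne_zero (qint_ne_zero (by norm_num)) (qint_ne_zero (by norm_num)))]

theorem serreSum_smul (a b : Qv) (x y : A) (s : ℕ) :
    serreSum (a • x) (b • y) s = (a ^ s * b) • serreSum x y s := by
  rw [serreSum, serreSum, Finset.smul_sum]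
  refine Finset.sum_congr rfl fun p hp => ?_
  have h : a ^ s = a ^ p * a ^ (s - p) := by
    rw [← pow_add, Nat.add_sub_cancel' (Nat.lt_succ_iff.mp (Finset.mem_range.mp hp))]
  simp only [dp, smul_pow, smul_mul_assoc, mul_smul_comm, smul_smul, h]
  congr 1
  ring

/-- The relations of `U m` for families in an algebra. -/
structure URep (m : ℕ) {A : Type} [Ring A] [Algebra Qv A] (E F K K' : ZMod m → A) : Prop where
  KK : ∀ i j, K i * K j = K j * K i
  KK' : ∀ i, K i * K' i = 1
  K'K : ∀ i, K' i * K i = 1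
  KE : ∀ i j, K i * E j = vv ^ cartan i j • (E j * K i)
  KF : ∀ i j, K i * F j = vv ^ (-cartan i j) • (F j * K i)
  EF : ∀ i j, E i * F j - F j * E i = if i = j then (vv - vv⁻¹)⁻¹ • (K i - K' i) else 0
  serreE : ∀ i j, i ≠ j → serreSum (E i) (E j) (1 - cartan i j).toNat = 0
  serreF : ∀ i j, i ≠ j → serreSum (F i) (F j) (1 - cartan i j).toNat = 0

end Serre

theorem U_urep (m : ℕ) : URep m (UE (m := m)) UF UK UKinv := by
  have h : ∀ {x y : FA m}, URel m x y →
      RingQuot.mkAlgHom Qv (URel m) x = RingQuot.mkAlgHom Qv (URel m) y :=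
    fun hxy => RingQuot.mkAlgHom_rel Qv hxy
  constructor
  · intro i j; simpa [UK] using h (URel.KK i j)
  · intro i; simpa [UK, UKinv] using h (URel.KKinv i)
  · intro i; simpa [UK, UKinv] using h (URel.KinvK i)
  · intro i j; simpa [UK, UE] using h (URel.KE i j)
  · intro i j; simpa only [UK, UF, map_mul, map_smul] using h (URel.KF i j)
  · intro i j
    have := h (URel.EF i j)
    split_ifs with hij
    · simpa only [UK, UF, UE, UKinv, map_mul, map_smul, map_sub, if_pos hij] using this
    · simpa only [UK, UF, UE, UKinv, map_mul, map_smul, map_sub, if_neg hij, map_zero] using this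
  · intro i j hij
    rw [UE, UE, ← serreSum_map]
    exact (h (URel.serreE i j hij)).trans (map_zero _)
  · intro i j hij
    rw [UF, UF, ← serreSum_map]
    exact (h (URel.serreF i j hij)).trans (map_zero _)

section Lift

variable {m : ℕ} {A : Type} [Ring A] [Algebra Qv A] {E F K K' : ZMod m → A}

/-- The map on free generators attached to families. -/
def genMap (E F K K' : ZMod m → A) : Gen m → A
  | Gen.E i => E i
  | Gen.F i => F i
  | Gen.K i => K i
  | Gen.Kinv i => K' i

/-- The algebra homomorphism attached to families satisfying the relations. -/
def ulift (h : URep m E F K K') : U m →ₐ[Qv] A :=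
  RingQuot.liftAlgHom Qv ⟨FreeAlgebra.lift Qv (genMap E F K K'), by
    have hE : ∀ i, FreeAlgebra.lift Qv (genMap E F K K') (fE i) = E i := fun i => by
      simp [fE, genMap]
    have hF : ∀ i, FreeAlgebra.lift Qv (genMap E F K K') (fF i) = F i := fun i => by
      simp [fF, genMap]
    have hK : ∀ i, FreeAlgebra.lift Qv (genMap E F K K') (fK i) = K i := fun i => by
      simp [fK, genMap]
    have hK' : ∀ i, FreeAlgebra.lift Qv (genMap E F K K') (fKinv i) = K' i := fun i => by
      simp [fKinv, genMap]
    intro x y hxy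
    induction hxy with
    | KK i j => simpa only [map_mul, hK] using h.KK i j
    | KKinv i => simpa only [map_mul, hK, hK', map_one] using h.KK' i
    | KinvK i => simpa only [map_mul, hK, hK', map_one] using h.K'K i
    | KE i j => simpa only [map_mul, map_smul, hK, hE] using h.KE i j
    | KF i j => simpa only [map_mul, map_smul, hK, hF] using h.KF i j
    | EF i j =>
      have := h.EF i j
      split_ifs at this ⊢ with hij
      · simpa only [map_mul, map_smul, map_sub, hK, hK', hF, hE] using this
      · simpa only [map_mul, map_smul, map_sub, map_zero, hF, hE] using this
    | serreE i j hij =>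
      have := serreSum_map (FreeAlgebra.lift Qv (genMap E F K K')) (fE i) (fE j)
        (1 - cartan i j).toNat
      rw [hE, hE, h.serreE i j hij] at this
      rw [map_zero]
      exact this
    | serreF i j hij =>
      have := serreSum_map (FreeAlgebra.lift Qv (genMap E F K K')) (fF i) (fF j)
        (1 - cartan i j).toNat
      rw [hF, hF, h.serreF i j hij] at this
      rw [map_zero]
      exact this⟩

@[simp] theorem ulift_E (h : URep m E F K K') (i : ZMod m) : ulift h (UE i) = E i := by
  simp [ulift, UE, fE, genMap]

@[simp] theorem ulift_F (h : URep m E F K K') (i : ZMod m) : ulift h (UF i) = F i := by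
  simp [ulift, UF, fF, genMap]

@[simp] theorem ulift_K (h : URep m E F K K') (i : ZMod m) : ulift h (UK i) = K i := by
  simp [ulift, UK, fK, genMap]

@[simp] theorem ulift_Kinv (h : URep m E F K K') (i : ZMod m) : ulift h (UKinv i) = K' i := by
  simp [ulift, UKinv, fKinv, genMap]

theorem U_hom_ext {f g : U m →ₐ[Qv] A} (hE : ∀ i, f (UE i) = g (UE i))
    (hF : ∀ i, f (UF i) = g (UF i)) (hK : ∀ i, f (UK i) = g (UK i))
    (hK' : ∀ i, f (UKinv i) = g (UKinv i)) : f = g := by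
  refine RingQuot.ringQuot_ext' _ _ _ (FreeAlgebra.hom_ext (funext fun x => ?_))
  cases x with
  | E i => exact hE i
  | F i => exact hF i
  | K i => exact hK i
  | Kinv i => exact hK' i

theorem URep.map {B : Type} [Ring B] [Algebra Qv B] (h : URep m E F K K') (f : A →ₐ[Qv] B) :
    URep m (fun i => f (E i)) (fun i => f (F i)) (fun i => f (K i)) (fun i => f (K' i)) where
  KK i j := by rw [← map_mul, h.KK, map_mul]
  KK' i := by rw [← map_mul, h.KK', map_one]
  K'K i := by rw [← map_mul, h.K'K, map_one]
  KE i j := by rw [← map_mul, h.KE, map_smul, map_mul]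
  KF i j := by rw [← map_mul, h.KF, map_smul, map_mul]
  EF i j := by
    rw [← map_mul, ← map_mul, ← map_sub, h.EF]
    split_ifs
    · rw [map_smul, map_sub]
    · rw [map_zero]
  serreE i j hij := by rw [← serreSum_map, h.serreE i j hij, map_zero]
  serreF i j hij := by rw [← serreSum_map, h.serreF i j hij, map_zero]

end Lift

/-! ### Folding two adjacent nodes -/

section Fold

variable {k A : Type} [Field k] [Ring A] [Algebra k A]

/-- The order-two quantum Serre polynomial with coefficient `c`. -/
def s2 (c : k) (x y : A) : A := x * x * y - c • (x * y * x) + y * x * x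

/-- The order-three quantum Serre polynomial with coefficient `c`. -/
def s3 (c : k) (x y : A) : A :=
  y * x * x * x - c • (x * y * x * x) + c • (x * x * y * x) - x * x * x * y

theorem fold_comm_left {q : k} (hq : q ≠ 0) {a b : A} (hab : s2 (q + q⁻¹) a b = 0) :
    a * (a * b - q • (b * a)) = q⁻¹ • ((a * b - q • (b * a)) * a) := by
  rw [← sub_eq_zero, ← hab, s2]
  simp only [mul_sub, sub_mul, smul_mul_assoc, mul_smul_comm, mul_assoc, smul_sub, smul_smul]
  match_scalars <;> field_simp
  ring

theorem fold_comm_right {q : k} (hq : q ≠ 0) {a b : A} (hba : s2 (q + q⁻¹) b a = 0) :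
    b * (a * b - q • (b * a)) = q • ((a * b - q • (b * a)) * b) := by
  have h : -q • s2 (q + q⁻¹) b a = 0 := by rw [hba, smul_zero]
  rw [← sub_eq_zero, ← h, s2]
  simp only [mul_sub, sub_mul, smul_mul_assoc, mul_smul_comm, mul_assoc, smul_sub, smul_smul]
  match_scalars <;> field_simp
  ring

theorem fold_s2_right {q : k} {a b z : A} (hza : s2 (q + q⁻¹) z a = 0) (hzb : z * b = b * z) :
    s2 (q + q⁻¹) z (a * b - q • (b * a)) = 0 := by
  have h1 : s2 (q + q⁻¹) z a * b - q • (b * s2 (q + q⁻¹) z a) = 0 := by simp [hza]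
  have hzb' : ∀ w, z * (b * w) = b * (z * w) := fun w => by rw [← mul_assoc, hzb, mul_assoc]
  rw [← h1, s2, s2]
  simp only [mul_sub, sub_mul, mul_add, add_mul, smul_mul_assoc, mul_smul_comm, mul_assoc, hzb, hzb']
  match_scalars <;> ring

theorem fold_s2_left {q : k} (hq : q ≠ 0) (hq2 : q ^ 2 + 1 ≠ 0) {a b z : A}
    (hba : s2 (q + q⁻¹) b a = 0)
    (haz : s2 (q + q⁻¹) a z = 0) (hzb : z * b = b * z) :
    s2 (q + q⁻¹) (a * b - q • (b * a)) z = 0 := by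
  have hby := fold_comm_right hq hba
  have hyb : (a * b - q • (b * a)) * b = q⁻¹ • (b * (a * b - q • (b * a))) := by
    rw [hby, smul_smul, inv_mul_cancel₀ hq, one_smul]
  obtain ⟨y, hy⟩ : ∃ y, y = a * b - q • (b * a) := ⟨_, rfl⟩
  have hab' : a * b = y + q • (b * a) := by rw [hy]; abel
  rw [← hy] at hyb ⊢
  have hzb' : ∀ w, z * (b * w) = b * (z * w) := fun w => by rw [← mul_assoc, hzb, mul_assoc]
  have hyb' : ∀ w, y * (b * w) = q⁻¹ • (b * (y * w)) := fun w => by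
    rw [← mul_assoc, hyb, smul_mul_assoc, mul_assoc]
  have hab'' : ∀ w, a * (b * w) = y * w + q • (b * (a * w)) := fun w => by
    rw [← mul_assoc, hab', add_mul, smul_mul_assoc, mul_assoc]
  have h1 : (q + q⁻¹)⁻¹ • (s2 (q + q⁻¹) a z * b * b - q ^ 2 • (b * s2 (q + q⁻¹) a z * b) -
      (b * s2 (q + q⁻¹) a z * b) + q ^ 2 • (b * b * s2 (q + q⁻¹) a z)) = 0 := by simp [haz]
  have hc : q + q⁻¹ ≠ 0 := by
    intro h
    apply hq2
    field_simp at h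
    simpa using h
  rw [← h1, s2, s2]
  simp only [mul_sub, sub_mul, mul_add, add_mul, smul_mul_assoc, mul_smul_comm, mul_assoc, hzb, hzb',
    hyb, hyb', hab', hab'', smul_add, smul_sub, smul_smul]
  match_scalars <;> field_simp <;> ring

theorem fold_s3_right {q : k} (hq : q ≠ 0) {a b z : A} (hza : s2 (q + q⁻¹) z a = 0)
    (hzb : s2 (q + q⁻¹) z b = 0) :
    s3 (q ^ 2 + 1 + q⁻¹ ^ 2) z (a * b - q • (b * a)) = 0 := by
  have hc : q ^ 2 + 1 + q⁻¹ ^ 2 = (q + q⁻¹) ^ 2 - 1 := by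
    field_simp
    ring
  have key : ∀ (c : k) {x y : A}, s2 c z x = 0 → s2 c z y = 0 → s3 (c ^ 2 - 1) z (x * y) = 0 := by
    intro c x y hx hy
    have h : -(z * s2 c z x * y + c • (s2 c z x * z * y) - (c ^ 2 - 1) • (s2 c z x * y * z) +
      (c ^ 2 - 1) • (z * x * s2 c z y) - c • (x * z * s2 c z y) - x * s2 c z y * z) = 0 := by
      simp [hx, hy]
    rw [← h, s2, s2, s3]
    simp only [mul_sub, sub_mul, mul_add, add_mul, smul_mul_assoc, mul_smul_comm, mul_assoc]
    match_scalars <;> ring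
  have h1 := key _ hza hzb
  have h2 := key _ hzb hza
  rw [hc]
  have h : s3 ((q + q⁻¹) ^ 2 - 1) z (a * b) - q • s3 ((q + q⁻¹) ^ 2 - 1) z (b * a) = 0 := by
    simp [h1, h2]
  rw [← h, s3, s3, s3]
  simp only [mul_sub, sub_mul, smul_mul_assoc, mul_smul_comm, mul_assoc]
  match_scalars <;> ring

theorem fold_EF {v κ q : k} (hv : v ≠ 0) (hκ : κ * (v - v⁻¹) = 1) (hq : q = v ∨ q = v⁻¹)
    {a b a' b' s s' t t' : A}
    (ha : a * a' = a' * a + κ • (s - s')) (hb : b * b' = b' * b + κ • (t - t'))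
    (hab' : a * b' = b' * a) (hba' : b * a' = a' * b)
    (hst : s * t = t * s) (hst' : s' * t' = t' * s')
    (hs't : s' * t = t * s') (hst'' : s * t' = t' * s)
    (hsb : s * b = v⁻¹ • (b * s)) (hta : t * a = v⁻¹ • (a * t))
    (hsb' : s' * b = v • (b * s')) (hta' : t' * a = v • (a * t'))
    (hsB : s * b' = v • (b' * s)) (htA : t * a' = v • (a' * t))
    (hsB' : s' * b' = v⁻¹ • (b' * s')) (htA' : t' * a' = v⁻¹ • (a' * t')) :
    (a * b - q • (b * a)) * (b' * a' - q⁻¹ • (a' * b')) -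
      (b' * a' - q⁻¹ • (a' * b')) * (a * b - q • (b * a)) = κ • (s * t - s' * t') := by
  have hq0 : q ≠ 0 := by rcases hq with rfl | rfl <;> simp [hv]
  have ext : ∀ {x y u w : A} {c : k}, x * y = c • (u * w) → ∀ X, x * (y * X) = c • (u * (w * X)) :=
    fun h X => by rw [← mul_assoc, h, smul_mul_assoc, mul_assoc]
  have ha2 : ∀ X, a * (a' * X) = a' * (a * X) + κ • (s * X - s' * X) := fun X => by
    rw [← mul_assoc, ha, add_mul, smul_mul_assoc, sub_mul, mul_assoc]
  have hb2 : ∀ X, b * (b' * X) = b' * (b * X) + κ • (t * X - t' * X) := fun X => by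
    rw [← mul_assoc, hb, add_mul, smul_mul_assoc, sub_mul, mul_assoc]
  have hab2 : ∀ X, a * (b' * X) = b' * (a * X) := fun X => by rw [← mul_assoc, hab', mul_assoc]
  have hba2 : ∀ X, b * (a' * X) = a' * (b * X) := fun X => by rw [← mul_assoc, hba', mul_assoc]
  simp only [mul_sub, sub_mul, mul_add, smul_mul_assoc, mul_smul_comm, mul_assoc, ha, ha2,
    hb, hb2, hab', hab2, hba', hba2, hsb, hta, hsb', hta',
    hsB, ext hsB, htA, ext htA, hsB', ext hsB', htA', ext htA', smul_add, smul_sub, smul_smul,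
    ← hst, ← hst', ← hs't, ← hst'']
  have hv2 : v ^ 2 - 1 ≠ 0 := by
    intro h
    field_simp at hκ
    rw [h, mul_zero] at hκ
    exact hv hκ.symm
  have hκ' : κ = v / (v ^ 2 - 1) := by
    rw [eq_div_iff hv2]
    field_simp at hκ
    exact hκ
  subst hκ'
  rcases hq with rfl | rfl <;> match_scalars <;> field_simp <;> ring

end Fold

section Fold

variable {k A : Type} [Field k] [Ring A] [Algebra k A]

set_option maxHeartbeats 4000000 in
theorem fold_s3_left {q : k} (hq : q ≠ 0) (hq2 : q ^ 2 + 1 ≠ 0) (hq4 : q ^ 4 + q ^ 2 + 1 ≠ 0)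
    {a b z : A} (hab : s2 (q + q⁻¹) a b = 0) (hba : s2 (q + q⁻¹) b a = 0)
    (haz : s2 (q + q⁻¹) a z = 0) (hbz : s2 (q + q⁻¹) b z = 0) :
    s3 (q ^ 2 + 1 + q⁻¹ ^ 2) (a * b - q • (b * a)) z = 0 := by
  have hay := fold_comm_left hq hab
  have hby := fold_comm_right hq hba
  obtain ⟨y, hy⟩ : ∃ y, y = a * b - q • (b * a) := ⟨_, rfl⟩
  have hab' : a * b = y + q • (b * a) := by rw [hy]; abel
  rw [← hy] at hay hby ⊢
  have hay' : ∀ w, a * (y * w) = q⁻¹ • (y * (a * w)) := fun w => by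
    rw [← mul_assoc, hay, smul_mul_assoc, mul_assoc]
  have hby' : ∀ w, b * (y * w) = q • (y * (b * w)) := fun w => by
    rw [← mul_assoc, hby, smul_mul_assoc, mul_assoc]
  have hab'' : ∀ w, a * (b * w) = y * w + q • (b * (a * w)) := fun w => by
    rw [← mul_assoc, hab', add_mul, smul_mul_assoc, mul_assoc]
  have hD : q * (1 + q ^ 2) * (1 + q ^ 2 + q ^ 4) ≠ 0 :=
    mul_ne_zero (mul_ne_zero hq (by rwa [add_comm])) (by convert hq4 using 1; ring)
  rw [← smul_eq_zero_iff_right hD]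
  have h : (-q ^ 3 - q ^ 5) • (s2 (q + q⁻¹) a z * b * b * b * a) +
      (q ^ 4 + q ^ 6 + q ^ 8) • (s2 (q + q⁻¹) a z * y * b * b) +
      (q ^ 2 + 2 * q ^ 4 + 2 * q ^ 6 + q ^ 8) • (b * s2 (q + q⁻¹) a z * b * b * a) +
      (-q ^ 4 - 2 * q ^ 6 - 2 * q ^ 8 - q ^ 10) • (b * s2 (q + q⁻¹) a z * y * b) +
      (-q ^ 3 - 2 * q ^ 5 - 2 * q ^ 7 - q ^ 9) • (b * b * s2 (q + q⁻¹) a z * b * a) +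
      (q ^ 6 + q ^ 8 + q ^ 10) • (b * b * s2 (q + q⁻¹) a z * y) +
      (q ^ 6 + q ^ 8) • (b * b * b * s2 (q + q⁻¹) a z * a) +
      (q ^ 3 + q ^ 5) • (a * s2 (q + q⁻¹) a z * b * b * b) +
      (-q ^ 3 - 2 * q ^ 5 - 2 * q ^ 7 - q ^ 9) • (b * a * s2 (q + q⁻¹) a z * b * b) +
      (-1 - 2 * q ^ 2 - 3 * q ^ 4 - 2 * q ^ 6 - q ^ 8) • (y * s2 (q + q⁻¹) a z * b * b) +
      (q ^ 5 + 2 * q ^ 7 + 2 * q ^ 9 + q ^ 11) • (b * b * a * s2 (q + q⁻¹) a z * b) +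
      (q + 3 * q ^ 3 + 5 * q ^ 5 + 5 * q ^ 7 + 3 * q ^ 9 + q ^ 11) • (y * b * s2 (q + q⁻¹) a z * b) +
      (-q ^ 9 - q ^ 11) • (b * b * b * a * s2 (q + q⁻¹) a z) +
      (-q ^ 4 - 2 * q ^ 6 - 3 * q ^ 8 - 2 * q ^ 10 - q ^ 12) • (y * b * b * s2 (q + q⁻¹) a z) +
      (q ^ 9 + q ^ 11) • (s2 (q + q⁻¹) b z * b * a * a * a) +
      (q ^ 2 + 2 * q ^ 4 + 3 * q ^ 6 + 2 * q ^ 8 + q ^ 10) • (s2 (q + q⁻¹) b z * y * a * a) +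
      (-q ^ 6 - q ^ 8) • (b * s2 (q + q⁻¹) b z * a * a * a) +
      (-q ^ 5 - 2 * q ^ 7 - 2 * q ^ 9 - q ^ 11) • (a * s2 (q + q⁻¹) b z * b * a * a) +
      (-1 - 3 * q ^ 2 - 5 * q ^ 4 - 5 * q ^ 6 - 3 * q ^ 8 - q ^ 10) • (a * s2 (q + q⁻¹) b z * y * a) +
      (q ^ 3 + 2 * q ^ 5 + 2 * q ^ 7 + q ^ 9) • (b * a * s2 (q + q⁻¹) b z * a * a) +
      (-q ^ 6 - q ^ 8 - q ^ 10) • (y * s2 (q + q⁻¹) b z * a * a) +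
      (q ^ 3 + 2 * q ^ 5 + 2 * q ^ 7 + q ^ 9) • (a * a * s2 (q + q⁻¹) b z * b * a) +
      (1 + 2 * q ^ 2 + 3 * q ^ 4 + 2 * q ^ 6 + q ^ 8) • (a * a * s2 (q + q⁻¹) b z * y) +
      (-q ^ 2 - 2 * q ^ 4 - 2 * q ^ 6 - q ^ 8) • (b * a * a * s2 (q + q⁻¹) b z * a) +
      (q ^ 3 + 2 * q ^ 5 + 2 * q ^ 7 + q ^ 9) • (y * a * s2 (q + q⁻¹) b z * a) +
      (-q ^ 3 - q ^ 5) • (a * a * a * s2 (q + q⁻¹) b z * b) +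
      (q ^ 3 + q ^ 5) • (b * a * a * a * s2 (q + q⁻¹) b z) +
      (-q ^ 2 - q ^ 4 - q ^ 6) • (y * a * a * s2 (q + q⁻¹) b z) = 0 := by
    simp only [haz, hbz, mul_zero, zero_mul, smul_zero, add_zero]
  rw [← h, s2, s2, s3]
  simp only [mul_sub, sub_mul, mul_add, add_mul, smul_mul_assoc, mul_smul_comm, mul_assoc,
    hay, hay', hby, hby', hab', hab'', smul_add, smul_sub, smul_smul]
  match_scalars
  all_goals field_simp
  all_goals ring

end Fold

section FoldSerre

variable {A : Type} [Ring A] [Algebra Qv A]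

theorem serreSum_two_iff {x y : A} {q : Qv} (hq : q = vv ∨ q = vv⁻¹) :
    serreSum x y 2 = 0 ↔ s2 (q + q⁻¹) x y = 0 := by
  have : q + q⁻¹ = vv + vv⁻¹ := by rcases hq with rfl | rfl <;> simp [add_comm]
  rw [serreSum_two_eq_zero, s2, this]

theorem serreSum_three_iff {x y : A} {q : Qv} (hq : q = vv ∨ q = vv⁻¹) :
    serreSum x y 3 = 0 ↔ s3 (q ^ 2 + 1 + q⁻¹ ^ 2) x y = 0 := by
  have : q ^ 2 + 1 + q⁻¹ ^ 2 = vv ^ 2 + 1 + vv⁻¹ ^ 2 := by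
    rcases hq with rfl | rfl
    · rfl
    · rw [inv_inv]; ring
  rw [serreSum_three_eq_zero, s3, this]

theorem fold_swap {q : Qv} (hq : q ≠ 0) (a b : A) :
    a * b - q • (b * a) = -q • (b * a - q⁻¹ • (a * b)) := by
  rw [smul_sub, smul_smul, neg_mul, mul_inv_cancel₀ hq]
  simp only [neg_smul, one_smul]
  abel

theorem vv_aux {q : Qv} (hq : q = vv ∨ q = vv⁻¹) :
    q ≠ 0 ∧ q ^ 2 + 1 ≠ 0 ∧ q ^ 4 + q ^ 2 + 1 ≠ 0 := by
  have hv : ∀ k : ℤ, k ≠ 0 → q ^ k ≠ 1 := by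
    rcases hq with rfl | rfl
    · exact fun k hk => vv_zpow_ne_one hk
    · intro k hk
      rw [inv_zpow, ← zpow_neg]
      exact vv_zpow_ne_one (by omega)
  refine ⟨by rcases hq with rfl | rfl <;> simp [vv_ne_zero], fun h => ?_, fun h => ?_⟩
  · apply hv 4 (by norm_num)
    rw [show (4 : ℤ) = (4 : ℕ) from rfl, zpow_natCast]
    linear_combination (q ^ 2 - 1) * h
  · apply hv 6 (by norm_num)
    rw [show (6 : ℤ) = (6 : ℕ) from rfl, zpow_natCast]
    linear_combination (q ^ 2 - 1) * h

theorem fold_serre_one_right {q : Qv} (hq : q = vv ∨ q = vv⁻¹) {a b z : A}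
    (hza : serreSum z a 2 = 0) (hzb : serreSum z b 1 = 0) :
    serreSum z (a * b - q • (b * a)) 2 = 0 := by
  rw [serreSum_two_iff hq] at hza ⊢
  exact fold_s2_right hza (serreSum_one_eq_zero.mp hzb)

theorem fold_serre_one_left {q : Qv} (hq : q = vv ∨ q = vv⁻¹) {a b z : A}
    (hba : serreSum b a 2 = 0) (haz : serreSum a z 2 = 0) (hzb : serreSum z b 1 = 0) :
    serreSum (a * b - q • (b * a)) z 2 = 0 := by
  rw [serreSum_two_iff hq] at hba haz ⊢
  obtain ⟨h0, h2, -⟩ := vv_aux hq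
  exact fold_s2_left h0 h2 hba haz (serreSum_one_eq_zero.mp hzb)

/-- Serre relations between a folded pair of adjacent nodes and a third node. -/
theorem fold_serre {q : Qv} (hq : q = vv ∨ q = vv⁻¹) {a b z : A} {c d : ℕ}
    (hc : c = 1 ∨ c = 2) (hd : d = 1 ∨ d = 2)
    (hab : serreSum a b 2 = 0) (hba : serreSum b a 2 = 0)
    (haz : serreSum a z c = 0) (hza : serreSum z a c = 0)
    (hbz : serreSum b z d = 0) (hzb : serreSum z b d = 0) :
    serreSum (a * b - q • (b * a)) z (c + d - 1) = 0 ∧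
      serreSum z (a * b - q • (b * a)) (c + d - 1) = 0 := by
  obtain ⟨h0, h2, h4⟩ := vv_aux hq
  have hq' : q⁻¹ = vv ∨ q⁻¹ = vv⁻¹ := by
    rcases hq with rfl | rfl
    · exact Or.inr rfl
    · exact Or.inl (inv_inv _)
  rcases hc with rfl | rfl <;> rcases hd with rfl | rfl
  · rw [serreSum_one_eq_zero] at haz hbz
    have h : (a * b - q • (b * a)) * z = z * (a * b - q • (b * a)) := by
      rw [sub_mul, mul_sub, mul_assoc, hbz, ← mul_assoc, haz, mul_assoc, smul_mul_assoc,
        mul_smul_comm, mul_assoc, haz, ← mul_assoc b, hbz, mul_assoc]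
    exact ⟨serreSum_one_eq_zero.mpr h, serreSum_one_eq_zero.mpr h.symm⟩
  · rw [fold_swap h0]
    have h1 := fold_serre_one_left hq' hab hbz hza
    have h2 := fold_serre_one_right hq' hzb hza
    constructor
    · have := serreSum_smul (-q) 1 (b * a - q⁻¹ • (a * b)) z 2
      rwa [h1, smul_zero, one_smul] at this
    · have := serreSum_smul 1 (-q) z (b * a - q⁻¹ • (a * b)) 2
      rwa [h2, smul_zero, one_smul] at this
  · exact ⟨fold_serre_one_left hq hba haz hzb, fold_serre_one_right hq hza hzb⟩
  · rw [serreSum_two_iff hq] at *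
    exact ⟨(serreSum_three_iff hq).mpr (fold_s3_left h0 h2 h4 hab hba haz hbz),
      (serreSum_three_iff hq).mpr (fold_s3_right h0 hza hzb)⟩

end FoldSerre

/-! ### Node bookkeeping -/

theorem cartan_comm {m : ℕ} (i j : ZMod m) : cartan i j = cartan j i := by
  unfold cartan
  have h1 : (i = j) ↔ (j = i) := eq_comm
  have h2 : (i = j + 1) ↔ (j = i - 1) := by constructor <;> rintro rfl <;> ring
  have h3 : (i = j - 1) ↔ (j = i + 1) := by constructor <;> rintro rfl <;> ring
  simp only [h1, h2, h3]
  ring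

theorem natCast_eq_iff {m a b : ℕ} (ha : a < m) (hb : b < m) :
    ((a : ZMod m) = (b : ZMod m)) ↔ a = b := by
  rw [ZMod.natCast_eq_natCast_iff', Nat.mod_eq_of_lt ha, Nat.mod_eq_of_lt hb]

theorem natCast_eq_succ_iff {m a b : ℕ} (ha : a < m) (hb : b < m) :
    ((a : ZMod m) = (b : ZMod m) + 1) ↔ a = b + 1 ∨ (a = 0 ∧ b + 1 = m) := by
  rcases (Nat.succ_le_of_lt hb).lt_or_eq with h | h
  · have := natCast_eq_iff ha h
    push_cast at this
    rw [this]
    omega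
  · have h0 : ((b : ZMod m) + 1) = ((0 : ℕ) : ZMod m) := by
      rw [← Nat.cast_succ, h]; simp
    rw [h0, natCast_eq_iff ha (by omega)]
    omega

theorem cartan_natCast {m a b : ℕ} (ha : a < m) (hb : b < m) :
    cartan (a : ZMod m) (b : ZMod m) = (if a = b then 2 else 0) -
      (if a = b + 1 ∨ (a = 0 ∧ b + 1 = m) then 1 else 0) -
      (if b = a + 1 ∨ (b = 0 ∧ a + 1 = m) then 1 else 0) := by
  have h3 : ((a : ZMod m) = b - 1) ↔ ((b : ZMod m) = a + 1) := by
    constructor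
    · intro h; rw [h]; ring
    · intro h; rw [h]; ring
  simp only [cartan, h3, natCast_eq_iff ha hb, natCast_eq_succ_iff ha hb,
    natCast_eq_succ_iff hb ha]

/-- The position in `ℤ/(n+1)` of the node `i ≠ r` of `ℤ/n`. -/
def pos (r i : ℕ) : ℕ := if i ≤ r then i else i + 1

section Embedding

variable {n r : ℕ} (hn : 2 ≤ n) (hr : r ≤ n - 1)
include hn hr

theorem cartan_pos {i j : ℕ} (hi : i < n) (hj : j < n) (hir : i ≠ r) (hjr : j ≠ r) :
    cartan (pos r i : ZMod (n + 1)) (pos r j : ZMod (n + 1)) =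
      cartan (i : ZMod n) (j : ZMod n) := by
  have hp : ∀ {j}, j < n → pos r j < n + 1 := fun _ => by unfold pos; split_ifs <;> omega
  rw [cartan_natCast hi hj, cartan_natCast (hp hi) (hp hj)]
  have hp' : ∀ {j}, j ≠ r → (j < r ∧ pos r j = j) ∨ (r < j ∧ pos r j = j + 1) := fun h => by
    unfold pos; split_ifs <;> omega
  have h1 : (pos r i = pos r j) ↔ (i = j) := by
    rcases hp' hir with h | h <;> rcases hp' hjr with h' | h' <;> omega
  have key : ∀ {i j}, i < n → j < n → i ≠ r → j ≠ r →
      ((pos r i = pos r j + 1 ∨ (pos r i = 0 ∧ pos r j + 1 = n + 1)) ↔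
      (i = j + 1 ∨ (i = 0 ∧ j + 1 = n))) := by
    intro i j hi hj hir hjr
    rcases hp' hir with h | h <;> rcases hp' hjr with h' | h' <;> omega
  simp only [h1, key hi hj hir hjr, key hj hi hjr hir]

theorem cartan_pos_fold {j : ℕ} (hj : j < n) (hjr : j ≠ r) :
    cartan (r : ZMod (n + 1)) (pos r j : ZMod (n + 1)) +
        cartan ((r + 1 : ℕ) : ZMod (n + 1)) (pos r j : ZMod (n + 1)) =
      cartan (r : ZMod n) (j : ZMod n) ∧
    (cartan (r : ZMod (n + 1)) (pos r j : ZMod (n + 1)) = 0 ∨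
      cartan (r : ZMod (n + 1)) (pos r j : ZMod (n + 1)) = -1) ∧
    (cartan ((r + 1 : ℕ) : ZMod (n + 1)) (pos r j : ZMod (n + 1)) = 0 ∨
      cartan ((r + 1 : ℕ) : ZMod (n + 1)) (pos r j : ZMod (n + 1)) = -1) := by
  have hp : pos r j < n + 1 := by unfold pos; split_ifs <;> omega
  rw [cartan_natCast (show r < n by omega) hj, cartan_natCast (show r < n + 1 by omega) hp,
    cartan_natCast (show r + 1 < n + 1 by omega) hp]
  have hp' : (j < r ∧ pos r j = j) ∨ (r < j ∧ pos r j = j + 1) := by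
    unfold pos; split_ifs <;> omega
  have e1 : (r = pos r j + 1 ∨ (r = 0 ∧ pos r j + 1 = n + 1)) ↔
      (r = j + 1 ∨ (r = 0 ∧ j + 1 = n)) := by omega
  have e2 : ¬ (pos r j = r + 1 ∨ (pos r j = 0 ∧ r + 1 = n + 1)) := by omega
  have e3 : ¬ (r + 1 = pos r j + 1 ∨ (r + 1 = 0 ∧ pos r j + 1 = n + 1)) := by omega
  have e4 : (pos r j = r + 1 + 1 ∨ (pos r j = 0 ∧ r + 1 + 1 = n + 1)) ↔
      (j = r + 1 ∨ (j = 0 ∧ r + 1 = n)) := by omega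
  have e5 : r ≠ pos r j := by omega
  have e6 : r + 1 ≠ pos r j := by omega
  rw [if_neg e5, if_neg e6, if_neg e2, if_neg e3, if_neg hjr.symm]
  simp only [e1, e4]
  refine ⟨?_, ?_, ?_⟩ <;> split_ifs <;> simp

theorem cartan_fold :
    cartan (r : ZMod (n + 1)) ((r + 1 : ℕ) : ZMod (n + 1)) = -1 ∧
    cartan (r : ZMod (n + 1)) (r : ZMod (n + 1)) = 2 ∧
    cartan ((r + 1 : ℕ) : ZMod (n + 1)) ((r + 1 : ℕ) : ZMod (n + 1)) = 2 ∧
    cartan (r : ZMod n) (r : ZMod n) = 2 := by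
  rw [cartan_natCast (by omega) (by omega), cartan_natCast (by omega) (by omega),
    cartan_natCast (by omega) (by omega), cartan_natCast (by omega) (by omega)]
  rw [if_neg (by omega), if_neg (by omega), if_pos (by omega), if_pos rfl, if_neg (by omega),
    if_pos rfl, if_neg (by omega), if_neg (by omega)]
  simp

end Embedding

/-! ### The folded generators satisfy the relations -/

section QComm

variable {A : Type} [Ring A] [Algebra Qv A]

/-- `k` and `e` commute up to the scalar `v ^ c`. -/
def QComm (c : ℤ) (k e : A) : Prop := k * e = vv ^ c • (e * k)

theorem QComm.mul_right {c c' : ℤ} {k e e' : A} (h : QComm c k e) (h' : QComm c' k e') :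
    QComm (c + c') k (e * e') := by
  unfold QComm at *
  rw [← mul_assoc, h, smul_mul_assoc, mul_assoc, h', mul_smul_comm, smul_smul,
    ← zpow_add₀ vv_ne_zero, mul_assoc]

theorem QComm.mul_left {c c' : ℤ} {k k' e : A} (h : QComm c k e) (h' : QComm c' k' e) :
    QComm (c + c') (k * k') e := by
  unfold QComm at *
  rw [mul_assoc, h', mul_smul_comm, ← mul_assoc, h, smul_mul_assoc, smul_smul,
    ← zpow_add₀ vv_ne_zero, mul_assoc, add_comm]

theorem QComm.sub_smul {c : ℤ} {k e e' : A} (q : Qv) (h : QComm c k e) (h' : QComm c k e') :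
    QComm c k (e - q • e') := by
  unfold QComm at *
  rw [mul_sub, sub_mul, mul_smul_comm, h, h', smul_mul_assoc, smul_sub, smul_comm q]

theorem QComm.cast {c c' : ℤ} {k e : A} (h : QComm c k e) (hc : c = c') : QComm c' k e := hc ▸ h

theorem QComm.inv {c : ℤ} {k k' e : A} (h : QComm c k e) (hk : k * k' = 1) (hk' : k' * k = 1) :
    QComm (-c) k' e := by
  unfold QComm at *
  have : k' * (k * e) * k' = vv ^ c • (k' * (e * k) * k') := by
    rw [h, mul_smul_comm, smul_mul_assoc]
  rw [← mul_assoc k', hk', one_mul, ← mul_assoc, mul_assoc (k' * e), hk, mul_one] at this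
  rw [this, smul_smul, ← zpow_add₀ vv_ne_zero, neg_add_cancel, zpow_zero, one_smul]

end QComm

section Fold

variable {n r : ℕ} {ε : ℤ}

theorem eElt_of_ne {i : ZMod n} (h : i.val ≠ r) :
    eElt n r ε i = UE (pos r i.val : ZMod (n + 1)) := by
  unfold eElt pos
  rcases lt_or_gt_of_ne h with h | h
  · rw [if_pos h, if_pos h.le]
  · rw [if_neg h.not_gt, if_neg h.ne', if_neg h.not_ge]

theorem fElt_of_ne {i : ZMod n} (h : i.val ≠ r) :
    fElt n r ε i = UF (pos r i.val : ZMod (n + 1)) := by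
  unfold fElt pos
  rcases lt_or_gt_of_ne h with h | h
  · rw [if_pos h, if_pos h.le]
  · rw [if_neg h.not_gt, if_neg h.ne', if_neg h.not_ge]

theorem kElt_of_ne {i : ZMod n} (h : i.val ≠ r) :
    kElt n r i = UK (pos r i.val : ZMod (n + 1)) := by
  unfold kElt pos
  rcases lt_or_gt_of_ne h with h | h
  · rw [if_pos h, if_pos h.le]
  · rw [if_neg h.not_gt, if_neg h.ne', if_neg h.not_ge]

theorem kinvElt_of_ne {i : ZMod n} (h : i.val ≠ r) :
    kinvElt n r i = UKinv (pos r i.val : ZMod (n + 1)) := by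
  unfold kinvElt pos
  rcases lt_or_gt_of_ne h with h | h
  · rw [if_pos h, if_pos h.le]
  · rw [if_neg h.not_gt, if_neg h.ne', if_neg h.not_ge]

theorem eElt_fold {i : ZMod n} (h : i.val = r) :
    eElt n r ε i = UE (r : ZMod (n + 1)) * UE ((r + 1 : ℕ) : ZMod (n + 1)) -
      vv ^ ε • (UE ((r + 1 : ℕ) : ZMod (n + 1)) * UE (r : ZMod (n + 1))) := by
  rw [eElt, if_neg h.not_lt, if_pos h, er, Nat.cast_succ]

theorem fElt_fold {i : ZMod n} (h : i.val = r) :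
    fElt n r ε i = UF ((r + 1 : ℕ) : ZMod (n + 1)) * UF (r : ZMod (n + 1)) -
      vv ^ (-ε) • (UF (r : ZMod (n + 1)) * UF ((r + 1 : ℕ) : ZMod (n + 1))) := by
  rw [fElt, if_neg h.not_lt, if_pos h, fr, Nat.cast_succ]

theorem kElt_fold {i : ZMod n} (h : i.val = r) :
    kElt n r i = UK (r : ZMod (n + 1)) * UK ((r + 1 : ℕ) : ZMod (n + 1)) := by
  rw [kElt, if_neg h.not_lt, if_pos h, kr, Nat.cast_succ]

theorem kinvElt_fold {i : ZMod n} (h : i.val = r) :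
    kinvElt n r i = UKinv (r : ZMod (n + 1)) * UKinv ((r + 1 : ℕ) : ZMod (n + 1)) := by
  rw [kinvElt, if_neg h.not_lt, if_pos h, Nat.cast_succ]

end Fold

section URepLemmas

variable {m : ℕ} {A : Type} [Ring A] [Algebra Qv A] {E F K K' : ZMod m → A}

theorem URep.K'K_comm (h : URep m E F K K') (i j : ZMod m) : K' i * K j = K j * K' i :=
  calc K' i * K j = K' i * (K j * K i) * K' i := by rw [mul_assoc, mul_assoc, h.KK', mul_one]
    _ = K j * K' i := by rw [h.KK, ← mul_assoc (K' i), h.K'K, one_mul]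

theorem URep.Kinv_mul_comm (h : URep m E F K K') (i j : ZMod m) : K' i * K' j = K' j * K' i :=
  calc K' i * K' j = K' i * (K' j * K i) * K' i := by rw [mul_assoc, mul_assoc, h.KK', mul_one]
    _ = K' j * K' i := by rw [h.K'K_comm j i, ← mul_assoc (K' i), h.K'K, one_mul]

theorem URep.qKE (h : URep m E F K K') (i j : ZMod m) : QComm (cartan i j) (K i) (E j) := h.KE i j

theorem URep.qKF (h : URep m E F K K') (i j : ZMod m) : QComm (-cartan i j) (K i) (F j) := h.KF i j

theorem URep.qK'E (h : URep m E F K K') (i j : ZMod m) : QComm (-cartan i j) (K' i) (E j) :=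
  (h.qKE i j).inv (h.KK' i) (h.K'K i)

theorem URep.qK'F (h : URep m E F K K') (i j : ZMod m) : QComm (cartan i j) (K' i) (F j) :=
  ((h.qKF i j).inv (h.KK' i) (h.K'K i)).cast (neg_neg _)

theorem URep.EF_ne (h : URep m E F K K') {i j : ZMod m} (hij : i ≠ j) : E i * F j = F j * E i := by
  rw [← sub_eq_zero, h.EF, if_neg hij]

theorem URep.EF_self (h : URep m E F K K') (i : ZMod m) :
    E i * F i = F i * E i + (vv - vv⁻¹)⁻¹ • (K i - K' i) := by
  rw [← sub_eq_iff_eq_add', h.EF, if_pos rfl]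

end URepLemmas

theorem pos_cast_inj {n r i j : ℕ} (hi : i < n) (hj : j < n) :
    ((pos r i : ZMod (n + 1)) = (pos r j : ZMod (n + 1))) ↔ i = j := by
  have hp : ∀ {j}, j < n → pos r j < n + 1 := fun _ => by unfold pos; split_ifs <;> omega
  rw [natCast_eq_iff (hp hi) (hp hj)]
  unfold pos
  split_ifs <;> omega

section Exists

variable {n r : ℕ} {ε : ℤ} (hn : 2 ≤ n) (hr : r ≤ n - 1)
include hn hr

theorem pos_cast_ne {j : ℕ} (hj : j < n) (hjr : j ≠ r) :
    (r : ZMod (n + 1)) ≠ (pos r j : ZMod (n + 1)) ∧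
      ((r + 1 : ℕ) : ZMod (n + 1)) ≠ (pos r j : ZMod (n + 1)) := by
  have hp : pos r j < n + 1 := by unfold pos; split_ifs <;> omega
  rw [Ne, Ne, natCast_eq_iff (by omega) hp, natCast_eq_iff (by omega) hp]
  unfold pos
  split_ifs <;> omega

theorem fold_cast_ne : (r : ZMod (n + 1)) ≠ ((r + 1 : ℕ) : ZMod (n + 1)) := by
  rw [Ne, natCast_eq_iff (by omega) (by omega)]
  omega

theorem fold_qcomm {X Y : ZMod n → U (n + 1)} {x y : ZMod (n + 1) → U (n + 1)} {σ : ℤ}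
    {q : Qv}
    (hX : ∀ i, i.val ≠ r → X i = x (pos r i.val))
    (hXr : ∀ i, i.val = r → X i = x r * x (r + 1 : ℕ))
    (hY : ∀ i, i.val ≠ r → Y i = y (pos r i.val))
    (hYr : ∀ i, i.val = r → Y i = y r * y (r + 1 : ℕ) - q • (y (r + 1 : ℕ) * y r) ∨
      Y i = y (r + 1 : ℕ) * y r - q • (y r * y (r + 1 : ℕ)))
    (h : ∀ i j, QComm (σ * cartan i j) (x i) (y j)) (i j : ZMod n) :
    QComm (σ * cartan i j) (X i) (Y j) := by
  have : NeZero n := ⟨by omega⟩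
  obtain ⟨c1, c2, c3, c4⟩ := cartan_fold hn hr
  have hc := cartan_comm (r : ZMod (n + 1)) (r + 1 : ℕ)
  have e : ∀ i : ZMod n, ((i.val : ℕ) : ZMod n) = i := ZMod.natCast_zmod_val
  by_cases hi : i.val = r <;> by_cases hj : j.val = r
  · rw [hXr i hi]
    have key : ∀ s, s = (r : ZMod (n + 1)) ∨ s = ((r + 1 : ℕ) : ZMod (n + 1)) →
        QComm σ (x r * x (r + 1 : ℕ)) (y s) := by
      rintro s (rfl | rfl)
      · exact ((h _ _).mul_left (h _ _)).cast (by rw [c2, ← hc, c1]; ring)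
      · exact ((h _ _).mul_left (h _ _)).cast (by rw [c3, c1]; ring)
    have hcij : σ * cartan i j = σ + σ := by rw [← e i, ← e j, hi, hj, c4]; ring
    rw [hcij]
    rcases hYr j hj with h | h <;> rw [h] <;>
    exact QComm.sub_smul _ ((key _ (by simp)).mul_right (key _ (by simp)))
      ((key _ (by simp)).mul_right (key _ (by simp)))
  · obtain ⟨h1, -⟩ := cartan_pos_fold hn hr (ZMod.val_lt j) hj
    rw [hXr i hi, hY j hj]
    exact ((h _ _).mul_left (h _ _)).cast (by rw [← mul_add, h1, ← hi, e, e])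
  · obtain ⟨h1, -⟩ := cartan_pos_fold hn hr (ZMod.val_lt i) hi
    have hj' : (r : ZMod n) = j := by rw [← hj, e]
    rw [cartan_comm (r : ZMod (n + 1)), cartan_comm ((r + 1 : ℕ) : ZMod (n + 1)),
      cartan_comm (r : ZMod n), e, hj'] at h1
    rw [hX i hi]
    have h2 := h (pos r i.val) r
    have h3 := h (pos r i.val) (r + 1 : ℕ)
    rw [← h1, mul_add]
    rcases hYr j hj with h' | h' <;> rw [h']
    · exact (h2.mul_right h3).sub_smul _ ((h3.mul_right h2).cast (add_comm _ _))
    · exact ((h3.mul_right h2).cast (add_comm _ _)).sub_smul _ (h2.mul_right h3)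
  · rw [hX i hi, hY j hj]
    exact (h _ _).cast (by rw [cartan_pos hn hr (ZMod.val_lt i) (ZMod.val_lt j) hi hj, e, e])

theorem fold_serre_family {Y : ZMod n → U (n + 1)} {y : ZMod (n + 1) → U (n + 1)} {q : Qv}
    (hq : q = vv ∨ q = vv⁻¹)
    (hY : ∀ i, i.val ≠ r → Y i = y (pos r i.val))
    (hYr : ∀ i, i.val = r → Y i = y r * y (r + 1 : ℕ) - q • (y (r + 1 : ℕ) * y r) ∨
      Y i = y (r + 1 : ℕ) * y r - q • (y r * y (r + 1 : ℕ)))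
    (h : ∀ i j, i ≠ j → serreSum (y i) (y j) (1 - cartan i j).toNat = 0) (i j : ZMod n)
    (hij : i ≠ j) : serreSum (Y i) (Y j) (1 - cartan i j).toNat = 0 := by
  have : NeZero n := ⟨by omega⟩
  obtain ⟨c1, -⟩ := cartan_fold hn hr
  have hc := cartan_comm (r : ZMod (n + 1)) (r + 1 : ℕ)
  have e : ∀ i : ZMod n, ((i.val : ℕ) : ZMod n) = i := ZMod.natCast_zmod_val
  have hne := fold_cast_ne hn hr
  have hab := h _ _ hne
  have hba := h _ _ hne.symm
  rw [← hc, c1] at hba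
  rw [c1] at hab
  have key : ∀ i j : ZMod n, i.val = r → j.val ≠ r →
      serreSum (Y i) (Y j) (1 - cartan i j).toNat = 0 ∧
      serreSum (Y j) (Y i) (1 - cartan i j).toNat = 0 := by
    intro i j hi hj
    obtain ⟨h1, h2, h3⟩ := cartan_pos_fold hn hr (ZMod.val_lt j) hj
    obtain ⟨n1, n2⟩ := pos_cast_ne hn hr (ZMod.val_lt j) hj
    have haz := h _ _ n1
    have hza := h _ _ n1.symm
    have hbz := h _ _ n2
    have hzb := h _ _ n2.symm
    rw [cartan_comm] at hza hzb
    rw [e, ← hi, e, hi] at h1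
    have hcd : (1 - cartan i j).toNat =
      (1 - cartan (r : ZMod (n + 1)) (pos r j.val : ZMod (n + 1))).toNat +
      (1 - cartan ((r + 1 : ℕ) : ZMod (n + 1)) (pos r j.val : ZMod (n + 1))).toNat - 1 := by
      omega
    rw [hcd, hY j hj]
    rcases hYr i hi with h' | h' <;> rw [h']
    · exact fold_serre hq (by omega) (by omega) hab hba haz hza hbz hzb
    · rw [add_comm (1 - cartan (r : ZMod (n + 1)) (pos r j.val : ZMod (n + 1))).toNat]
      exact fold_serre hq (by omega) (by omega) hba hab hbz hzb haz hza
  by_cases hi : i.val = r <;> by_cases hj : j.val = r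
  · exact absurd (ZMod.val_injective n (hi.trans hj.symm)) hij
  · exact (key i j hi hj).1
  · rw [cartan_comm]
    exact (key j i hj hi).2
  · rw [hY i hi, hY j hj, ← e i, ← e j, ← cartan_pos hn hr (ZMod.val_lt i) (ZMod.val_lt j) hi hj]
    simp only [e]
    refine h _ _ fun h' => hij ?_
    rw [pos_cast_inj (ZMod.val_lt i) (ZMod.val_lt j)] at h'
    exact ZMod.val_injective n h'

theorem fold_urep (hε : ε = 1 ∨ ε = -1) :
    URep n (eElt n r ε) (fElt n r ε) (kElt n r) (kinvElt n r) := by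
  have : NeZero n := ⟨by omega⟩
  have hU := U_urep (n + 1)
  have hne := fold_cast_ne hn hr
  have hq : vv ^ ε = vv ∨ vv ^ ε = vv⁻¹ := by
    rcases hε with rfl | rfl
    · exact Or.inl (zpow_one _)
    · exact Or.inr (zpow_neg_one _)
  have hq' : vv ^ (-ε) = vv ∨ vv ^ (-ε) = vv⁻¹ := by
    rw [zpow_neg]
    rcases hq with h | h <;> rw [h] <;> simp
  have hKs : ∀ i, kElt n r i * kinvElt n r i = 1 ∧ kinvElt n r i * kElt n r i = 1 := by
    intro i
    by_cases hi : i.val = r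
    · rw [kElt_fold hi, kinvElt_fold hi]
      constructor
      · rw [hU.Kinv_mul_comm, mul_assoc, ← mul_assoc (UK ((r + 1 : ℕ) : ZMod (n + 1))), hU.KK', one_mul,
          hU.KK']
      · rw [hU.KK, mul_assoc, ← mul_assoc (UKinv ((r + 1 : ℕ) : ZMod (n + 1))), hU.K'K, one_mul,
          hU.K'K]
    · rw [kElt_of_ne hi, kinvElt_of_ne hi]
      exact ⟨hU.KK' _, hU.K'K _⟩
  constructor
  · have key : ∀ (x : U (n + 1)), (∀ i, Commute x (UK i)) → ∀ i, Commute x (kElt n r i) := by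
      intro x hx i
      by_cases hi : i.val = r
      · rw [kElt_fold hi]; exact (hx _).mul_right (hx _)
      · rw [kElt_of_ne hi]; exact hx _
    exact fun i j => key _ (fun l => (key _ (fun l' => hU.KK l l') i).symm) j
  · exact fun i => (hKs i).1
  · exact fun i => (hKs i).2
  · intro i j
    have := fold_qcomm hn hr (σ := 1) (X := kElt n r) (Y := eElt n r ε) (x := UK) (y := UE)
      (fun i hi => kElt_of_ne hi) (fun i hi => kElt_fold hi) (fun i hi => eElt_of_ne hi)
      (fun i hi => Or.inl (eElt_fold hi)) (fun i j => (hU.qKE i j).cast (one_mul _).symm) i j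
    exact this.cast (one_mul _)
  · intro i j
    have := fold_qcomm hn hr (σ := -1) (X := kElt n r) (Y := fElt n r ε) (x := UK) (y := UF)
      (fun i hi => kElt_of_ne hi) (fun i hi => kElt_fold hi) (fun i hi => fElt_of_ne hi)
      (fun i hi => Or.inr (fElt_fold hi)) (fun i j => (hU.qKF i j).cast (neg_one_mul _).symm) i j
    exact this.cast (neg_one_mul _)
  · intro i j
    by_cases hi : i.val = r <;> by_cases hj : j.val = r
    · rw [if_pos (ZMod.val_injective n (hi.trans hj.symm)), eElt_fold hi, fElt_fold hj,
        kElt_fold hi, kinvElt_fold hi, zpow_neg]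
      obtain ⟨c1, c2, c3, -⟩ := cartan_fold hn hr
      have c1' := cartan_comm (r : ZMod (n + 1)) (r + 1 : ℕ)
      rw [c1] at c1'
      refine fold_EF vv_ne_zero (inv_mul_cancel₀ vv_sub_inv_ne_zero) hq (hU.EF_self _)
        (hU.EF_self _) (hU.EF_ne hne) (hU.EF_ne hne.symm) (hU.KK _ _) (hU.Kinv_mul_comm _ _)
        (hU.K'K_comm _ _) (hU.K'K_comm _ _).symm ?_ ?_ ?_ ?_ ?_ ?_ ?_ ?_
      · rw [hU.KE, c1, zpow_neg_one]
      · rw [hU.KE, ← c1', zpow_neg_one]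
      · rw [hU.qK'E _ _, c1, neg_neg, zpow_one]
      · rw [hU.qK'E _ _, ← c1', neg_neg, zpow_one]
      · rw [hU.qKF _ _, c1, neg_neg, zpow_one]
      · rw [hU.qKF _ _, ← c1', neg_neg, zpow_one]
      · rw [hU.qK'F _ _, c1, zpow_neg_one]
      · rw [hU.qK'F _ _, ← c1', zpow_neg_one]
    · rw [if_neg (by rintro rfl; exact hj hi), eElt_fold hi, fElt_of_ne hj, sub_eq_zero]
      obtain ⟨n1, n2⟩ := pos_cast_ne hn hr (ZMod.val_lt j) hj
      have h1 : Commute (UE (r : ZMod (n + 1))) _ := hU.EF_ne n1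
      have h2 : Commute (UE ((r + 1 : ℕ) : ZMod (n + 1))) _ := hU.EF_ne n2
      exact (h1.mul_left h2).sub_left ((h2.mul_left h1).smul_left _)
    · rw [if_neg (by rintro rfl; exact hi hj), eElt_of_ne hi, fElt_fold hj, sub_eq_zero]
      obtain ⟨n1, n2⟩ := pos_cast_ne hn hr (ZMod.val_lt i) hi
      have h1 : Commute _ (UF (r : ZMod (n + 1))) := hU.EF_ne n1.symm
      have h2 : Commute _ (UF ((r + 1 : ℕ) : ZMod (n + 1))) := hU.EF_ne n2.symm
      exact (h2.mul_right h1).sub_right ((h1.mul_right h2).smul_right _)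
    · have hij : i = j ↔ i.val = j.val := (ZMod.val_injective n).eq_iff.symm
      rw [eElt_of_ne hi, fElt_of_ne hj, kElt_of_ne hi, kinvElt_of_ne hi, hU.EF]
      simp only [hij, pos_cast_inj (ZMod.val_lt i) (ZMod.val_lt j)]
  · exact fold_serre_family hn hr hq (fun i hi => eElt_of_ne hi)
      (fun i hi => Or.inl (eElt_fold hi)) hU.serreE
  · exact fold_serre_family hn hr hq' (fun i hi => fElt_of_ne hi)
      (fun i hi => Or.inr (fElt_fold hi)) hU.serreF

end Exists

/-! ### Classical root vectors -/

section RootVectors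

/-- The classical Serre relations of the cyclic quiver with `n` vertices. -/
structure ClSerre (n : ℕ) {L : Type} [LieRing L] (E : ZMod n → L) : Prop where
  far : ∀ i j, j ≠ i → j ≠ i + 1 → i ≠ j + 1 → ⁅E i, E j⁆ = 0
  left : 3 ≤ n → ∀ i, ⁅E i, ⁅E i, E (i + 1)⁆⁆ = 0
  right : 3 ≤ n → ∀ i, ⁅E (i + 1), ⁅E i, E (i + 1)⁆⁆ = 0
  cubic : n = 2 → ∀ i, ⁅E i, ⁅E i, ⁅E i, E (i + 1)⁆⁆⁆ = 0

variable {n : ℕ} {L : Type} [LieRing L]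

theorem ite_zero_lie (p : Prop) [Decidable p] (x y : L) :
    ⁅if p then x else 0, y⁆ = if p then ⁅x, y⁆ else 0 := by
  split_ifs
  · rfl
  · exact zero_lie y

theorem lie_ite_zero (p : Prop) [Decidable p] (x y : L) :
    ⁅x, if p then y else 0⁆ = if p then ⁅x, y⁆ else 0 := by
  split_ifs
  · rfl
  · exact lie_zero x

theorem ite_bracket_identity {G : Type} [AddCommGroup G] {A B C D Z p₁ p₂ p₃ p₄ p₅ p₆ : Prop}
    [Decidable A] [Decidable B] [Decidable C] [Decidable D] [Decidable Z] [Decidable p₁]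
    [Decidable p₂] [Decidable p₃] [Decidable p₄] [Decidable p₅] [Decidable p₆]
    (r₁ : A → (p₁ ↔ D)) (r₂ : B → (p₂ ↔ Z)) (r₃ : C → (p₃ ↔ Z)) (r₄ : C → (p₄ ↔ B)) (r₅ : D → p₅)
    (r₆ : Z → (p₆ ↔ C)) (x y z : G) :
    ((if A then x - if p₁ then y else 0 else 0) -
        if B then (if C then x else 0) - if p₂ then z else 0 else 0) -
      ((if C then (if p₃ then y else 0) - if p₄ then x else 0 else 0) -
        if D then (if A then y else 0) - if p₅ then z else 0 else 0) =
    ((if A then x else 0) - if D then z else 0) -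
      if Z then (if p₆ then y else 0) - if B then z else 0 else 0 := by
  by_cases hA : A <;> by_cases hB : B <;> by_cases hC : C <;> by_cases hD : D <;>
    by_cases hZ : Z <;> simp_all <;> abel

variable [LieAlgebra ℚ L]

/-- The normalisation `ℓ - 1 + [n ∣ ℓ]`. -/
def lam (n ℓ : ℕ) : ℚ := (ℓ : ℚ) - 1 + if (ℓ : ZMod n) = 0 then 1 else 0

/-- The root vector of length `ℓ` starting at `i`. -/
def rootX (E : ZMod n → L) (ℓ : ℕ) (i : ZMod n) : L :=
  if ℓ ≤ 1 then E i else (lam n ℓ)⁻¹ • ∑ d ∈ (Finset.Ico 1 ℓ).attach,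
    ⁅rootX E d.1 i, rootX E (ℓ - d.1) (i + (d.1 : ℕ))⁆
termination_by ℓ
decreasing_by
  · exact (Finset.mem_Ico.mp d.2).2
  · have := Finset.mem_Ico.mp d.2; omega

variable (E : ZMod n → L)

theorem rootX_one (i : ZMod n) : rootX E 1 i = E i := by
  rw [rootX, if_pos le_rfl]

theorem lam_ne_zero {ℓ : ℕ} (hℓ : 2 ≤ ℓ) : lam n ℓ ≠ 0 := by
  have : (2 : ℚ) ≤ ℓ := by exact_mod_cast hℓ
  unfold lam
  split_ifs <;> linarith

theorem lam_smul_rootX {ℓ : ℕ} (hℓ : 2 ≤ ℓ) (i : ZMod n) :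
    lam n ℓ • rootX E ℓ i =
      ∑ d ∈ Finset.Ico 1 ℓ, ⁅rootX E d i, rootX E (ℓ - d) (i + (d : ℕ))⁆ := by
  rw [rootX, if_neg (by omega), smul_smul, mul_inv_cancel₀ (lam_ne_zero hℓ), one_smul,
    Finset.sum_attach (Finset.Ico 1 ℓ)
      (fun d => ⁅rootX E d i, rootX E (ℓ - d) (i + (d : ℕ))⁆)]

/-- The expected bracket of two root vectors. -/
def rootB (a b : ℕ) (i j : ZMod n) : L :=
  (if i + a = j then rootX E (a + b) i else 0) - (if j + b = i then rootX E (a + b) j else 0)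

theorem rootX_sum [NeZero n] (hn : 2 ≤ n) {ℓ : ℕ} (hℓ : 1 ≤ ℓ) (h : (ℓ : ZMod n) = 0) :
    ∑ i, rootX E ℓ i = 0 := by
  have h2 : 2 ≤ ℓ := by
    by_contra h'
    obtain rfl : ℓ = 1 := by omega
    rw [ZMod.natCast_eq_zero_iff, Nat.dvd_one] at h
    omega
  have key : ∑ i, lam n ℓ • rootX E ℓ i = -∑ i, lam n ℓ • rootX E ℓ i := by
    simp only [lam_smul_rootX E h2]
    rw [Finset.sum_comm, ← Finset.sum_neg_distrib]
    refine Finset.sum_bij' (fun d _ => ℓ - d) (fun d _ => ℓ - d) ?_ ?_ ?_ ?_ ?_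
    · intro d hd; rw [Finset.mem_Ico] at *; omega
    · intro d hd; rw [Finset.mem_Ico] at *; omega
    · intro d hd; rw [Finset.mem_Ico] at *; omega
    · intro d hd; rw [Finset.mem_Ico] at *; omega
    · intro d hd
      rw [Finset.mem_Ico] at hd
      rw [← Finset.sum_neg_distrib, ← Equiv.sum_comp (Equiv.addRight (d : ZMod n))
        fun i => -⁅rootX E (ℓ - d) i, rootX E (ℓ - (ℓ - d)) (i + (ℓ - d : ℕ))⁆]
      refine Finset.sum_congr rfl fun i _ => ?_
      have e : i + (d : ZMod n) + (ℓ - d : ℕ) = i := by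
        rw [Nat.cast_sub hd.2.le, h]; ring
      rw [Equiv.coe_addRight, e, Nat.sub_sub_self hd.2.le, lie_skew]
  have h0 : (2 : ℚ) • ∑ i, lam n ℓ • rootX E ℓ i = 0 := by
    rw [two_smul]
    nth_rw 1 [key]
    exact neg_add_cancel _
  rw [smul_eq_zero_iff_right two_ne_zero, ← Finset.smul_sum,
    smul_eq_zero_iff_right (lam_ne_zero h2)] at h0
  exact h0

/-- The bracket of a generator with a root vector, up to a scalar. -/
theorem lie_generator_rootX {ℓ : ℕ} (hℓ : 2 ≤ ℓ) (k j : ZMod n)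
    (ih : ∀ d, 1 ≤ d → d < ℓ → ∀ j, ⁅E k, rootX E d j⁆ = rootB E 1 d k j) :
    (lam n ℓ + (if k + 1 = j then 1 else 0) + (if j + ℓ = k then 1 else 0)
        - (if j + ℓ = k + 1 then 1 else 0) - (if j = k then 1 else 0)) • ⁅E k, rootX E ℓ j⁆ =
      lam n (ℓ + 1) • rootB E 1 ℓ k j := by
  have hS : ∀ i, lam n (ℓ + 1) • rootX E (ℓ + 1) i = _ := lam_smul_rootX E (show 2 ≤ ℓ + 1 by omega)
  have hA : ∑ d ∈ Finset.Ico 1 ℓ, ⁅rootX E (1 + d) k, rootX E (ℓ - d) (k + 1 + (d : ℕ))⁆ =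
      lam n (ℓ + 1) • rootX E (ℓ + 1) k - ⁅E k, rootX E ℓ (k + 1)⁆ := by
    rw [hS, Finset.sum_eq_sum_Ico_succ_bot (show 1 < ℓ + 1 by omega), rootX_one, Nat.add_sub_cancel,
      Nat.cast_one, add_sub_cancel_left, ← Finset.sum_Ico_add' _ 1 ℓ 1]
    refine Finset.sum_congr rfl fun d _ => ?_
    rw [Nat.add_comm 1 d, Nat.add_sub_add_right, Nat.cast_succ, add_assoc, add_comm (1 : ZMod n)]
  have hB : ∑ d ∈ Finset.Ico 1 ℓ, ⁅rootX E d j, rootX E (1 + (ℓ - d)) (j + (d : ℕ))⁆ =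
      lam n (ℓ + 1) • rootX E (ℓ + 1) j - ⁅rootX E ℓ j, E (j + (ℓ : ℕ))⁆ := by
    rw [hS, Finset.sum_Ico_succ_top (by omega), Nat.add_sub_cancel_left, rootX_one,
      add_sub_cancel_right]
    refine Finset.sum_congr rfl fun d hd => ?_
    rw [Finset.mem_Ico] at hd
    rw [show 1 + (ℓ - d) = ℓ + 1 - d by omega]
  set B : ℕ → L := fun d => if j + (d : ℕ) = k + 1 then ⁅rootX E d j, rootX E (ℓ + 1 - d) k⁆ else 0
    with hBdef
  have hC : B 1 + ∑ d ∈ Finset.Ico 1 ℓ, B (d + 1) = (∑ d ∈ Finset.Ico 1 ℓ, B d) + B ℓ := by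
    rw [← Finset.sum_Ico_succ_top (by omega),
      Finset.sum_eq_sum_Ico_succ_bot (show 1 < ℓ + 1 by omega), Finset.sum_Ico_add']
  have hB1 : B 1 = (if j = k then (1 : ℚ) else 0) • ⁅E k, rootX E ℓ j⁆ := by
    simp only [hBdef, Nat.cast_one, add_left_inj, rootX_one, Nat.add_sub_cancel, ite_smul,
      one_smul, zero_smul]
    split_ifs with h
    · rw [h]
    · rfl
  have hBl : B ℓ = -((if j + ℓ = k + 1 then (1 : ℚ) else 0) • ⁅E k, rootX E ℓ j⁆) := by
    simp only [hBdef, Nat.add_sub_cancel_left, rootX_one, ite_smul, one_smul, zero_smul]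
    split_ifs with h
    · rw [lie_skew]
    · rw [neg_zero]
  have hsum : lam n ℓ • ⁅E k, rootX E ℓ j⁆ =
      (if k + 1 = j then lam n (ℓ + 1) • rootX E (ℓ + 1) k - ⁅E k, rootX E ℓ j⁆ else 0) -
      (if j + ℓ = k then lam n (ℓ + 1) • rootX E (ℓ + 1) j + ⁅E k, rootX E ℓ j⁆ else 0) -
      (∑ d ∈ Finset.Ico 1 ℓ, B (d + 1)) + ∑ d ∈ Finset.Ico 1 ℓ, B d := by
    have e1 : (if k + 1 = j then lam n (ℓ + 1) • rootX E (ℓ + 1) k - ⁅E k, rootX E ℓ j⁆ else 0) =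
        ∑ d ∈ Finset.Ico 1 ℓ,
          if k + 1 = j then ⁅rootX E (1 + d) k, rootX E (ℓ - d) (j + (d : ℕ))⁆ else 0 := by
      split_ifs with h
      · rw [← h, hA]
      · simp
    have e2 : (if j + ℓ = k then lam n (ℓ + 1) • rootX E (ℓ + 1) j + ⁅E k, rootX E ℓ j⁆ else 0) =
        ∑ d ∈ Finset.Ico 1 ℓ,
          if j + ℓ = k then ⁅rootX E d j, rootX E (1 + (ℓ - d)) (j + (d : ℕ))⁆ else 0 := by
      split_ifs with h
      · rw [hB, h, ← lie_skew (E k), sub_eq_add_neg]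
      · simp
    rw [e1, e2, ← lie_smul, lam_smul_rootX E hℓ, lie_sum, ← Finset.sum_sub_distrib,
      ← Finset.sum_sub_distrib, ← Finset.sum_add_distrib]
    refine Finset.sum_congr rfl fun d hd => ?_
    rw [Finset.mem_Ico] at hd
    have e3 : j + (d : ZMod n) + (ℓ - d : ℕ) = j + ℓ := by
      rw [Nat.cast_sub hd.2.le]; ring
    have e4 : (j + ((d + 1 : ℕ) : ZMod n) = k + 1) ↔ j + (d : ZMod n) = k := by
      rw [Nat.cast_succ, ← add_assoc, add_left_inj]
    have e5 : (k + 1 = j + (d : ZMod n)) ↔ (j + (d : ZMod n) = k + 1) := eq_comm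
    rw [leibniz_lie, ih d hd.1 hd.2, ih (ℓ - d) (by omega) (by omega)]
    simp only [rootB, Nat.cast_one, e3, hBdef, e4, e5, sub_lie, lie_sub, ite_zero_lie,
      lie_ite_zero]
    rw [show ℓ + 1 - d = 1 + (ℓ - d) by omega, show ℓ + 1 - (d + 1) = ℓ - d by omega,
      Nat.add_comm d 1]
    have e6 : (if j + (d : ZMod n) = k then ⁅rootX E (1 + d) j, rootX E (ℓ - d) (j + (d : ℕ))⁆ else 0)
        = if j + (d : ZMod n) = k then ⁅rootX E (1 + d) j, rootX E (ℓ - d) k⁆ else 0 := by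
      split_ifs with h
      · rw [h]
      · rfl
    rw [e6]
    abel
  rw [sub_smul, sub_smul, add_smul, add_smul, hsum, ← hB1]
  have : (if j + ℓ = k + 1 then (1 : ℚ) else 0) • ⁅E k, rootX E ℓ j⁆ = - B ℓ := by
    rw [hBl, neg_neg]
  rw [this, rootB, Nat.add_comm 1 ℓ, Nat.cast_one, smul_sub]
  have hC' : (∑ d ∈ Finset.Ico 1 ℓ, B (d + 1)) = (∑ d ∈ Finset.Ico 1 ℓ, B d) + B ℓ - B 1 := by
    rw [← hC]; abel
  rw [hC']
  split_ifs <;> simp only [one_smul, zero_smul, smul_zero] <;> abel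

theorem lie_generator_one (hn : 2 ≤ n) (hE : ClSerre n E) (k j : ZMod n) :
    ⁅E k, rootX E 1 j⁆ = rootB E 1 1 k j := by
  have h2 : ∀ i, lam n 2 • rootX E 2 i = ⁅E i, E (i + 1)⁆ := fun i => by
    rw [lam_smul_rootX E le_rfl, show Finset.Ico 1 2 = {1} from rfl, Finset.sum_singleton,
      rootX_one, rootX_one, Nat.cast_one]
  have h1 : (1 : ZMod n) ≠ 0 := by
    have : Fact (1 < n) := ⟨by omega⟩
    exact one_ne_zero
  have hl : lam n 2 = 1 + if (2 : ZMod n) = 0 then 1 else 0 := by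
    simp only [lam, Nat.cast_ofNat]; norm_num
  rw [← sub_eq_zero, ← smul_eq_zero_iff_right (lam_ne_zero (n := n) (le_refl 2)), rootX_one, smul_sub,
    rootB, smul_sub, Nat.cast_one, smul_ite, smul_ite, smul_zero, h2, h2, sub_eq_zero, hl]
  by_cases hkj : k + 1 = j <;> by_cases hjk : j + 1 = k
  · have h20 : (2 : ZMod n) = 0 := by linear_combination hkj + hjk
    rw [if_pos hkj, if_pos hjk, if_pos h20, hkj, hjk, ← lie_skew (E j) (E k), add_smul, one_smul,
      sub_neg_eq_add]
  · have h20 : (2 : ZMod n) ≠ 0 := fun h => hjk (by linear_combination h - hkj)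
    rw [if_pos hkj, if_neg hjk, if_neg h20, hkj, add_zero, one_smul, sub_zero]
  · have h20 : (2 : ZMod n) ≠ 0 := fun h => hkj (by linear_combination h - hjk)
    rw [if_neg hkj, if_pos hjk, if_neg h20, hjk, add_zero, one_smul, zero_sub, lie_skew]
  · rw [if_neg hkj, if_neg hjk, sub_zero]
    by_cases h : j = k
    · rw [h, lie_self, smul_zero]
    · rw [hE.far k j h (Ne.symm hkj) (Ne.symm hjk), smul_zero]

theorem lie_generator (hn : 2 ≤ n) (hE : ClSerre n E) {ℓ : ℕ} (hℓ : 1 ≤ ℓ) (k j : ZMod n) :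
    ⁅E k, rootX E ℓ j⁆ = rootB E 1 ℓ k j := by
  have h1 : (1 : ZMod n) ≠ 0 := by
    have : Fact (1 < n) := ⟨by omega⟩
    exact one_ne_zero
  induction ℓ using Nat.strong_induction_on generalizing j with
  | _ ℓ ih =>
  rcases hℓ.eq_or_lt with rfl | hℓ2
  · exact lie_generator_one E hn hE k j
  have h := lie_generator_rootX E hℓ2 k j fun d hd hd' j => ih d hd' hd j
  have hl := lam_ne_zero (n := n) (show 2 ≤ ℓ + 1 by omega)
  by_cases hkj : k + 1 = j
  · have e1 : (j + (ℓ : ZMod n) = k) ↔ ((ℓ + 1 : ℕ) : ZMod n) = 0 := by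
      rw [← hkj]; push_cast
      constructor <;> intro h <;> linear_combination h
    have e2 : (j + (ℓ : ZMod n) = k + 1) ↔ (ℓ : ZMod n) = 0 := by
      rw [← hkj]
      constructor <;> intro h <;> linear_combination h
    have e3 : j ≠ k := fun h => h1 (by linear_combination hkj + h)
    rw [if_pos hkj, if_neg e3] at h
    simp only [e1, e2] at h
    rw [show lam n ℓ + 1 + (if ((ℓ + 1 : ℕ) : ZMod n) = 0 then (1 : ℚ) else 0) -
      (if (ℓ : ZMod n) = 0 then (1 : ℚ) else 0) - 0 = lam n (ℓ + 1) by
        simp only [lam]; push_cast; ring] at h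
    exact smul_right_injective L hl h
  by_cases hjk : j + (ℓ : ZMod n) = k
  · have e2 : j + (ℓ : ZMod n) ≠ k + 1 := fun h => h1 (by linear_combination hjk - h)
    have e3 : (j = k) ↔ (ℓ : ZMod n) = 0 := by
      rw [← hjk]
      constructor <;> intro h <;> linear_combination -h
    have e4 : ((ℓ + 1 : ℕ) : ZMod n) ≠ 0 := fun h => hkj (by
      push_cast at h; linear_combination h - hjk)
    rw [if_pos hjk, if_neg e2, if_neg hkj] at h
    simp only [e3] at h
    rw [show lam n ℓ + 0 + 1 - 0 - (if (ℓ : ZMod n) = 0 then (1 : ℚ) else 0) = lam n (ℓ + 1) by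
        simp only [lam, if_neg e4]; push_cast; ring] at h
    exact smul_right_injective L hl h
  have hB : rootB E 1 ℓ k j = 0 := by
    rw [rootB, Nat.cast_one, if_neg hkj, if_neg hjk, sub_zero]
  rw [hB] at h ⊢
  rw [smul_zero, if_neg hkj, if_neg hjk, smul_eq_zero, add_zero, add_zero] at h
  rcases h with h | h
  swap
  · exact h
  have h2 : ∀ i, lam n 2 • rootX E 2 i = ⁅E i, E (i + 1)⁆ := fun i => by
    rw [lam_smul_rootX E le_rfl, show Finset.Ico 1 2 = {1} from rfl, Finset.sum_singleton,
      rootX_one, rootX_one, Nat.cast_one]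
  have hℓ3 : ℓ = 2 ∨ ℓ = 3 := by
    by_contra hc
    have : (4 : ℚ) ≤ ℓ := by exact_mod_cast (show 4 ≤ ℓ by omega)
    unfold lam at h
    split_ifs at h <;> linarith
  rcases hℓ3 with rfl | rfl
  · rw [← smul_eq_zero_iff_right (lam_ne_zero (n := n) (le_refl 2)), ← lie_smul, h2]
    have h20 : (2 : ZMod n) ≠ 0 := by
      intro h20
      have h3 : ¬ (j + ((2 : ℕ) : ZMod n) = k + 1 ∧ j = k) := by
        rintro ⟨h3, rfl⟩
        apply h1
        push_cast at h3
        linear_combination h3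
      unfold lam at h
      rw [if_pos (by exact_mod_cast h20)] at h
      push_cast at h
      split_ifs at h <;> first | exact h3 ⟨‹_›, ‹_›⟩ | norm_num at h
    have hn3 : 3 ≤ n := by
      by_contra hn3
      obtain rfl : n = 2 := by omega
      exact h20 rfl
    by_cases h3 : j = k
    · rw [h3]; exact hE.left hn3 k
    · rw [if_neg h3] at h
      by_cases h4 : j + ((2 : ℕ) : ZMod n) = k + 1
      · have : k = j + 1 := by push_cast at h4; linear_combination -h4
        rw [this]; exact hE.right hn3 j
      · unfold lam at h
        rw [if_neg h4, if_neg (by exact_mod_cast h20)] at h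
        norm_num at h
  · have h3 : j + ((3 : ℕ) : ZMod n) = k + 1 ∧ j = k := by
      by_contra hc
      unfold lam at h
      split_ifs at h <;> first | exact hc ⟨‹_›, ‹_›⟩ | norm_num at h
    obtain ⟨h3, rfl⟩ := h3
    have h20 : (2 : ZMod n) = 0 := by push_cast at h3; linear_combination h3
    have hn2 : n = 2 := by
      have : ((2 : ℕ) : ZMod n) = 0 := by exact_mod_cast h20
      rw [ZMod.natCast_eq_zero_iff] at this
      exact le_antisymm (Nat.le_of_dvd (by norm_num) this) hn
    rw [← smul_eq_zero_iff_right (lam_ne_zero (n := n) (show 2 ≤ 3 by norm_num)), ← lie_smul,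
      lam_smul_rootX E (show 2 ≤ 3 by norm_num), show Finset.Ico 1 3 = {1, 2} from rfl,
      Finset.sum_pair (by norm_num), show 3 - 1 = 2 from rfl, show 3 - 2 = 1 from rfl, rootX_one,
      rootX_one, ← smul_eq_zero_iff_right (lam_ne_zero (n := n) (le_refl 2)), ← lie_smul, smul_add,
      ← lie_smul, ← smul_lie, h2, h2, Nat.cast_one, show j + 1 + 1 = j by linear_combination h20,
      show j + ((2 : ℕ) : ZMod n) = j by push_cast; linear_combination h20,
      ← lie_skew (E (j + 1)) (E j), lie_neg, lie_add, lie_neg, hE.cubic hn2,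
      ← lie_skew (⁅E j, E (j + 1)⁆) (E j), lie_neg, hE.cubic hn2]
    simp

theorem lie_rootX (hn : 2 ≤ n) (hE : ClSerre n E) {a b : ℕ} (ha : 1 ≤ a) (hb : 1 ≤ b)
    (i j : ZMod n) : ⁅rootX E a i, rootX E b j⁆ = rootB E a b i j := by
  have : NeZero n := ⟨by omega⟩
  induction a, ha using Nat.le_induction generalizing b i j with
  | base => rw [rootX_one]; exact lie_generator E hn hE hb i j
  | succ a ha ih =>
    have hstep : ∀ i, ⁅E i, rootX E a (i + 1)⁆ = rootX E (a + 1) i -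
        if ((a + 1 : ℕ) : ZMod n) = 0 then rootX E (a + 1) (i + 1) else 0 := by
      intro i
      have e : (i + 1 + (a : ZMod n) = i) ↔ ((a + 1 : ℕ) : ZMod n) = 0 := by
        push_cast
        constructor <;> intro h <;> linear_combination h
      rw [lie_generator E hn hE ha, rootB, Nat.cast_one, if_pos rfl, Nat.add_comm 1 a]
      simp only [e]
    have key : ∀ i, ⁅rootX E (a + 1) i - (if ((a + 1 : ℕ) : ZMod n) = 0 then
        rootX E (a + 1) (i + 1) else 0), rootX E b j⁆ = rootB E (a + 1) b i j -
        (if ((a + 1 : ℕ) : ZMod n) = 0 then rootB E (a + 1) b (i + 1) j else 0) := by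
      intro i
      rw [← hstep, lie_lie, ih hb, lie_generator E hn hE hb]
      simp only [rootB, lie_sub, lie_ite_zero, Nat.cast_one]
      rw [lie_generator E hn hE (by omega), lie_generator E hn hE (by omega), ih (by omega),
        ih (by omega)]
      simp only [rootB, Nat.cast_one, Nat.cast_add, if_true]
      rw [show a + (1 + b) = a + 1 + b by omega, show 1 + (a + b) = a + 1 + b by omega]
      have r1 : i + 1 + (a : ZMod n) = j → ((i + 1 + ((a : ZMod n) + b) = i) ↔ j + b = i) :=
        fun h => by rw [← h, add_assoc (i + 1)]
      have r2 : j + (b : ZMod n) = i + 1 → ((j + ((a : ZMod n) + b) = i) ↔ (a : ZMod n) + 1 = 0) :=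
        fun h => by
          constructor <;> intro h'
          · linear_combination h' - h
          · linear_combination h' + h
      have r3 : i + 1 = j → ((i + 1 + (a : ZMod n) = i) ↔ (a : ZMod n) + 1 = 0) :=
        fun _ => by constructor <;> intro h' <;> linear_combination h'
      have r4 : i + 1 = j → ((i + (1 + (b : ZMod n)) = i + 1) ↔ j + b = i + 1) :=
        fun h => by rw [← h, add_assoc]
      have r5 : j + (b : ZMod n) = i → j + (1 + (b : ZMod n)) = i + 1 :=
        fun h => by linear_combination h
      have r6 : (a : ZMod n) + 1 = 0 → ((i + 1 + ((a : ZMod n) + 1) = j) ↔ i + 1 = j) :=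
        fun h => by rw [h, add_zero]
      have r7 : (i + ((a : ZMod n) + 1) = j) ↔ i + 1 + (a : ZMod n) = j := by
        rw [add_comm (a : ZMod n), add_assoc]
      rw [if_congr r7 rfl rfl]
      exact ite_bracket_identity r1 r2 r3 r4 r5 r6 _ _ _
    by_cases h0 : ((a + 1 : ℕ) : ZMod n) = 0
    · simp only [if_pos h0, sub_lie] at key
      have hconst : ∀ i, ⁅rootX E (a + 1) (i + 1), rootX E b j⁆ - rootB E (a + 1) b (i + 1) j =
          ⁅rootX E (a + 1) i, rootX E b j⁆ - rootB E (a + 1) b i j := by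
        intro i
        have := key i
        rw [sub_eq_iff_eq_add] at this
        rw [this]; abel
      have hconst' : ∀ m : ℕ, ⁅rootX E (a + 1) (m : ZMod n), rootX E b j⁆ -
          rootB E (a + 1) b (m : ZMod n) j =
          ⁅rootX E (a + 1) 0, rootX E b j⁆ - rootB E (a + 1) b 0 j := by
        intro m
        induction m with
        | zero => rw [Nat.cast_zero]
        | succ m ihm => rw [Nat.cast_succ, hconst, ihm]
      have hc : ∀ i', ⁅rootX E (a + 1) i', rootX E b j⁆ - rootB E (a + 1) b i' j =
          ⁅rootX E (a + 1) i, rootX E b j⁆ - rootB E (a + 1) b i j := by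
        intro i'
        have h1 := hconst' i'.val
        have h2 := hconst' i.val
        rw [ZMod.natCast_zmod_val] at h1 h2
        rw [h1, h2]
      have hsum := Finset.sum_congr (rfl : (Finset.univ : Finset (ZMod n)) = _) fun i' _ => hc i'
      have e1 : ∀ i', (i' + ((a + 1 : ℕ) : ZMod n) = j) ↔ i' = j := fun i' => by rw [h0, add_zero]
      have e2 : ∑ i', rootB E (a + 1) b i' j = 0 := by
        simp only [rootB, e1, Finset.sum_sub_distrib, Finset.sum_ite_eq', Finset.sum_ite_eq,
          Finset.mem_univ, if_true, sub_self]
      rw [Finset.sum_sub_distrib, ← sum_lie, rootX_sum E hn (by omega) h0, zero_lie, e2, sub_zero,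
        Finset.sum_const, eq_comm, ← Nat.cast_smul_eq_nsmul ℚ, smul_eq_zero_iff_right] at hsum
      · exact sub_eq_zero.mp hsum
      · rw [Finset.card_univ, ZMod.card]
        exact_mod_cast NeZero.ne n
    · have := key i
      rwa [if_neg h0, if_neg h0, sub_zero, sub_zero] at this

end RootVectors

/-! ### The classical polynomial representation -/

section ClassicalPolynomial

variable (n : ℕ) (C : Type)

/-- The derivation moving `x_J` to `x_{J - ℓ}` whenever `J ≡ i + ℓ`. -/
def shiftDer (ℓ : ℕ) (i : ZMod n) :
    Derivation ℚ (MvPolynomial (ℤ × C) ℚ) (MvPolynomial (ℤ × C) ℚ) :=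
  MvPolynomial.mkDerivation ℚ fun x =>
    if (x.1 : ZMod n) = i + ℓ then MvPolynomial.X (x.1 - ℓ, x.2) else 0

variable {n C}

theorem shiftDer_X (ℓ : ℕ) (i : ZMod n) (x : ℤ × C) :
    shiftDer n C ℓ i (MvPolynomial.X x) =
      if (x.1 : ZMod n) = i + ℓ then MvPolynomial.X (x.1 - ℓ, x.2) else 0 :=
  MvPolynomial.mkDerivation_X _ _ _

theorem shiftDer_shiftDer_X (a b : ℕ) (i j : ZMod n) (x : ℤ × C) :
    shiftDer n C a i (shiftDer n C b j (MvPolynomial.X x)) =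
      if i + a = j then shiftDer n C (a + b) i (MvPolynomial.X x) else 0 := by
  obtain ⟨J, c⟩ := x
  simp only [shiftDer_X]
  by_cases h : (J : ZMod n) = j + b
  · rw [if_pos h, shiftDer_X]
    have e1 : ((J - b : ℤ) : ZMod n) = i + a ↔ i + a = j := by
      push_cast; rw [h, add_sub_cancel_right, eq_comm]
    simp only [e1]
    refine if_ctx_congr Iff.rfl (fun h' => ?_) fun _ => rfl
    rw [if_pos (by rw [h, ← h']; push_cast; ring), show J - b - a = J - (a + b : ℕ) by
      push_cast; ring]
  · rw [if_neg h, map_zero]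
    split_ifs with h1 h2
    · exact absurd (by rw [h2, ← h1]; push_cast; ring) h
    · rfl
    · rfl

theorem lie_shiftDer (a b : ℕ) (i j : ZMod n) :
    ⁅shiftDer n C a i, shiftDer n C b j⁆ =
      (if i + a = j then shiftDer n C (a + b) i else 0) -
        (if j + b = i then shiftDer n C (a + b) j else 0) := by
  refine MvPolynomial.derivation_ext fun x => ?_
  rw [Derivation.commutator_apply, shiftDer_shiftDer_X, shiftDer_shiftDer_X, Derivation.sub_apply,
    Nat.add_comm b a]
  split_ifs <;> rfl

theorem clSerre_shiftDer (hn : 2 ≤ n) : ClSerre n (shiftDer n C 1) := by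
  have h1 : (1 : ZMod n) ≠ 0 := by
    have : Fact (1 < n) := ⟨by omega⟩
    exact one_ne_zero
  have h2 : 3 ≤ n → (2 : ZMod n) ≠ 0 := fun h h' => by
    have : ((2 : ℕ) : ZMod n) = 0 := by exact_mod_cast h'
    rw [ZMod.natCast_eq_zero_iff] at this
    have := Nat.le_of_dvd (by norm_num) this
    omega
  have i1 : ∀ i : ZMod n, i + 1 ≠ i := fun i h => h1 (by linear_combination h)
  have i2 : 3 ≤ n → ∀ i : ZMod n, i + 1 + 1 ≠ i := fun h i h' => h2 h (by linear_combination h')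
  have i2' : 3 ≤ n → ∀ i : ZMod n, i + 2 ≠ i := fun h i h' => h2 h (by linear_combination h')
  have i3 : 3 ≤ n → ∀ i : ZMod n, i + 2 ≠ i + 1 := fun h i h' => h1 (by linear_combination h')
  constructor
  · intro i j _ hij hji
    rw [lie_shiftDer, Nat.cast_one, if_neg (Ne.symm hij), if_neg (Ne.symm hji), sub_zero]
  · intro hn3 i
    simp [lie_shiftDer, i1, i2 hn3, i2' hn3]
  · intro hn3 i
    simp [lie_shiftDer, i2 hn3, i3 hn3]
  · rintro rfl i
    have h20 : (2 : ZMod 2) = 0 := rfl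
    have h30 : (3 : ZMod 2) = 1 := rfl
    have i4 : i + 1 + 1 = i := by linear_combination h20
    simp [lie_shiftDer, i1, i4, h20, h30]

theorem rootX_map {L L' : Type} [LieRing L] [LieAlgebra ℚ L] [LieRing L'] [LieAlgebra ℚ L']
    (f : L →ₗ[ℚ] L') (hf : ∀ x y, f ⁅x, y⁆ = ⁅f x, f y⁆) (E : ZMod n → L) (ℓ : ℕ) (i : ZMod n) :
    f (rootX E ℓ i) = rootX (fun i => f (E i)) ℓ i := by
  induction ℓ using Nat.strong_induction_on generalizing i with
  | _ ℓ ih =>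
  rw [rootX, rootX]
  split_ifs with h
  · rfl
  · rw [map_smul, map_sum]
    congr 1
    refine Finset.sum_congr rfl fun d _ => ?_
    have := Finset.mem_Ico.mp d.2
    rw [hf, ih _ (by omega), ih _ (by omega)]

/-- A step of the recursion for root vectors. -/
theorem lie_generator_step {L : Type} [LieRing L] [LieAlgebra ℚ L] {E : ZMod n → L} (hn : 2 ≤ n)
    (hE : ClSerre n E) {ℓ : ℕ} (hℓ : 1 ≤ ℓ) (i : ZMod n) :
    ⁅E i, rootX E ℓ (i + 1)⁆ = rootX E (ℓ + 1) i -
      if ((ℓ + 1 : ℕ) : ZMod n) = 0 then rootX E (ℓ + 1) (i + 1) else 0 := by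
  have e : (i + 1 + (ℓ : ZMod n) = i) ↔ ((ℓ + 1 : ℕ) : ZMod n) = 0 := by
    push_cast
    constructor <;> intro h <;> linear_combination h
  rw [lie_generator E hn hE hℓ, rootB, Nat.cast_one, if_pos rfl, Nat.add_comm 1 ℓ]
  simp only [e]

theorem eq_of_add_one_eq {G : Type} [NeZero n] {f : ZMod n → G} (h : ∀ i, f (i + 1) = f i)
    (i j : ZMod n) : f i = f j := by
  have h' : ∀ m : ℕ, f (m : ZMod n) = f 0 := fun m => by
    induction m with
    | zero => rw [Nat.cast_zero]
    | succ m ih => rw [Nat.cast_succ, h, ih]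
  rw [← ZMod.natCast_zmod_val i, ← ZMod.natCast_zmod_val j, h', h']

theorem lie_smul_sum_eq_zero {L : Type} [LieRing L] [LieAlgebra ℚ L] [NeZero n] (x : L)
    (f : ZMod n → L) (c : ℚ) (h : ∑ k, ⁅x, f k⁆ = 0) : ⁅x, c • ∑ k, f k⁆ = 0 := by
  rw [lie_smul, lie_sum, h, smul_zero]

theorem rootX_shiftDer [NeZero n] (hn : 2 ≤ n) {ℓ : ℕ} (hℓ : 1 ≤ ℓ) (i : ZMod n) :
    rootX (shiftDer n C 1) ℓ i = shiftDer n C ℓ i -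
      if (ℓ : ZMod n) = 0 then (n : ℚ)⁻¹ • ∑ k, shiftDer n C ℓ k else 0 := by
  have h1 : ((1 : ℕ) : ZMod n) ≠ 0 := by
    have : Fact (1 < n) := ⟨by omega⟩
    rw [Nat.cast_one]
    exact one_ne_zero
  have hS := clSerre_shiftDer (n := n) (C := C) hn
  induction ℓ, hℓ using Nat.le_induction generalizing i with
  | base => rw [rootX_one, if_neg h1, sub_zero]
  | succ ℓ hℓ ih =>
    have key : ∀ i, rootX (shiftDer n C 1) (ℓ + 1) i - (if ((ℓ + 1 : ℕ) : ZMod n) = 0 then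
        rootX (shiftDer n C 1) (ℓ + 1) (i + 1) else 0) = shiftDer n C (ℓ + 1) i -
          if ((ℓ + 1 : ℕ) : ZMod n) = 0 then shiftDer n C (ℓ + 1) (i + 1) else 0 := by
      intro i
      have e : (i + 1 + (ℓ : ZMod n) = i) ↔ ((ℓ + 1 : ℕ) : ZMod n) = 0 := by
        push_cast
        constructor <;> intro h <;> linear_combination h
      rw [← lie_generator_step hn hS hℓ, ih, lie_sub, lie_shiftDer]
      have hc := fun h : (ℓ : ZMod n) = 0 => lie_smul_sum_eq_zero (shiftDer n C 1 i)
        (shiftDer n C ℓ) (n : ℚ)⁻¹ (by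
          simp only [lie_shiftDer, h, add_zero, Finset.sum_sub_distrib, Finset.sum_ite_eq,
            Finset.sum_ite_eq', Finset.mem_univ, if_true, Nat.add_comm]
          exact sub_self _)
      rw [lie_ite_zero]
      rw [if_ctx_congr Iff.rfl hc fun _ => rfl, ite_self]
      rw [sub_zero]
      simp only [e, Nat.cast_one, if_true, Nat.add_comm 1 ℓ]
    by_cases h0 : ((ℓ + 1 : ℕ) : ZMod n) = 0
    · simp only [if_pos h0] at key ⊢
      have hc := eq_of_add_one_eq (f := fun i => rootX (shiftDer n C 1) (ℓ + 1) i -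
        shiftDer n C (ℓ + 1) i) (fun i => by
          have := key i
          rw [sub_eq_iff_eq_add] at this
          simp only [this]; abel)
      have hsum := Finset.sum_congr (rfl : (Finset.univ : Finset (ZMod n)) = _)
        fun i' _ => hc i' i
      rw [Finset.sum_sub_distrib, rootX_sum _ hn (by omega) h0, zero_sub, Finset.sum_const,
        Finset.card_univ, ZMod.card, ← Nat.cast_smul_eq_nsmul ℚ] at hsum
      rw [neg_eq_iff_eq_neg.mp hsum, smul_neg, smul_smul,
        inv_mul_cancel₀ (by exact_mod_cast NeZero.ne n), one_smul]
      abel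
    · have := key i
      rw [if_neg h0, if_neg h0, sub_zero, sub_zero] at this
      rw [if_neg h0, sub_zero, this]
end ClassicalPolynomial

/-! ### Straightening of root vectors -/

section Straightening

variable {n : ℕ}

/-- Indices of a basis of root vectors. -/
abbrev RootIdx (n : ℕ) : Type := {b : ZMod n × ℕ // 1 ≤ b.2 ∧ ¬((b.2 : ZMod n) = 0 ∧ b.1 = 0)}

/-- The linearly independent root vectors. -/
def rootY {L : Type} [LieRing L] [LieAlgebra ℚ L] (E : ZMod n → L) (b : RootIdx n) : L :=
  rootX E b.1.2 b.1.1 - if (b.1.2 : ZMod n) = 0 then rootX E b.1.2 0 else 0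

section Lie

variable {L : Type} [LieRing L] [LieAlgebra ℚ L] (E : ZMod n → L)

theorem rootX_mem_span [NeZero n] (hn : 2 ≤ n) {ℓ : ℕ} (hℓ : 1 ≤ ℓ) (i : ZMod n) :
    rootX E ℓ i ∈ Submodule.span ℚ (Set.range (rootY E)) := by
  have hY : ∀ b, rootY E b ∈ Submodule.span ℚ (Set.range (rootY E)) :=
    fun b => Submodule.subset_span ⟨b, rfl⟩
  by_cases h0 : (ℓ : ZMod n) = 0
  · have hd : ∀ i, rootX E ℓ i - rootX E ℓ 0 ∈ Submodule.span ℚ (Set.range (rootY E)) := by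
      intro i
      by_cases hi : i = 0
      · rw [hi, sub_self]; exact zero_mem _
      · have := hY ⟨(i, ℓ), hℓ, fun h => hi h.2⟩
        rwa [rootY, if_pos h0] at this
    have hs : ∑ i, (rootX E ℓ i - rootX E ℓ 0) ∈ Submodule.span ℚ (Set.range (rootY E)) :=
      Submodule.sum_mem _ fun i _ => hd i
    rw [Finset.sum_sub_distrib, rootX_sum E hn hℓ h0, Finset.sum_const, Finset.card_univ, ZMod.card,
      zero_sub, ← Nat.cast_smul_eq_nsmul ℚ, Submodule.neg_mem_iff,
      Submodule.smul_mem_iff _ (by exact_mod_cast NeZero.ne n)] at hs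
    have := Submodule.add_mem _ (hd i) hs
    rwa [sub_add_cancel] at this
  · have := hY ⟨(i, ℓ), hℓ, fun h => h0 h.1⟩
    rwa [rootY, if_neg h0, sub_zero] at this

theorem lie_rootY_mem [NeZero n] (hn : 2 ≤ n) (hE : ClSerre n E) (b c : RootIdx n) :
    ⁅rootY E b, rootY E c⁆ ∈ Submodule.span ℚ (Set.range (rootY E)) := by
  have hX : ∀ {k l : ℕ}, 1 ≤ k → 1 ≤ l → ∀ i j,
      ⁅rootX E k i, rootX E l j⁆ ∈ Submodule.span ℚ (Set.range (rootY E)) := by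
    intro k l hk hl i j
    rw [lie_rootX E hn hE hk hl, rootB]
    refine Submodule.sub_mem _ ?_ ?_ <;> split_ifs <;>
      first | exact rootX_mem_span E hn (by omega) _ | exact zero_mem _
  have hb := b.2.1
  have hc := c.2.1
  unfold rootY
  split_ifs <;> simp only [sub_zero, lie_sub, sub_lie] <;>
    repeat' first | apply Submodule.sub_mem | exact hX hb hc _ _

end Lie

section Filtration

variable {B Q : Type} [Ring Q] [Algebra ℚ Q] (Y : B → Q)

/-- The span of products of at most `m` of the elements `Y b`. -/
def filt (m : ℕ) : Submodule ℚ Q :=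
  Submodule.span ℚ {x | ∃ l : List B, l.length ≤ m ∧ (l.map Y).prod = x}

variable {Y}

theorem prod_mem_filt {m : ℕ} {l : List B} (h : l.length ≤ m) : (l.map Y).prod ∈ filt Y m :=
  Submodule.subset_span ⟨l, h, rfl⟩

theorem filt_mono {m k : ℕ} (h : m ≤ k) : filt Y m ≤ filt Y k :=
  Submodule.span_mono fun _ ⟨l, hl, hx⟩ => ⟨l, hl.trans h, hx⟩

theorem mul_mem_filt {m k : ℕ} {x y : Q} (hx : x ∈ filt Y m) (hy : y ∈ filt Y k) :
    x * y ∈ filt Y (m + k) := by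
  have h := Submodule.mul_mem_mul hx hy
  rw [filt, filt, Submodule.span_mul_span] at h
  refine Submodule.span_mono ?_ h
  rintro _ ⟨_, ⟨l, hl, rfl⟩, _, ⟨l', hl', rfl⟩, rfl⟩
  refine ⟨l ++ l', by rw [List.length_append]; omega, ?_⟩
  rw [List.map_append, List.prod_append]

theorem span_le_filt : Submodule.span ℚ (Set.range Y) ≤ filt Y 1 := by
  rw [Submodule.span_le]
  rintro _ ⟨b, rfl⟩
  have := prod_mem_filt (Y := Y) (l := [b]) (m := 1) le_rfl
  simpa using this

theorem perm_sub_mem_filt (hY : ∀ b c, Y b * Y c - Y c * Y b ∈ Submodule.span ℚ (Set.range Y))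
    {l l' : List B} (h : l.Perm l') {m : ℕ} (hm : l.length ≤ m + 1) :
    (l.map Y).prod - (l'.map Y).prod ∈ filt Y m := by
  induction h generalizing m with
  | nil => rw [sub_self]; exact zero_mem _
  | @cons a l l' h ih =>
    rw [List.map_cons, List.map_cons, List.prod_cons, List.prod_cons, ← mul_sub]
    rw [List.length_cons] at hm
    rcases m with _ | m
    · have : l = [] := List.length_eq_zero_iff.mp (by omega)
      subst this
      rw [List.nil_perm] at h
      rw [h, sub_self, mul_zero]
      exact zero_mem _
    · rw [Nat.add_comm m 1]
      exact mul_mem_filt (span_le_filt (Submodule.subset_span ⟨a, rfl⟩)) (ih (by omega))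
  | swap a b l =>
    simp only [List.map_cons, List.prod_cons, List.length_cons] at hm ⊢
    rw [← mul_assoc, ← mul_assoc, ← sub_mul]
    have := mul_mem_filt (span_le_filt (hY b a)) (prod_mem_filt (Y := Y) (le_refl l.length))
    exact filt_mono (by omega) this
  | @trans l₁ l₂ l₃ h₁ h₂ ih₁ ih₂ =>
    have := Submodule.add_mem _ (ih₁ hm) (ih₂ (by rwa [← h₁.length_eq]))
    rwa [sub_add_sub_cancel] at this

/-- Normally ordered products, extended linearly. -/
def normalOrder (Y : B → Q) : MvPolynomial B ℚ →ₗ[ℚ] Q :=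
  (MvPolynomial.basisMonomials B ℚ).constr ℚ fun s => ((Finsupp.toMultiset s).toList.map Y).prod

theorem normalOrder_monomial (s : B →₀ ℕ) :
    normalOrder Y (MvPolynomial.monomial s 1) = ((Finsupp.toMultiset s).toList.map Y).prod := by
  have := (MvPolynomial.basisMonomials B ℚ).constr_basis ℚ
    (fun s => ((Finsupp.toMultiset s).toList.map Y).prod) s
  rwa [MvPolynomial.coe_basisMonomials] at this

theorem exists_prod_X_eq_monomial (l : List B) : ∃ s : B →₀ ℕ, Finsupp.toMultiset s = l ∧
    (l.map (MvPolynomial.X (R := ℚ))).prod = MvPolynomial.monomial s 1 := by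
  induction l with
  | nil => exact ⟨0, by simp, by simp⟩
  | cons a l ih =>
    obtain ⟨s, hs, h⟩ := ih
    refine ⟨Finsupp.single a 1 + s, ?_, ?_⟩
    · rw [Finsupp.toMultiset_add, hs, Finsupp.toMultiset_single, one_smul, Multiset.singleton_add,
        Multiset.cons_coe]
    · rw [List.map_cons, List.prod_cons, h, MvPolynomial.X, MvPolynomial.monomial_mul, one_mul]

theorem prod_sub_normalOrder_mem
    (hY : ∀ b c, Y b * Y c - Y c * Y b ∈ Submodule.span ℚ (Set.range Y))
    {l : List B} {m : ℕ} (hm : l.length ≤ m + 1) :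
    (l.map Y).prod - normalOrder Y (l.map (MvPolynomial.X (R := ℚ))).prod ∈ filt Y m := by
  obtain ⟨s, hs, h⟩ := exists_prod_X_eq_monomial l
  rw [h, normalOrder_monomial, hs]
  refine perm_sub_mem_filt hY ?_ hm
  rw [← Multiset.coe_eq_coe, Multiset.coe_toList]

end Filtration

end Straightening

/-! ### Faithfulness of the classical polynomial representation -/

attribute [local instance] LieRing.ofAssociativeRing LieAlgebra.ofAssociativeAlgebra

section Symbol

theorem derivation_prod_pow {B P : Type} [CommRing P] [Algebra ℚ P] (D : B → Derivation ℚ P P)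
    (y : P) (l : List B) (j : ℕ) : ∃ q : P,
      (l.map fun b => (D b : Module.End ℚ P)).prod (y ^ (l.length + j)) =
        ((j + 1).ascFactorial l.length : P) * (y ^ j * (l.map fun b => D b y).prod) +
          y ^ (j + 1) * q := by
  induction l generalizing j with
  | nil => exact ⟨0, by simp⟩
  | cons b l ih =>
    obtain ⟨q, hq⟩ := ih (j + 1)
    refine ⟨((j + 2).ascFactorial l.length : P) * D b (l.map fun b => D b y).prod +
      ((j + 2 : ℕ) : P) * D b y * q + y * D b q, ?_⟩
    have e : (((j + 1).ascFactorial (l.length + 1) : ℕ) : P) =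
        ((j + 1 : ℕ) : P) * ((j + 2).ascFactorial l.length : P) := by
      rw [← Nat.cast_mul]
      exact congrArg _ (Nat.succ_ascFactorial (j + 1) l.length).symm
    rw [List.map_cons, List.prod_cons, Module.End.mul_apply, List.length_cons,
      show l.length + 1 + j = l.length + (j + 1) by ring, hq, List.map_cons, List.prod_cons, e]
    simp only [Derivation.coeFn_coe, map_add, Derivation.leibniz, Derivation.leibniz_pow,
      Derivation.map_natCast, smul_eq_mul, nsmul_eq_mul, Nat.add_sub_cancel]
    push_cast
    ring

variable {n : ℕ}

abbrev SymP (n : ℕ) : Type := MvPolynomial (ℤ × RootIdx n) ℚ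

/-- The test element attached to a finite set of root vectors. -/
def testElt (T : Finset (RootIdx n)) : SymP n :=
  ∑ c ∈ T, MvPolynomial.X ((c.1.1.val : ℤ) + c.1.2, c)

/-- The evaluation detecting symbols. -/
def symEval (n : ℕ) : SymP n →ₐ[ℚ] MvPolynomial (RootIdx n) ℚ :=
  MvPolynomial.aeval fun x => if x.1 = (x.2.1.1.val : ℤ) then MvPolynomial.X x.2 else 0

theorem symEval_testElt (T : Finset (RootIdx n)) : symEval n (testElt T) = 0 := by
  rw [testElt, map_sum]
  refine Finset.sum_eq_zero fun c _ => ?_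
  rw [symEval, MvPolynomial.aeval_X, if_neg]
  have := c.2.1
  dsimp only
  omega

theorem symEval_shiftDer [NeZero n] (ℓ : ℕ) (i : ZMod n) (c : RootIdx n) :
    symEval n (shiftDer n (RootIdx n) ℓ i (MvPolynomial.X ((c.1.1.val : ℤ) + c.1.2, c))) =
      if c.1 = (i, ℓ) then MvPolynomial.X c else 0 := by
  have e : (((c.1.1.val : ℤ) + c.1.2 : ℤ) : ZMod n) = c.1.1 + c.1.2 := by
    push_cast; rw [ZMod.natCast_zmod_val]
  rw [shiftDer_X]
  dsimp only
  rw [e]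
  by_cases hℓ : ℓ = c.1.2
  · by_cases hi : i = c.1.1
    · rw [if_pos (by rw [hi, hℓ]), if_pos (by rw [hi, hℓ]), symEval, MvPolynomial.aeval_X, if_pos]
      rw [hℓ, add_sub_cancel_right]
    · rw [if_neg, if_neg, map_zero]
      · intro h; exact hi (by rw [h])
      · rw [hℓ, add_left_inj]; exact Ne.symm hi
  · rw [if_neg (c := c.1 = (i, ℓ)) (fun h => hℓ (by rw [h]))]
    split_ifs
    · rw [symEval, MvPolynomial.aeval_X, if_neg]
      dsimp only
      omega
    · exact map_zero _

theorem symEval_rootY [NeZero n] (hn : 2 ≤ n) (b : RootIdx n) (T : Finset (RootIdx n)) :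
    symEval n (rootY (shiftDer n (RootIdx n) 1) b (testElt T)) =
      if b ∈ T then MvPolynomial.X b else 0 := by
  have key : ∀ c : RootIdx n, symEval n (rootY (shiftDer n (RootIdx n) 1) b
      (MvPolynomial.X ((c.1.1.val : ℤ) + c.1.2, c))) = if b = c then MvPolynomial.X b else 0 := by
    intro c
    have e1 : (c.1 = (b.1.1, b.1.2)) ↔ b = c := by
      rw [Prod.mk.eta, Subtype.ext_iff, eq_comm]
    rw [rootY, rootX_shiftDer hn b.2.1]
    by_cases h0 : (b.1.2 : ZMod n) = 0
    · rw [rootX_shiftDer hn b.2.1, if_pos h0, if_pos h0, sub_sub_sub_cancel_right,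
        Derivation.sub_apply, map_sub, symEval_shiftDer, symEval_shiftDer,
        if_neg (c := c.1 = (0, b.1.2)), sub_zero]
      · simp only [e1]
        exact if_ctx_congr Iff.rfl (fun h => by rw [h]) fun _ => rfl
      · intro h
        exact c.2.2 (by rw [h]; exact ⟨h0, rfl⟩)
    · rw [if_neg h0, if_neg h0, sub_zero, sub_zero, symEval_shiftDer]
      simp only [e1]
      exact if_ctx_congr Iff.rfl (fun h => by rw [h]) fun _ => rfl
  rw [testElt, map_sum, map_sum, Finset.sum_congr rfl fun c _ => key c, Finset.sum_ite_eq]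

variable {Q : Type} [Ring Q] [Algebra ℚ Q]

theorem algHom_rootY (E : ZMod n → Q) (θ : Q →ₐ[ℚ] Module.End ℚ (SymP n))
    (hθ : ∀ i, θ (E i) = (shiftDer n (RootIdx n) 1 i : Module.End ℚ (SymP n))) (b : RootIdx n) :
    θ (rootY E b) =
      (rootY (shiftDer n (RootIdx n) 1) b : Derivation ℚ (SymP n) (SymP n)) := by
  let f : Derivation ℚ (SymP n) (SymP n) →ₗ[ℚ] Module.End ℚ (SymP n) :=
    { toFun := fun D => D
      map_add' := fun _ _ => rfl
      map_smul' := fun _ _ => rfl }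
  have hX : ∀ ℓ i, θ (rootX E ℓ i) = f (rootX (shiftDer n (RootIdx n) 1) ℓ i) := by
    intro ℓ i
    have h1 := rootX_map θ.toLinearMap (fun x y => by
      simp only [Ring.lie_def, AlgHom.toLinearMap_apply, map_sub, map_mul]) E ℓ i
    have h2 := rootX_map f (fun x y => Derivation.commutator_coe_linear_map)
      (shiftDer n (RootIdx n) 1) ℓ i
    rw [h2]
    refine h1.trans ?_
    congr 1
    funext i
    exact hθ i
  change θ (rootY E b) = f (rootY _ b)
  rw [rootY, rootY, map_sub, map_sub, hX]
  split_ifs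
  · rw [hX]
  · rw [map_zero, map_zero]

theorem exists_symbol [NeZero n] (hn : 2 ≤ n) {E : ZMod n → Q} (hE : ClSerre n E)
    (θ : Q →ₐ[ℚ] Module.End ℚ (SymP n))
    (hθ : ∀ i, θ (E i) = (shiftDer n (RootIdx n) 1 i : Module.End ℚ (SymP n))) {k : ℕ} {x : Q}
    (hx : x ∈ filt (rootY E) (k + 1)) : ∃ p : MvPolynomial (RootIdx n) ℚ,
      x - normalOrder (rootY E) p ∈ filt (rootY E) k ∧ ∀ T : Finset (RootIdx n),
        symEval n (θ x (testElt T ^ (k + 1))) = (k + 1).factorial •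
          MvPolynomial.aeval (fun b => if b ∈ T then MvPolynomial.X (R := ℚ) b else 0) p := by
  have hY : ∀ b c, rootY E b * rootY E c - rootY E c * rootY E b ∈
      Submodule.span ℚ (Set.range (rootY E)) := fun b c => lie_rootY_mem E hn hE b c
  have hprod : ∀ l : List (RootIdx n), θ (l.map (rootY E)).prod = (l.map fun b =>
      ((rootY (shiftDer n (RootIdx n) 1) b : Derivation ℚ (SymP n) (SymP n)) :
        Module.End ℚ (SymP n))).prod := fun l => by
    rw [map_list_prod, List.map_map]
    congr 2
    funext b
    exact algHom_rootY E θ hθ b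
  induction hx using Submodule.span_induction with
  | mem x hx =>
    obtain ⟨l, hl, rfl⟩ := hx
    obtain ⟨j, hj⟩ := Nat.exists_eq_add_of_le hl
    have hev : ∀ T : Finset (RootIdx n), symEval n (θ (l.map (rootY E)).prod
        (testElt T ^ (k + 1))) = ((j + 1).ascFactorial l.length : MvPolynomial (RootIdx n) ℚ) *
          (0 ^ j * (l.map fun b => if b ∈ T then MvPolynomial.X (R := ℚ) b else 0).prod) := by
      intro T
      obtain ⟨q, hq⟩ := derivation_prod_pow (rootY (shiftDer n (RootIdx n) 1)) (testElt T) l j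
      rw [hprod, hj, hq]
      simp only [map_add, map_mul, map_pow, symEval_testElt, map_natCast, map_list_prod,
        List.map_map]
      rw [pow_succ, mul_zero, zero_mul, add_zero]
      congr 4
      funext b
      exact symEval_rootY hn b T
    rcases j with _ | j
    · refine ⟨_, prod_sub_normalOrder_mem hY hl, fun T => ?_⟩
      rw [hev, zero_add, Nat.one_ascFactorial, pow_zero, one_mul, map_list_prod, List.map_map,
        nsmul_eq_mul, hj, add_zero]
      congr 3
      funext b
      rw [Function.comp_apply, MvPolynomial.aeval_X]
    · refine ⟨0, ?_, fun T => ?_⟩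
      · rw [map_zero, sub_zero]
        exact prod_mem_filt (by omega)
      · rw [hev, pow_succ, mul_zero, zero_mul, mul_zero, map_zero, smul_zero]
  | zero => exact ⟨0, by rw [map_zero, sub_zero]; exact zero_mem _, fun T => by simp⟩
  | add x y _ _ ihx ihy =>
    obtain ⟨p, hp, hp'⟩ := ihx
    obtain ⟨q, hq, hq'⟩ := ihy
    refine ⟨p + q, ?_, fun T => ?_⟩
    · rw [map_add, add_sub_add_comm]
      exact add_mem hp hq
    · rw [map_add, LinearMap.add_apply, map_add, hp', hq', map_add, smul_add]
  | smul a x _ ih =>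
    obtain ⟨p, hp, hp'⟩ := ih
    refine ⟨a • p, ?_, fun T => ?_⟩
    · rw [map_smul, ← smul_sub]
      exact Submodule.smul_mem _ _ hp
    · rw [map_smul, LinearMap.smul_apply, map_smul, hp', map_smul, smul_comm]

theorem eq_zero_of_mem_filt [NeZero n] (hn : 2 ≤ n) {E : ZMod n → Q} (hE : ClSerre n E)
    (θ : Q →ₐ[ℚ] Module.End ℚ (SymP n))
    (hθ : ∀ i, θ (E i) = (shiftDer n (RootIdx n) 1 i : Module.End ℚ (SymP n))) {k : ℕ} {x : Q}
    (hx : x ∈ filt (rootY E) k) (h0 : θ x = 0) : x = 0 := by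
  induction k with
  | zero =>
    have : x ∈ Submodule.span ℚ {(1 : Q)} := by
      refine Submodule.span_mono ?_ hx
      rintro _ ⟨l, hl, rfl⟩
      obtain rfl := List.length_eq_zero_iff.mp (Nat.le_zero.mp hl)
      rfl
    obtain ⟨c, rfl⟩ := Submodule.mem_span_singleton.mp this
    rw [map_smul, map_one, smul_eq_zero] at h0
    rcases h0 with rfl | h0
    · exact zero_smul _ _
    · exact absurd h0 one_ne_zero
  | succ k ih =>
    obtain ⟨p, hp, hT⟩ := exists_symbol hn hE θ hθ hx
    have h := hT p.vars
    rw [h0, LinearMap.zero_apply, map_zero, eq_comm, smul_eq_zero] at h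
    have h := h.resolve_left (Nat.factorial_ne_zero _)
    have hp0 : p = 0 := by
      rw [← h]
      conv_lhs => rw [← AlgHom.id_apply (R := ℚ) p, ← MvPolynomial.aeval_X_left]
      refine MvPolynomial.eval₂Hom_congr' rfl (fun b hb _ => ?_) rfl
      rw [if_pos hb]
    rw [hp0, map_zero, sub_zero] at hp
    exact ih hp

theorem exists_mem_filt [NeZero n] (hn : 2 ≤ n) (E : ZMod n → Q) (p : FreeAlgebra ℚ (ZMod n)) :
    ∃ k, FreeAlgebra.lift ℚ E p ∈ filt (rootY E) k := by
  induction p using FreeAlgebra.induction with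
  | grade0 c =>
    refine ⟨0, ?_⟩
    rw [AlgHom.commutes, Algebra.algebraMap_eq_smul_one]
    exact Submodule.smul_mem _ _ (prod_mem_filt (l := []) le_rfl)
  | grade1 i =>
    refine ⟨1, ?_⟩
    rw [FreeAlgebra.lift_ι_apply, ← rootX_one E]
    exact span_le_filt (rootX_mem_span E hn le_rfl i)
  | mul a b iha ihb =>
    obtain ⟨k, hk⟩ := iha
    obtain ⟨l, hl⟩ := ihb
    exact ⟨k + l, by rw [map_mul]; exact mul_mem_filt hk hl⟩
  | add a b iha ihb =>
    obtain ⟨k, hk⟩ := iha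
    obtain ⟨l, hl⟩ := ihb
    refine ⟨k + l, ?_⟩
    rw [map_add]
    exact add_mem (filt_mono (by omega) hk) (filt_mono (by omega) hl)

end Symbol

theorem ClSerre.map {n : ℕ} {L L' : Type} [LieRing L] [LieRing L'] {E : ZMod n → L}
    (hE : ClSerre n E) (f : L → L') (h0 : f 0 = 0) (hf : ∀ x y, f ⁅x, y⁆ = ⁅f x, f y⁆) :
    ClSerre n fun i => f (E i) where
  far i j h1 h2 h3 := by rw [← hf, hE.far i j h1 h2 h3, h0]
  left hn i := by simp only [← hf, hE.left hn i, h0]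
  right hn i := by simp only [← hf, hE.right hn i, h0]
  cubic hn i := by simp only [← hf, hE.cubic hn i, h0]

/-- The polynomial representation detects elements of every algebra generated by elements
satisfying the classical Serre relations. -/
theorem lift_eq_zero_of_polynomial {n : ℕ} (hn : 2 ≤ n) {Q : Type} [Ring Q] [Algebra ℚ Q]
    {E : ZMod n → Q} (hE : ClSerre n E) (p : FreeAlgebra ℚ (ZMod n))
    (hp : FreeAlgebra.lift ℚ
      (fun i => (shiftDer n (RootIdx n) 1 i : Module.End ℚ (SymP n))) p = 0) :
    FreeAlgebra.lift ℚ E p = 0 := by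
  have : NeZero n := ⟨by omega⟩
  set D : ZMod n → Module.End ℚ (SymP n) := fun i => shiftDer n (RootIdx n) 1 i with hD
  have hDS : ClSerre n D := (clSerre_shiftDer hn).map
    (fun D : Derivation ℚ (SymP n) (SymP n) => (D : Module.End ℚ (SymP n))) rfl
    fun _ _ => Derivation.commutator_coe_linear_map
  set E' : ZMod n → Q × Module.End ℚ (SymP n) := fun i => (E i, D i) with hE'
  have hES : ClSerre n E' := by
    constructor
    · exact fun i j h1 h2 h3 => Prod.ext (hE.far i j h1 h2 h3) (hDS.far i j h1 h2 h3)
    · exact fun h i => Prod.ext (hE.left h i) (hDS.left h i)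
    · exact fun h i => Prod.ext (hE.right h i) (hDS.right h i)
    · exact fun h i => Prod.ext (hE.cubic h i) (hDS.cubic h i)
  have h2 : (AlgHom.snd ℚ Q _).comp (FreeAlgebra.lift ℚ E') = FreeAlgebra.lift ℚ D := by
    ext i : 2
    simp [hE']
  have h1 : (AlgHom.fst ℚ Q _).comp (FreeAlgebra.lift ℚ E') = FreeAlgebra.lift ℚ E := by
    ext i : 2
    simp [hE']
  obtain ⟨k, hk⟩ := exists_mem_filt hn E' p
  have := eq_zero_of_mem_filt hn hES (AlgHom.snd ℚ Q _) (fun i => rfl) hk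
    ((DFunLike.congr_fun h2 p).trans hp)
  rw [← h1, AlgHom.comp_apply, this, map_zero]

/-! ### Coproducts -/

section SerreAdd

variable {k A : Type} [Field k] [Ring A] [Algebra k A]

theorem s2_add {q : k} (hq : q ≠ 0) {a b x y : A} (hab : s2 (q + q⁻¹) a b = 0)
    (hxy : s2 (q + q⁻¹) x y = 0) (hxa : x * a = q ^ 2 • (a * x)) (hxb : x * b = q⁻¹ • (b * x))
    (hya : y * a = q⁻¹ • (a * y)) : s2 (q + q⁻¹) (a + x) (b + y) = 0 := by
  have hxa' : ∀ w, x * (a * w) = q ^ 2 • (a * (x * w)) := fun w => by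
    rw [← mul_assoc, hxa, smul_mul_assoc, mul_assoc]
  have hxb' : ∀ w, x * (b * w) = q⁻¹ • (b * (x * w)) := fun w => by
    rw [← mul_assoc, hxb, smul_mul_assoc, mul_assoc]
  have hya' : ∀ w, y * (a * w) = q⁻¹ • (a * (y * w)) := fun w => by
    rw [← mul_assoc, hya, smul_mul_assoc, mul_assoc]
  have h : s2 (q + q⁻¹) (a + x) (b + y) = s2 (q + q⁻¹) a b + s2 (q + q⁻¹) x y := by
    simp only [s2, mul_add, add_mul, mul_assoc, hxa, hxb, hya, hxa', hxb', hya', smul_mul_assoc,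
      mul_smul_comm, smul_smul, smul_add]
    match_scalars <;> field_simp <;> ring
  rw [h, hab, hxy, add_zero]

theorem s2_mul_of_commute {c : k} {x y p q : A} (hxy : s2 c x y = 0) (hpp : Commute p q)
    (hpx : Commute x p) (hpy : Commute y p) (hqx : Commute x q) :
    s2 c (p * x) (q * y) = 0 := by
  have h : s2 c (p * x) (q * y) = p * p * q * s2 c x y := by
    have h1 : ∀ w, x * (p * w) = p * (x * w) := fun w => by rw [← mul_assoc, hpx.eq, mul_assoc]
    have h2 : ∀ w, y * (p * w) = p * (y * w) := fun w => by rw [← mul_assoc, hpy.eq, mul_assoc]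
    have h3 : ∀ w, x * (q * w) = q * (x * w) := fun w => by rw [← mul_assoc, hqx.eq, mul_assoc]
    have h4 : ∀ w, q * (p * w) = p * (q * w) := fun w => by rw [← mul_assoc, ← hpp.eq, mul_assoc]
    simp only [s2, mul_assoc, h1, h2, h3, h4, mul_sub, mul_add, mul_smul_comm]
  rw [h, hxy, mul_zero]

end SerreAdd

theorem cartan_cases {m : ℕ} (hm : 3 ≤ m) {i j : ZMod m} (hij : i ≠ j) :
    cartan i j = 0 ∨ cartan i j = -1 := by
  unfold cartan
  rw [if_neg hij]
  by_cases h1 : i = j + 1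
  · rw [if_pos h1]
    right
    rw [if_neg, zero_sub, sub_zero]
    rintro rfl
    have h2 : ((2 : ℕ) : ZMod m) = 0 := by
      push_cast
      linear_combination -h1
    rw [ZMod.natCast_eq_zero_iff] at h2
    exact absurd (Nat.le_of_dvd (by norm_num) h2) (by omega)
  · rw [if_neg h1]
    split_ifs <;> simp

section Coproduct

variable {m : ℕ} {A : Type} [Ring A] [Algebra Qv A] {E F K K' X Y L L' : ZMod m → A}

theorem serreSum_add (hm : 3 ≤ m) {a x : ZMod m → A}
    (ha : ∀ i j, i ≠ j → serreSum (a i) (a j) (1 - cartan i j).toNat = 0)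
    (hx : ∀ i j, i ≠ j → serreSum (x i) (x j) (1 - cartan i j).toNat = 0)
    (hxa : ∀ i j, QComm (cartan i j) (x i) (a j)) (i j : ZMod m) (hij : i ≠ j) :
    serreSum (a i + x i) (a j + x j) (1 - cartan i j).toNat = 0 := by
  have hai := ha i j hij
  have hxi := hx i j hij
  have h1 := hxa i j
  have h2 := hxa j i
  have h3 := hxa i i
  rw [cartan_comm] at h2
  have h4 : cartan i i = 2 := by
    unfold cartan
    have : (1 : ZMod m) ≠ 0 := by
      intro h
      have h' : ((1 : ℕ) : ZMod m) = 0 := by exact_mod_cast h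
      rw [ZMod.natCast_eq_zero_iff] at h'
      exact absurd (Nat.le_of_dvd (by norm_num) h') (by omega)
    rw [if_pos rfl, if_neg (by simpa using this), if_neg (by simpa [eq_sub_iff_add_eq] using this)]
    norm_num
  rw [h4] at h3
  unfold QComm at h1 h2 h3
  rcases cartan_cases hm hij with h | h <;> rw [h] at hai hxi h1 h2 ⊢
  · have : (1 - (0 : ℤ)).toNat = 1 := rfl
    rw [this, serreSum_one_eq_zero] at hai hxi ⊢
    rw [zpow_zero, one_smul] at h1 h2
    rw [add_mul, mul_add, mul_add, add_mul, mul_add, mul_add, hai, hxi, h1, h2]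
    abel
  · have : (1 - (-1 : ℤ)).toNat = 2 := rfl
    rw [this, serreSum_two_iff (Or.inl rfl)] at hai hxi ⊢
    rw [zpow_neg_one] at h1 h2
    exact s2_add vv_ne_zero hai hxi (by exact_mod_cast h3) h1 h2

theorem serreSum_mul (hm : 3 ≤ m) {x p : ZMod m → A}
    (hx : ∀ i j, i ≠ j → serreSum (x i) (x j) (1 - cartan i j).toNat = 0)
    (hp : ∀ i j, Commute (p i) (p j)) (hpx : ∀ i j, Commute (x i) (p j)) (i j : ZMod m)
    (hij : i ≠ j) : serreSum (p i * x i) (p j * x j) (1 - cartan i j).toNat = 0 := by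
  have hxi := hx i j hij
  rcases cartan_cases hm hij with h | h <;> rw [h] at hxi ⊢
  · have : (1 - (0 : ℤ)).toNat = 1 := rfl
    rw [this, serreSum_one_eq_zero] at hxi ⊢
    rw [mul_assoc, ← mul_assoc (x i), (hpx i j).eq, mul_assoc (p j), hxi, ← mul_assoc, (hp i j).eq,
      mul_assoc, ← mul_assoc (p i), ← (hpx j i).eq]
    simp only [mul_assoc]
  · have : (1 - (-1 : ℤ)).toNat = 2 := rfl
    rw [this, serreSum_two_iff (Or.inl rfl)] at hxi ⊢
    exact s2_mul_of_commute hxi (hp i j) (hpx i i) (hpx j i) (hpx i j)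

/-- The coproduct of two commuting representations of the relations. -/
theorem URep.coprod (hm : 3 ≤ m) (h : URep m E F K K') (h' : URep m X Y L L')
    (hc : ∀ s t, Commute (genMap E F K K' s) (genMap X Y L L' t)) :
    URep m (fun i => E i + K i * X i) (fun i => Y i + L' i * F i) (fun i => K i * L i)
      (fun i => K' i * L' i) := by
  have cEX : ∀ i j, E i * X j = X j * E i := fun i j => hc (Gen.E i) (Gen.E j)
  have cEY : ∀ i j, E i * Y j = Y j * E i := fun i j => hc (Gen.E i) (Gen.F j)
  have cEL : ∀ i j, E i * L j = L j * E i := fun i j => hc (Gen.E i) (Gen.K j)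
  have cEL' : ∀ i j, E i * L' j = L' j * E i := fun i j => hc (Gen.E i) (Gen.Kinv j)
  have cFX : ∀ i j, F i * X j = X j * F i := fun i j => hc (Gen.F i) (Gen.E j)
  have cFY : ∀ i j, F i * Y j = Y j * F i := fun i j => hc (Gen.F i) (Gen.F j)
  have cFL : ∀ i j, F i * L j = L j * F i := fun i j => hc (Gen.F i) (Gen.K j)
  have cFL' : ∀ i j, F i * L' j = L' j * F i := fun i j => hc (Gen.F i) (Gen.Kinv j)
  have cKX : ∀ i j, K i * X j = X j * K i := fun i j => hc (Gen.K i) (Gen.E j)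
  have cKY : ∀ i j, K i * Y j = Y j * K i := fun i j => hc (Gen.K i) (Gen.F j)
  have cKL : ∀ i j, K i * L j = L j * K i := fun i j => hc (Gen.K i) (Gen.K j)
  have cKL' : ∀ i j, K i * L' j = L' j * K i := fun i j => hc (Gen.K i) (Gen.Kinv j)
  have cK'L : ∀ i j, K' i * L j = L j * K' i := fun i j => hc (Gen.Kinv i) (Gen.K j)
  have cKinvLinv : ∀ i j, K' i * L' j = L' j * K' i := fun i j => hc (Gen.Kinv i) (Gen.Kinv j)
  have qz : ∀ {x y : A}, x * y = y * x → QComm 0 x y := fun h => by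
    rw [QComm, zpow_zero, one_smul, h]
  have qadd : ∀ {c : ℤ} {x y z : A}, QComm c x y → QComm c x z → QComm c x (y + z) :=
    fun h1 h2 => by
      unfold QComm at *
      rw [mul_add, h1, h2, add_mul, smul_add]
  have qcast : ∀ {c c' : ℤ} {x y : A}, QComm c x y → c = c' → QComm c' x y :=
    fun h1 h2 => h2 ▸ h1
  constructor
  · intro i j
    rw [mul_assoc, ← mul_assoc (L i), ← cKL, mul_assoc (K j), h'.KK, ← mul_assoc, h.KK, mul_assoc,
      ← mul_assoc (K i), cKL]
    simp only [mul_assoc]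
  · intro i
    rw [mul_assoc, ← mul_assoc (L i), ← cK'L, mul_assoc (K' i), h'.KK', mul_one, h.KK']
  · intro i
    rw [mul_assoc, ← mul_assoc (L' i), ← cKL', mul_assoc (K i), h'.K'K, mul_one, h.K'K]
  · intro i j
    refine qadd ?_ ?_
    · exact qcast ((h.qKE i j).mul_left (qz (cEL j i).symm)) (by ring)
    · exact qcast (((qz (h.KK i j)).mul_right (qz (cKX i j))).mul_left
        ((qz (cKL j i).symm).mul_right (h'.qKE i j))) (by ring)
  · intro i j
    refine qadd ?_ ?_
    · exact qcast ((qz (cKY i j)).mul_left (h'.qKF i j)) (by ring)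
    · exact qcast (((qz (cKL' i j)).mul_right (h.qKF i j)).mul_left
        ((qz (h'.K'K_comm j i).symm).mul_right (qz (cFL j i).symm))) (by ring)
  · intro i j
    have e1 : E i * (L' j * F j) - L' j * F j * E i = L' j * (E i * F j - F j * E i) := by
      rw [mul_sub, ← mul_assoc, cEL', mul_assoc, mul_assoc]
    have e2 : K i * X i * Y j - Y j * (K i * X i) = K i * (X i * Y j - Y j * X i) := by
      rw [mul_sub, ← mul_assoc (Y j), ← cKY, mul_assoc, mul_assoc]
    have e3 : K i * X i * (L' j * F j) = L' j * F j * (K i * X i) := by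
      have h1 : QComm (-cartan j i + cartan j i) (L' j * F j) (K i * X i) := by
        have := h.KF i j
        have h2 : QComm (cartan i j) (F j) (K i) := by
          rw [QComm, this, smul_smul, ← zpow_add₀ vv_ne_zero, add_neg_cancel, zpow_zero, one_smul]
        refine qcast (((qz (cKL' i j).symm).mul_right (h'.qK'E j i)).mul_left
          (h2.mul_right (qz (cFX j i)))) ?_
        rw [cartan_comm j i]
        ring
      rw [QComm, neg_add_cancel, zpow_zero, one_smul] at h1
      exact h1.symm
    have e4 : (E i + K i * X i) * (Y j + L' j * F j) - (Y j + L' j * F j) * (E i + K i * X i) =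
        (E i * (L' j * F j) - L' j * F j * E i) + (K i * X i * Y j - Y j * (K i * X i)) := by
      simp only [add_mul, mul_add]
      rw [e3, cEY]
      abel
    rw [e4, e1, e2, h.EF, h'.EF]
    split_ifs with hij
    · subst hij
      rw [mul_smul_comm, mul_smul_comm, ← smul_add, mul_sub, mul_sub, ← cKL', ← cKinvLinv]
      congr 1
      abel
    · rw [mul_zero, mul_zero, add_zero]
  · refine serreSum_add hm h.serreE (serreSum_mul hm h'.serreE h.KK fun i j => (cKX j i).symm) ?_
    intro i j
    exact qcast ((h.qKE i j).mul_left (qz (cEX j i).symm)) (by ring)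
  · refine serreSum_add hm h'.serreF
      (serreSum_mul hm h.serreF h'.Kinv_mul_comm fun i j => cFL' i j) ?_
    intro i j
    exact qcast ((h'.qK'F i j).mul_left (qz (cFY i j))) (by ring)

end Coproduct

section Twist

variable {m : ℕ} {A : Type} [Ring A] [Algebra Qv A] {E F K K' : ZMod m → A}

theorem serreSum_mul_pow {t t' x y : A} (ht : Commute t x) (ht' : Commute t' x)
    (hty : Commute t y) (htt' : Commute t t') (s : ℕ) :
    serreSum (t * x) (t' * y) s = t ^ s * t' * serreSum x y s := by
  rw [serreSum, serreSum, Finset.mul_sum]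
  refine Finset.sum_congr rfl fun p hp => ?_
  have h : t ^ s = t ^ p * t ^ (s - p) := by
    rw [← pow_add, Nat.add_sub_cancel' (Nat.lt_succ_iff.mp (Finset.mem_range.mp hp))]
  have h1 : t ^ p * x ^ p * (t' * y) * (t ^ (s - p) * x ^ (s - p)) =
      t ^ s * t' * (x ^ p * y * x ^ (s - p)) := by
    have e1 : x ^ p * t' = t' * x ^ p := (ht'.pow_right p).eq.symm
    have e2 : y * t ^ (s - p) = t ^ (s - p) * y := (hty.pow_left (s - p)).eq.symm
    have e3 : x ^ p * t ^ (s - p) = t ^ (s - p) * x ^ p := (ht.pow_pow (s - p) p).eq.symm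
    have e4 : t' * t ^ (s - p) = t ^ (s - p) * t' := (htt'.pow_left (s - p)).eq.symm
    calc t ^ p * x ^ p * (t' * y) * (t ^ (s - p) * x ^ (s - p))
        = t ^ p * (x ^ p * t') * (y * t ^ (s - p)) * x ^ (s - p) := by simp only [mul_assoc]
      _ = t ^ p * t' * (x ^ p * t ^ (s - p)) * y * x ^ (s - p) := by
        rw [e1, e2]; simp only [mul_assoc]
      _ = t ^ p * (t' * t ^ (s - p)) * (x ^ p * y * x ^ (s - p)) := by
        rw [e3]; simp only [mul_assoc]
      _ = _ := by rw [e4, h]; simp only [mul_assoc]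
  simp only [dp, ht.mul_pow, smul_mul_assoc, mul_smul_comm, h1]

/-- Rescaling the generators by central powers of a grading variable. -/
theorem URep.twist (h : URep m E F K K') (wt : ZMod m → ℤ) {t : ℤ → A} (h0 : t 0 = 1)
    (hadd : ∀ a b, t (a + b) = t a * t b) (ht : ∀ a s, Commute (t a) (genMap E F K K' s)) :
    URep m (fun i => t (wt i) * E i) (fun i => t (-wt i) * F i) K K' := by
  have hE : ∀ a i, Commute (t a) (E i) := fun a i => ht a (Gen.E i)
  have hF : ∀ a i, Commute (t a) (F i) := fun a i => ht a (Gen.F i)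
  have hK : ∀ a i, Commute (t a) (K i) := fun a i => ht a (Gen.K i)
  have htt : ∀ a b, Commute (t a) (t b) := fun a b => by
    rw [Commute, SemiconjBy, ← hadd, ← hadd, add_comm]
  refine ⟨h.KK, h.KK', h.K'K, fun i j => ?_, fun i j => ?_, fun i j => ?_, fun i j hij => ?_,
    fun i j hij => ?_⟩
  · rw [← mul_assoc, ← (hK _ i).eq, mul_assoc, h.KE, mul_smul_comm, mul_assoc]
  · rw [← mul_assoc, ← (hK _ i).eq, mul_assoc, h.KF, mul_smul_comm, mul_assoc]
  · have e1 : t (wt i) * E i * (t (-wt j) * F j) = t (wt i + -wt j) * (E i * F j) := by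
      rw [hadd, mul_assoc, ← mul_assoc (E i), ← (hE _ i).eq]
      simp only [mul_assoc]
    have e2 : t (-wt j) * F j * (t (wt i) * E i) = t (wt i + -wt j) * (F j * E i) := by
      rw [add_comm, hadd, mul_assoc, ← mul_assoc (F j), ← (hF _ j).eq]
      simp only [mul_assoc]
    rw [e1, e2, ← mul_sub, h.EF]
    split_ifs with hij
    · rw [hij, add_neg_cancel, h0, one_mul]
    · rw [mul_zero]
  · rw [serreSum_mul_pow (hE _ i) (hE _ i) (hE _ j) (htt _ _), h.serreE i j hij, mul_zero]
  · rw [serreSum_mul_pow (hF _ i) (hF _ i) (hF _ j) (htt _ _), h.serreF i j hij, mul_zero]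

/-- A family of Laurent polynomials with constant coefficients twisted by a grading. -/
theorem URep.twist_laurent (h : URep m E F K K') (wt : ZMod m → ℤ) :
    URep m (fun i => LaurentPolynomial.T (wt i) * LaurentPolynomial.C (E i))
      (fun i => LaurentPolynomial.T (-wt i) * LaurentPolynomial.C (F i))
      (fun i => LaurentPolynomial.C (K i)) (fun i => LaurentPolynomial.C (K' i)) := by
  have h' := h.map (AddMonoidAlgebra.singleZeroAlgHom (R := Qv) (A := A) (M := ℤ))
  refine h'.twist wt (t := LaurentPolynomial.T) LaurentPolynomial.T_zero LaurentPolynomial.T_add ?_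
  exact fun a s => LaurentPolynomial.commute_T _ _

end Twist

/-! ### Monomial operators and tensor powers of the vector representation -/

section MonOp

variable {G R : Type} [CommRing R]

/-- The operator sending a basis vector `g` to a multiple `c g` of the basis vector `σ g`. -/
def monOp (σ : G → G) (c : G → R) : Module.End R (G →₀ R) :=
  Finsupp.linearCombination R fun g => Finsupp.single (σ g) (c g)

theorem monOp_single (σ : G → G) (c : G → R) (g : G) (a : R) :
    monOp σ c (Finsupp.single g a) = Finsupp.single (σ g) (a * c g) := by
  simp [monOp]

theorem monOp_mul (σ τ : G → G) (c d : G → R) :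
    monOp σ c * monOp τ d = monOp (fun g => σ (τ g)) (fun g => d g * c (τ g)) := by
  refine Finsupp.lhom_ext fun g a => ?_
  rw [Module.End.mul_apply]
  simp only [monOp_single, mul_assoc]

theorem monOp_congr {σ τ : G → G} {c d : G → R} (hc : ∀ g, c g = d g)
    (h : ∀ g, d g ≠ 0 → σ g = τ g) : monOp σ c = monOp τ d := by
  refine Finsupp.lhom_ext fun g a => ?_
  rw [monOp_single, monOp_single, hc]
  by_cases hd : d g = 0
  · simp [hd]
  · rw [h g hd]

theorem monOp_eq_zero {σ : G → G} {c : G → R} (hc : ∀ g, c g = 0) : monOp σ c = 0 := by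
  refine Finsupp.lhom_ext fun g a => ?_
  rw [monOp_single, hc, mul_zero, Finsupp.single_zero, LinearMap.zero_apply]

theorem monOp_smul (a : R) (σ : G → G) (c : G → R) :
    a • monOp σ c = monOp σ fun g => a * c g := by
  refine Finsupp.lhom_ext fun g b => ?_
  rw [LinearMap.smul_apply, monOp_single, monOp_single, Finsupp.smul_single, smul_eq_mul]
  congr 1
  ring

theorem monOp_one {σ : G → G} {c : G → R} (hσ : ∀ g, σ g = g) (hc : ∀ g, c g = 1) :
    monOp σ c = 1 := by
  refine Finsupp.lhom_ext fun g b => ?_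
  rw [monOp_single, hσ, hc, mul_one, Module.End.one_apply]

theorem monOp_commute {σ τ : G → G} {c d : G → R} (h : ∀ g, σ (τ g) = τ (σ g))
    (hc : ∀ g, c (τ g) = c g) (hd : ∀ g, d (σ g) = d g) : Commute (monOp σ c) (monOp τ d) := by
  rw [Commute, SemiconjBy, monOp_mul, monOp_mul]
  refine monOp_congr (fun g => ?_) fun g _ => h g
  rw [hc, hd, mul_comm]

end MonOp

section Sites

variable {ι : Type}

/-- Translate the `k`-th coordinate by `d`. -/
def siteShift (k : ℕ) (d : ℤ) (g : ℕ → ℤ × ι) : ℕ → ℤ × ι :=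
  Function.update g k ((g k).1 + d, (g k).2)

theorem siteShift_self (k : ℕ) (d : ℤ) (g : ℕ → ℤ × ι) :
    siteShift k d g k = ((g k).1 + d, (g k).2) := by simp [siteShift]

theorem siteShift_of_ne {k l : ℕ} (h : l ≠ k) (d : ℤ) (g : ℕ → ℤ × ι) :
    siteShift k d g l = g l := by simp [siteShift, h]

theorem siteShift_add (k : ℕ) (c d : ℤ) (g : ℕ → ℤ × ι) :
    siteShift k c (siteShift k d g) = siteShift k (d + c) g := by
  funext l
  by_cases h : l = k
  · subst h
    simp only [siteShift_self, add_assoc]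
  · simp only [siteShift_of_ne h]

theorem siteShift_zero (k : ℕ) (g : ℕ → ℤ × ι) : siteShift k 0 g = g := by
  simp [siteShift]

theorem siteShift_comm {k l : ℕ} (h : k ≠ l) (c d : ℤ) (g : ℕ → ℤ × ι) :
    siteShift k c (siteShift l d g) = siteShift l d (siteShift k c g) := by
  funext p
  by_cases hk : p = k
  · subst hk
    simp only [siteShift_self, siteShift_of_ne h]
  · by_cases hl : p = l
    · subst hl
      simp only [siteShift_self, siteShift_of_ne hk]
    · simp only [siteShift_of_ne hk, siteShift_of_ne hl]

variable (R : Type) [CommRing R] (ι) (m : ℕ)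

/-- Lowering operator of the vector representation at site `k`. -/
def siteE (k : ℕ) (i : ZMod m) : Module.End R ((ℕ → ℤ × ι) →₀ R) :=
  monOp (siteShift k (-1)) fun g => if ((g k).1 : ZMod m) = i + 1 then 1 else 0

/-- Raising operator of the vector representation at site `k`. -/
def siteF (k : ℕ) (i : ZMod m) : Module.End R ((ℕ → ℤ × ι) →₀ R) :=
  monOp (siteShift k 1) fun g => if ((g k).1 : ZMod m) = i then 1 else 0

/-- The weight of a residue. -/
def siteWt {m : ℕ} (i a : ZMod m) : ℤ :=
  (if a = i then 1 else 0) - (if a = i + 1 then 1 else 0)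

variable {R m}

/-- Diagonal operator at site `k`. -/
def siteK (q : Rˣ) (k : ℕ) (i : ZMod m) : Module.End R ((ℕ → ℤ × ι) →₀ R) :=
  monOp id fun g => ((q ^ siteWt i ((g k).1 : ZMod m) : Rˣ) : R)

end Sites

section SiteRep

variable {ι : Type} {m : ℕ}

theorem zmod_one_ne_zero (hm : 2 ≤ m) : (1 : ZMod m) ≠ 0 := by
  intro h
  have h' : ((1 : ℕ) : ZMod m) = 0 := by exact_mod_cast h
  rw [ZMod.natCast_eq_zero_iff] at h'
  exact absurd (Nat.le_of_dvd (by norm_num) h') (by omega)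

theorem zmod_two_ne_zero (hm : 3 ≤ m) : (2 : ZMod m) ≠ 0 := by
  intro h
  have h' : ((2 : ℕ) : ZMod m) = 0 := by exact_mod_cast h
  rw [ZMod.natCast_eq_zero_iff] at h'
  exact absurd (Nat.le_of_dvd (by norm_num) h') (by omega)

/-- The element `v` as a unit. -/
def vvUnit : Qvˣ := Units.mk0 vv vv_ne_zero

theorem vvUnit_zpow (c : ℤ) : ((vvUnit ^ c : Qvˣ) : Qv) = vv ^ c := by simp [vvUnit]

theorem siteWt_sub (i j : ZMod m) : siteWt i j - siteWt i (j + 1) = cartan i j := by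
  unfold siteWt cartan
  have h1 : (j = i) ↔ (i = j) := eq_comm
  have h2 : (j + 1 = i + 1) ↔ (i = j) :=
    ⟨fun h => (add_right_cancel h).symm, fun h => by rw [h]⟩
  have h3 : (j + 1 = i) ↔ (i = j + 1) := eq_comm
  have h4 : (j = i + 1) ↔ (i = j - 1) :=
    ⟨fun h => by rw [h]; ring, fun h => by rw [h]; ring⟩
  simp only [h1, h2, h3, h4]
  split_ifs <;> ring

theorem siteE_mul_siteE_eq_zero {k : ℕ} {i j : ZMod m} (h : j ≠ i + 1) :
    siteE ι Qv m k i * siteE ι Qv m k j = 0 := by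
  rw [siteE, siteE, monOp_mul]
  refine monOp_eq_zero fun g => ?_
  rw [siteShift_self, ite_mul, zero_mul, one_mul]
  split_ifs with h1 h2
  · exfalso
    apply h
    push_cast at h2
    rw [h1] at h2
    linear_combination h2
  · rfl
  · rfl

theorem siteF_mul_siteF_eq_zero {k : ℕ} {i j : ZMod m} (h : i ≠ j + 1) :
    siteF ι Qv m k i * siteF ι Qv m k j = 0 := by
  rw [siteF, siteF, monOp_mul]
  refine monOp_eq_zero fun g => ?_
  rw [siteShift_self, ite_mul, zero_mul, one_mul]
  split_ifs with h1 h2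
  · exfalso
    apply h
    push_cast at h2
    rw [h1] at h2
    exact h2.symm
  · rfl
  · rfl

theorem site_serre {A : Type} [Ring A] [Algebra Qv A] (hm : 3 ≤ m) {X : ZMod m → A}
    (h : (∀ i j, j ≠ i + 1 → X i * X j = 0) ∨ (∀ i j, i ≠ j + 1 → X i * X j = 0)) (i j : ZMod m)
    (hij : i ≠ j) : serreSum (X i) (X j) (1 - cartan i j).toNat = 0 := by
  have h1 := zmod_one_ne_zero (m := m) (by omega)
  have h2 := zmod_two_ne_zero hm
  have hii : X i * X i = 0 := by
    rcases h with h | h <;> exact h i i (by simpa using h1)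
  rcases cartan_cases hm hij with hc | hc <;> rw [hc]
  · rw [show (1 - (0 : ℤ)).toNat = 1 from rfl, serreSum_one_eq_zero]
    unfold cartan at hc
    rw [if_neg hij] at hc
    have h3 : i ≠ j + 1 := fun h3 => by
      rw [if_pos h3] at hc
      split_ifs at hc <;> omega
    have h4 : j ≠ i + 1 := fun h4 => by
      rw [if_neg h3, if_pos (by rw [h4]; ring)] at hc
      omega
    rcases h with h | h
    · rw [h i j h4, h j i h3]
    · rw [h i j h3, h j i h4]
  · rw [show (1 - (-1 : ℤ)).toNat = 2 from rfl, serreSum_two_eq_zero, hii, zero_mul, mul_assoc (X j),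
      hii, mul_zero, zero_sub, add_zero, neg_eq_zero]
    have h5 : X i * X j = 0 ∨ X j * X i = 0 := by
      by_cases h3 : i = j + 1
      · have h4 : j ≠ i + 1 := fun h4 => by
          apply h2
          rw [h3] at h4
          linear_combination -h4
        rcases h with h | h
        · exact Or.inl (h i j h4)
        · exact Or.inr (h j i h4)
      · rcases h with h | h
        · exact Or.inr (h j i h3)
        · exact Or.inl (h i j h3)
    rcases h5 with h5 | h5
    · rw [h5, zero_mul, smul_zero]
    · rw [mul_assoc, h5, mul_zero, smul_zero]

theorem site_urep (hm : 3 ≤ m) (k : ℕ) : URep m (siteE ι Qv m k) (siteF ι Qv m k)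
    (siteK ι vvUnit k) (siteK ι vvUnit⁻¹ k) := by
  have h1 := zmod_one_ne_zero (m := m) (by omega)
  constructor
  · intro i j
    rw [siteK, siteK, monOp_mul, monOp_mul]
    exact monOp_congr (fun g => mul_comm _ _) fun _ _ => rfl
  · intro i
    rw [siteK, siteK, monOp_mul]
    exact monOp_one (fun g => rfl) fun g => by rw [← Units.val_mul, inv_zpow', ← zpow_add]; simp
  · intro i
    rw [siteK, siteK, monOp_mul]
    exact monOp_one (fun g => rfl) fun g => by rw [← Units.val_mul, inv_zpow', ← zpow_add]; simp
  · intro i j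
    rw [siteK, siteE, monOp_mul, monOp_mul, monOp_smul]
    refine monOp_congr (fun g => ?_) fun _ _ => rfl
    simp only [siteShift_self, id, vvUnit_zpow]
    split_ifs with h
    · rw [one_mul, mul_one, ← zpow_add₀ vv_ne_zero]
      push_cast
      rw [h, ← siteWt_sub]
      congr 1
      rw [← sub_eq_add_neg, add_sub_cancel_right]
      ring
    · simp
  · intro i j
    rw [siteK, siteF, monOp_mul, monOp_mul, monOp_smul]
    refine monOp_congr (fun g => ?_) fun _ _ => rfl
    simp only [siteShift_self, id, vvUnit_zpow]
    split_ifs with h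
    · rw [one_mul, mul_one, ← zpow_add₀ vv_ne_zero]
      push_cast
      rw [h, ← siteWt_sub]
      congr 1
      ring
    · simp
  · intro i j
    have e : siteE ι Qv m k i * siteF ι Qv m k j =
        monOp id fun g => if i = j then (if ((g k).1 : ZMod m) = i then 1 else 0) else 0 := by
      rw [siteE, siteF, monOp_mul]
      refine monOp_congr (fun g => ?_) fun g _ => ?_
      · rw [siteShift_self, ite_mul, zero_mul, one_mul]
        push_cast
        by_cases hj : ((g k).1 : ZMod m) = j
        · rw [if_pos hj, hj]
          by_cases hij : i = j
          · rw [hij, if_pos rfl, if_pos rfl, if_pos rfl]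
          · rw [if_neg hij, if_neg fun h => hij (add_right_cancel h).symm]
        · rw [if_neg hj]
          by_cases hij : i = j
          · rw [if_pos hij, hij, if_neg hj]
          · rw [if_neg hij]
      · rw [siteShift_add, add_neg_cancel, siteShift_zero, id]
    have f : siteF ι Qv m k j * siteE ι Qv m k i =
        monOp id fun g => if i = j then (if ((g k).1 : ZMod m) = i + 1 then 1 else 0) else 0 := by
      rw [siteE, siteF, monOp_mul]
      refine monOp_congr (fun g => ?_) fun g _ => ?_
      · rw [siteShift_self, ite_mul, zero_mul, one_mul]
        push_cast
        by_cases hj : ((g k).1 : ZMod m) = i + 1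
        · rw [if_pos hj, hj, ← sub_eq_add_neg, add_sub_cancel_right, if_pos rfl]
        · rw [if_neg hj, if_neg hj]
          split_ifs <;> rfl
      · rw [siteShift_add, neg_add_cancel, siteShift_zero, id]
    rw [e, f]
    split_ifs with hij
    · refine Finsupp.lhom_ext fun g a => ?_
      simp only [LinearMap.sub_apply, LinearMap.smul_apply, siteK, monOp_single, id, inv_zpow', vvUnit_zpow,
        ← Finsupp.single_sub, Finsupp.smul_single, ← mul_sub, smul_eq_mul]
      congr 1
      rw [mul_left_comm]
      congr 1
      have hd := vv_sub_inv_ne_zero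
      rw [inv_mul_eq_div, eq_div_iff hd]
      unfold siteWt
      split_ifs with h2 h3 h3
      · exfalso
        rw [h2] at h3
        exact h1 (by linear_combination -h3)
      all_goals simp
    · rw [monOp_eq_zero fun _ => rfl, sub_zero]
  · exact site_serre hm (Or.inl fun i j h => siteE_mul_siteE_eq_zero h)
  · exact site_serre hm (Or.inr fun i j h => siteF_mul_siteF_eq_zero h)

theorem site_commute {k l : ℕ} (h : k ≠ l) (s t : Gen m) :
    Commute (genMap (siteE ι Qv m k) (siteF ι Qv m k) (siteK ι vvUnit k) (siteK ι vvUnit⁻¹ k) s)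
      (genMap (siteE ι Qv m l) (siteF ι Qv m l) (siteK ι vvUnit l) (siteK ι vvUnit⁻¹ l) t) := by
  have H : ∀ s : Gen m, ∃ (d : ℤ) (c : ℤ → Qv), ∀ k, genMap (siteE ι Qv m k) (siteF ι Qv m k)
      (siteK ι vvUnit k) (siteK ι vvUnit⁻¹ k) s = monOp (siteShift k d) fun g => c (g k).1 := by
    have h0 : ∀ k, (siteShift k 0 : (ℕ → ℤ × ι) → _) = id := fun k =>
      funext fun g => siteShift_zero k g
    rintro (i | i | i | i)
    · exact ⟨-1, fun a => if (a : ZMod m) = i + 1 then 1 else 0, fun k => rfl⟩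
    · exact ⟨1, fun a => if (a : ZMod m) = i then 1 else 0, fun k => rfl⟩
    · exact ⟨0, fun a => ((vvUnit ^ siteWt i (a : ZMod m) : Qvˣ) : Qv), fun k => by rw [h0]; rfl⟩
    · exact ⟨0, fun a => ((vvUnit⁻¹ ^ siteWt i (a : ZMod m) : Qvˣ) : Qv), fun k => by rw [h0]; rfl⟩
  obtain ⟨d, c, hs⟩ := H s
  obtain ⟨d', c', ht⟩ := H t
  rw [hs, ht]
  exact monOp_commute (fun g => siteShift_comm h _ _ _)
    (fun g => by rw [siteShift_of_ne h]) (fun g => by rw [siteShift_of_ne h.symm])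

variable (ι m)

/-- Diagonal generators on the first `a` sites. -/
def famK (a : ℕ) (i : ZMod m) : Module.End Qv ((ℕ → ℤ × ι) →₀ Qv) :=
  Nat.rec 1 (fun k x => x * siteK ι vvUnit k i) a

/-- Inverse diagonal generators on the first `a` sites. -/
def famK' (a : ℕ) (i : ZMod m) : Module.End Qv ((ℕ → ℤ × ι) →₀ Qv) :=
  Nat.rec 1 (fun k x => x * siteK ι vvUnit⁻¹ k i) a

/-- Lowering generators on the first `a` sites. -/
def famE (a : ℕ) (i : ZMod m) : Module.End Qv ((ℕ → ℤ × ι) →₀ Qv) :=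
  Nat.rec 0 (fun k x => x + famK ι m k i * siteE ι Qv m k i) a

/-- Raising generators on the first `a` sites. -/
def famF (a : ℕ) (i : ZMod m) : Module.End Qv ((ℕ → ℤ × ι) →₀ Qv) :=
  Nat.rec 0 (fun k x => siteF ι Qv m k i + siteK ι vvUnit⁻¹ k i * x) a

variable {ι m}

theorem fam_commute (a : ℕ) : ∀ k, a ≤ k → ∀ s t : Gen m,
    Commute (genMap (famE ι m a) (famF ι m a) (famK ι m a) (famK' ι m a) s)
      (genMap (siteE ι Qv m k) (siteF ι Qv m k) (siteK ι vvUnit k) (siteK ι vvUnit⁻¹ k) t) := by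
  induction a with
  | zero =>
    rintro k - (i | i | i | i) t
    exacts [Commute.zero_left _, Commute.zero_left _, Commute.one_left _, Commute.one_left _]
  | succ a ih =>
    intro k hk s t
    have h1 := fun s => ih k (by omega) s t
    have h2 := fun s => site_commute (ι := ι) (m := m) (show a ≠ k by omega) s t
    rcases s with i | i | i | i
    · exact (h1 (Gen.E i)).add_left ((h1 (Gen.K i)).mul_left (h2 (Gen.E i)))
    · exact (h2 (Gen.F i)).add_left ((h2 (Gen.Kinv i)).mul_left (h1 (Gen.F i)))
    · exact (h1 (Gen.K i)).mul_left (h2 (Gen.K i))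
    · exact (h1 (Gen.Kinv i)).mul_left (h2 (Gen.Kinv i))

theorem trivial_urep (m : ℕ) (A : Type) [Ring A] [Algebra Qv A] :
    URep m (fun _ => (0 : A)) (fun _ => 0) (fun _ => 1) (fun _ => 1) := by
  have hs : ∀ i j : ZMod m, i ≠ j → serreSum (0 : A) 0 (1 - cartan i j).toNat = 0 :=
    fun i j hij => by simp [serreSum]
  refine ⟨fun i j => rfl, fun i => one_mul _, fun i => one_mul _, fun i j => ?_, fun i j => ?_,
    fun i j => ?_, hs, hs⟩ <;> simp

theorem fam_urep (hm : 3 ≤ m) (a : ℕ) :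
    URep m (famE ι m a) (famF ι m a) (famK ι m a) (famK' ι m a) := by
  induction a with
  | zero =>
    exact trivial_urep m _
  | succ a ih => exact ih.coprod hm (site_urep hm a) (fam_commute a a le_rfl)

end SiteRep

/-! ### Specialisation at `v = 1` -/

section Specialization

/-- The inclusion of Laurent polynomials in `v` into the field. -/
def lauToQv : LaurentPolynomial ℚ →+* Qv := LaurentPolynomial.eval₂ (algebraMap ℚ Qv) vvUnit

/-- Evaluation of Laurent polynomials at `v = 1`. -/
def lauEv : LaurentPolynomial ℚ →+* ℚ := LaurentPolynomial.eval₂ (RingHom.id ℚ) 1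

theorem lauToQv_toLaurent (p : Polynomial ℚ) :
    lauToQv (Polynomial.toLaurent p) = algebraMap (Polynomial ℚ) Qv p := by
  rw [lauToQv, LaurentPolynomial.eval₂_toLaurent]
  have h : Polynomial.eval₂RingHom (algebraMap ℚ Qv) (vvUnit : Qv) =
      algebraMap (Polynomial ℚ) Qv := by
    refine Polynomial.ringHom_ext (fun a => ?_) ?_
    · simp only [Polynomial.coe_eval₂RingHom, Polynomial.eval₂_C]
      exact RingHom.congr_fun (RingHom.ext_rat (algebraMap ℚ Qv)
        ((algebraMap (Polynomial ℚ) Qv).comp Polynomial.C)) a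
    · simp only [Polynomial.coe_eval₂RingHom, Polynomial.eval₂_X]
      exact RatFunc.algebraMap_X.symm
  exact congrArg (fun f => f p) h

theorem lauToQv_T (c : ℤ) : lauToQv (LaurentPolynomial.T c) = vv ^ c := by
  rw [lauToQv, LaurentPolynomial.eval₂_T, vvUnit_zpow]

theorem lauEv_toLaurent (p : Polynomial ℚ) : lauEv (Polynomial.toLaurent p) = p.eval 1 := by
  rw [lauEv, LaurentPolynomial.eval₂_toLaurent, Units.val_one]
  rfl

theorem lauEv_T (c : ℤ) : lauEv (LaurentPolynomial.T c) = 1 := by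
  rw [lauEv, LaurentPolynomial.eval₂_T, one_zpow, Units.val_one]

theorem lauEv_C (a : ℚ) : lauEv (LaurentPolynomial.C a) = a := by
  rw [lauEv, LaurentPolynomial.eval₂_C, RingHom.id_apply]

theorem lauToQv_injective : Function.Injective lauToQv := by
  rw [injective_iff_map_eq_zero]
  intro p hp
  obtain ⟨k, f, hf⟩ := LaurentPolynomial.exists_T_pow p
  have h := congrArg lauToQv hf
  rw [map_mul, hp, zero_mul, lauToQv_toLaurent] at h
  rw [RatFunc.algebraMap_injective ℚ (h.trans (map_zero _).symm), map_zero] at hf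
  have h2 := congrArg (· * LaurentPolynomial.T (-(k : ℤ))) hf
  simpa only [mul_assoc, ← LaurentPolynomial.T_add, add_neg_cancel, LaurentPolynomial.T_zero,
    mul_one, zero_mul, eq_comm] using h2

variable {G : Type}

/-- Operators over `ℚ(v)` and over `ℚ` with a common lift to Laurent polynomials. -/
def Compat (A : Module.End Qv (G →₀ Qv)) (B : Module.End ℚ (G →₀ ℚ)) : Prop :=
  ∃ M : Module.End (LaurentPolynomial ℚ) (G →₀ LaurentPolynomial ℚ),
    (∀ x, A (Finsupp.mapRange.addMonoidHom lauToQv.toAddMonoidHom x) =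
      Finsupp.mapRange.addMonoidHom lauToQv.toAddMonoidHom (M x)) ∧
    ∀ x, B (Finsupp.mapRange.addMonoidHom lauEv.toAddMonoidHom x) =
      Finsupp.mapRange.addMonoidHom lauEv.toAddMonoidHom (M x)

variable {A A' : Module.End Qv (G →₀ Qv)} {B B' : Module.End ℚ (G →₀ ℚ)}

theorem Compat.add (h : Compat A B) (h' : Compat A' B') : Compat (A + A') (B + B') := by
  obtain ⟨M, h1, h2⟩ := h
  obtain ⟨M', h1', h2'⟩ := h'
  refine ⟨M + M', fun x => ?_, fun x => ?_⟩
  · rw [LinearMap.add_apply, LinearMap.add_apply, h1, h1', map_add]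
  · rw [LinearMap.add_apply, LinearMap.add_apply, h2, h2', map_add]

theorem Compat.sub (h : Compat A B) (h' : Compat A' B') : Compat (A - A') (B - B') := by
  obtain ⟨M, h1, h2⟩ := h
  obtain ⟨M', h1', h2'⟩ := h'
  refine ⟨M - M', fun x => ?_, fun x => ?_⟩
  · rw [LinearMap.sub_apply, LinearMap.sub_apply, h1, h1', map_sub]
  · rw [LinearMap.sub_apply, LinearMap.sub_apply, h2, h2', map_sub]

theorem Compat.mul (h : Compat A B) (h' : Compat A' B') : Compat (A * A') (B * B') := by
  obtain ⟨M, h1, h2⟩ := h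
  obtain ⟨M', h1', h2'⟩ := h'
  refine ⟨M * M', fun x => ?_, fun x => ?_⟩
  · rw [Module.End.mul_apply, Module.End.mul_apply, h1', h1]
  · rw [Module.End.mul_apply, Module.End.mul_apply, h2', h2]

theorem mapRange_smul_ringHom {R S : Type} [CommRing R] [CommRing S] (f : R →+* S) (a : R)
    (x : G →₀ R) : Finsupp.mapRange.addMonoidHom f.toAddMonoidHom (a • x) =
      f a • Finsupp.mapRange.addMonoidHom f.toAddMonoidHom x := by
  ext g
  exact map_mul f a (x g)

theorem Compat.smul (h : Compat A B) (a : LaurentPolynomial ℚ) :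
    Compat (lauToQv a • A) (lauEv a • B) := by
  obtain ⟨M, h1, h2⟩ := h
  refine ⟨a • M, fun x => ?_, fun x => ?_⟩
  · rw [LinearMap.smul_apply, LinearMap.smul_apply, h1, mapRange_smul_ringHom]
  · rw [LinearMap.smul_apply, LinearMap.smul_apply, h2, mapRange_smul_ringHom]

theorem Compat.zero : Compat (0 : Module.End Qv (G →₀ Qv)) 0 :=
  ⟨0, fun _ => (map_zero _).symm, fun _ => (map_zero _).symm⟩

theorem Compat.one : Compat (1 : Module.End Qv (G →₀ Qv)) 1 :=
  ⟨1, fun _ => rfl, fun _ => rfl⟩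

theorem Compat.monOp (σ : G → G) (c : G → LaurentPolynomial ℚ) :
    Compat (monOp σ fun g => lauToQv (c g)) (monOp σ fun g => lauEv (c g)) := by
  have key : ∀ {S : Type} [CommRing S] (f : LaurentPolynomial ℚ →+* S) (x),
      _root_.monOp σ (fun g => f (c g)) (Finsupp.mapRange.addMonoidHom f.toAddMonoidHom x) =
        Finsupp.mapRange.addMonoidHom f.toAddMonoidHom (_root_.monOp σ c x) := by
    intro S _ f x
    induction x using Finsupp.induction_linear with
    | zero => simp only [map_zero]
    | add x y hx hy => simp only [map_add, hx, hy]
    | single g a =>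
      simp only [Finsupp.mapRange.addMonoidHom_apply, monOp_single, Finsupp.mapRange_single]
      congr 1
      exact (map_mul f a (c g)).symm
  exact ⟨_root_.monOp σ c, key _, key _⟩

theorem Compat.eq_zero (h : Compat A B) (hA : A = 0) : B = 0 := by
  obtain ⟨M, h1, h2⟩ := h
  refine Finsupp.lhom_ext fun g a => ?_
  have e : Finsupp.mapRange.addMonoidHom lauEv.toAddMonoidHom
      (Finsupp.single g (LaurentPolynomial.C a)) = Finsupp.single g a := by
    simp only [Finsupp.mapRange.addMonoidHom_apply, Finsupp.mapRange_single]
    congr 1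
    exact lauEv_C a
  have h3 := h1 (Finsupp.single g (LaurentPolynomial.C a))
  rw [hA, LinearMap.zero_apply] at h3
  have h4 : M (Finsupp.single g (LaurentPolynomial.C a)) = 0 := by
    refine Finsupp.ext fun g' => ?_
    refine lauToQv_injective ?_
    have := DFunLike.congr_fun h3 g'
    rw [Finsupp.zero_apply, map_zero]
    exact this.symm
  rw [← e, h2, h4, map_zero, LinearMap.zero_apply]

/-- The product of a family along a word. -/
def wordProd {X A : Type} [Monoid A] (E : X → A) (w : List X) : A := (w.map E).prod

theorem Compat.wordProd {X : Type} {A : X → Module.End Qv (G →₀ Qv)}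
    {B : X → Module.End ℚ (G →₀ ℚ)} (h : ∀ i, Compat (A i) (B i)) (w : List X) :
    Compat (wordProd A w) (wordProd B w) := by
  induction w with
  | nil => exact Compat.one
  | cons i w ih =>
    simp only [_root_.wordProd, List.map_cons, List.prod_cons] at ih ⊢
    exact (h i).mul ih

theorem Compat.sum {X : Type} {A : X → Module.End Qv (G →₀ Qv)}
    {B : X → Module.End ℚ (G →₀ ℚ)} (h : ∀ i, Compat (A i) (B i)) (s : Finset X) :
    Compat (∑ i ∈ s, A i) (∑ i ∈ s, B i) := by
  classical
  induction s using Finset.induction_on with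
  | empty => exact Compat.zero
  | insert i s hi ih =>
    rw [Finset.sum_insert hi, Finset.sum_insert hi]
    exact (h i).add ih

theorem Compat.smul_polynomial (h : Compat A B) (p : Polynomial ℚ) :
    Compat (algebraMap (Polynomial ℚ) Qv p • A) (p.eval 1 • B) := by
  rw [← lauToQv_toLaurent, ← lauEv_toLaurent]
  exact h.smul _

end Specialization

section FamCompat

variable {ι : Type} {m : ℕ}

theorem compat_siteE (k : ℕ) (i : ZMod m) : Compat (siteE ι Qv m k i) (siteE ι ℚ m k i) := by
  have h := Compat.monOp (siteShift (ι := ι) k (-1))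
    fun g => if ((g k).1 : ZMod m) = i + 1 then 1 else 0
  simp only [apply_ite lauToQv, apply_ite lauEv, map_one, map_zero] at h
  exact h

theorem compat_siteK (k : ℕ) (i : ZMod m) : Compat (siteK ι vvUnit k i) 1 := by
  have h := Compat.monOp (G := ℕ → ℤ × ι) id
    fun g => LaurentPolynomial.T (siteWt i ((g k).1 : ZMod m))
  simp only [lauToQv_T, lauEv_T, ← vvUnit_zpow] at h
  rwa [monOp_one (R := ℚ) (σ := id) (c := fun _ => 1) (fun _ => rfl) fun _ => rfl] at h

theorem compat_famK (a : ℕ) (i : ZMod m) : Compat (famK ι m a i) 1 := by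
  induction a with
  | zero => exact Compat.one
  | succ a ih => exact (mul_one (1 : Module.End ℚ ((ℕ → ℤ × ι) →₀ ℚ))) ▸ ih.mul (compat_siteK a i)

theorem compat_famE (a : ℕ) (i : ZMod m) :
    Compat (famE ι m a i) (∑ k ∈ Finset.range a, siteE ι ℚ m k i) := by
  induction a with
  | zero => exact Compat.zero
  | succ a ih =>
    have h := ih.add ((compat_famK a i).mul (compat_siteE a i))
    rw [one_mul, ← Finset.sum_range_succ (fun k => siteE ι ℚ m k i)] at h
    exact h

end FamCompat

/-! ### From tensor powers to the polynomial representation -/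

section Intertwine

/-- The two adjacent nodes `r`, `r + 1` folded by a commutator. -/
def foldFamily {n : ℕ} (r : ℕ) {A : Type} [Ring A] (E : ZMod (n + 1) → A) (i : ZMod n) : A :=
  if i.val = r then
    E (r : ZMod (n + 1)) * E ((r + 1 : ℕ) : ZMod (n + 1)) -
      E ((r + 1 : ℕ) : ZMod (n + 1)) * E (r : ZMod (n + 1))
  else E (pos r i.val : ZMod (n + 1))

variable {V W : Type} [AddCommGroup V] [Module ℚ V] [AddCommGroup W] [Module ℚ W]
  (T : V →ₗ[ℚ] W)

theorem intertwine_foldFamily {n r : ℕ} {A : ZMod (n + 1) → Module.End ℚ V}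
    {B : ZMod (n + 1) → Module.End ℚ W} (h : ∀ i x, T (A i x) = B i (T x)) (i : ZMod n) (x : V) :
    T (foldFamily r A i x) = foldFamily r B i (T x) := by
  unfold foldFamily
  split_ifs
  · simp only [LinearMap.sub_apply, Module.End.mul_apply, map_sub, h]
  · exact h _ _

theorem intertwine_wordProd {X : Type} {A : X → Module.End ℚ V} {B : X → Module.End ℚ W}
    (h : ∀ i x, T (A i x) = B i (T x)) (w : List X) (x : V) :
    T (wordProd A w x) = wordProd B w (T x) := by
  induction w with
  | nil => rfl
  | cons i w ih =>
    simp only [wordProd, List.map_cons, List.prod_cons, Module.End.mul_apply] at ih ⊢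
    rw [h, ih]

theorem intertwine_sum {X : Type} {A : X → Module.End ℚ V} {B : X → Module.End ℚ W}
    (h : ∀ i x, T (A i x) = B i (T x)) (s : Finset (List X)) (c : List X → ℚ) (x : V) :
    T ((∑ w ∈ s, c w • wordProd A w) x) = (∑ w ∈ s, c w • wordProd B w) (T x) := by
  simp only [LinearMap.sum_apply, LinearMap.smul_apply, map_sum, map_smul,
    intertwine_wordProd T h]

end Intertwine

section TensorToPolynomial

variable {ι : Type} {m : ℕ}

open MvPolynomial

theorem shiftDer_prod (a : ℕ) (i : ZMod m) (g : ℕ → ℤ × ι) :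
    shiftDer m ι 1 i (∏ k ∈ Finset.range a, X (g k)) =
      ∑ k ∈ Finset.range a, if ((g k).1 : ZMod m) = i + 1 then
        ∏ l ∈ Finset.range a, X (siteShift k (-1) g l) else 0 := by
  induction a with
  | zero => simp
  | succ a ih =>
    rw [Finset.prod_range_succ, Derivation.leibniz, ih, Finset.sum_range_succ, shiftDer_X,
      add_comm, smul_eq_mul, smul_eq_mul, Finset.mul_sum]
    congr 1
    · refine Finset.sum_congr rfl fun k hk => ?_
      rw [mul_ite, mul_zero, Finset.prod_range_succ, siteShift_of_ne (Finset.mem_range.mp hk).ne',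
        mul_comm]
    · rw [mul_ite, mul_zero, Nat.cast_one, Nat.cast_one]
      refine if_ctx_congr Iff.rfl (fun _ => ?_) fun _ => rfl
      rw [Finset.prod_range_succ, siteShift_self]
      congr 1
      refine Finset.prod_congr rfl fun k hk => ?_
      rw [siteShift_of_ne (Finset.mem_range.mp hk).ne]

variable (ι) in
/-- The symmetrisation of the first `a` tensor factors. -/
def toPoly (a : ℕ) : ((ℕ → ℤ × ι) →₀ ℚ) →ₗ[ℚ] MvPolynomial (ℤ × ι) ℚ :=
  Finsupp.linearCombination ℚ fun g => ∏ k ∈ Finset.range a, X (g k)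

theorem toPoly_siteE (a : ℕ) (i : ZMod m) (x : (ℕ → ℤ × ι) →₀ ℚ) :
    toPoly ι a ((∑ k ∈ Finset.range a, siteE ι ℚ m k i) x) =
      (shiftDer m ι 1 i : Module.End ℚ (MvPolynomial (ℤ × ι) ℚ)) (toPoly ι a x) := by
  induction x using Finsupp.induction_linear with
  | zero => simp only [map_zero]
  | add x y hx hy => simp only [map_add, hx, hy]
  | single g b =>
    simp only [toPoly, LinearMap.sum_apply, map_sum, siteE, monOp_single,
      Finsupp.linearCombination_single, map_smul, Derivation.coeFn_coe, shiftDer_prod,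
      Finset.smul_sum]
    refine Finset.sum_congr rfl fun k _ => ?_
    split_ifs <;> simp

theorem span_toPoly [Nonempty ι] (p : MvPolynomial (ℤ × ι) ℚ) :
    p ∈ Submodule.span ℚ {q | ∃ a x, q = toPoly ι a x} := by
  induction p using MvPolynomial.induction_on with
  | C c =>
    refine Submodule.subset_span ⟨0, Finsupp.single (fun _ => Classical.arbitrary _) c, ?_⟩
    simp only [toPoly, Finsupp.linearCombination_single, Finset.prod_range_zero, C_eq_smul_one]
  | add p q hp hq => exact Submodule.add_mem _ hp hq
  | mul_X p i hp =>
    induction hp using Submodule.span_induction with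
    | zero => rw [zero_mul]; exact Submodule.zero_mem _
    | add p q _ _ hp hq => rw [add_mul]; exact Submodule.add_mem _ hp hq
    | smul c p _ hp => rw [smul_mul_assoc]; exact Submodule.smul_mem _ _ hp
    | mem p hp =>
      obtain ⟨a, x, rfl⟩ := hp
      induction x using Finsupp.induction_linear with
      | zero => rw [map_zero, zero_mul]; exact Submodule.zero_mem _
      | add x y hx hy => rw [map_add, add_mul]; exact Submodule.add_mem _ hx hy
      | single g b =>
        refine Submodule.subset_span ⟨a + 1, Finsupp.single (Function.update g a i) b, ?_⟩
        simp only [toPoly, Finsupp.linearCombination_single, Finset.prod_range_succ,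
          Function.update_self, smul_mul_assoc]
        congr 2
        refine Finset.prod_congr rfl fun k hk => ?_
        rw [Function.update_of_ne (Finset.mem_range.mp hk).ne]

end TensorToPolynomial

section Unfold

variable {ι : Type} {n r : ℕ}

/-- The increasing relabelling of `ℤ` that skips the residue `r + 1` modulo `n + 1`. -/
def unfoldPos (n r : ℕ) (J : ℤ) : ℤ := (n + 1) * (J / n) + pos r (J % n).toNat

theorem unfoldPos_eq {q : ℤ} {t : ℕ} (ht : t < n) :
    unfoldPos n r (n * q + t) = (n + 1) * q + pos r t := by
  unfold unfoldPos
  have hn : (n : ℤ) ≠ 0 := by omega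
  rw [Int.mul_add_ediv_left _ _ hn, Int.ediv_eq_zero_of_lt (by omega) (by omega), add_zero,
    Int.mul_add_emod_self_left, Int.emod_eq_of_lt (by omega) (by omega), Int.toNat_natCast]

theorem unfoldPos_succ {q : ℤ} {t : ℕ} (ht : t < n) (hr : r < n) :
    unfoldPos n r (n * q + t + 1) = (n + 1) * q + pos r t + 1 + if t = r then 1 else 0 := by
  by_cases h : t + 1 < n
  · rw [add_assoc, ← Nat.cast_succ, unfoldPos_eq h]
    unfold pos
    split_ifs <;> push_cast <;> omega
  · have : (n : ℤ) * q + t + 1 = n * (q + 1) + (0 : ℕ) := by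
      have : (t : ℤ) + 1 = n := by omega
      push_cast
      linear_combination this
    rw [this, unfoldPos_eq (by omega), mul_add, add_assoc, add_assoc, add_assoc, mul_one]
    congr 1
    unfold pos
    split_ifs <;> push_cast <;> omega

theorem exists_decomp (hn : 0 < n) (J : ℤ) : ∃ (q : ℤ) (t : ℕ), t < n ∧ J = n * q + t := by
  refine ⟨J / n, (J % n).toNat, ?_, ?_⟩
  · have := Int.emod_lt_of_pos J (show (0 : ℤ) < n by omega)
    omega
  · rw [Int.toNat_of_nonneg (Int.emod_nonneg J (by omega))]
    exact (Int.mul_ediv_add_emod J n).symm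

theorem unfoldPos_strictMono (hn : 0 < n) (hr : r < n) : StrictMono (unfoldPos n r) := by
  refine strictMono_int_of_lt_succ fun J => ?_
  obtain ⟨q, t, ht, rfl⟩ := exists_decomp hn J
  rw [unfoldPos_succ ht hr, unfoldPos_eq ht]
  split_ifs <;> omega

open MvPolynomial in
theorem rename_unfold (hn : 2 ≤ n) (hr : r < n) (i : ZMod n) (f : MvPolynomial (ℤ × ι) ℚ) :
    rename (fun x : ℤ × ι => (unfoldPos n r x.1, x.2)) (shiftDer n ι 1 i f) =
      foldFamily r (fun j => (shiftDer (n + 1) ι 1 j : Module.End ℚ (MvPolynomial (ℤ × ι) ℚ))) i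
        (rename (fun x : ℤ × ι => (unfoldPos n r x.1, x.2)) f) := by
  have : NeZero n := ⟨by omega⟩
  set S : MvPolynomial (ℤ × ι) ℚ →ₐ[ℚ] MvPolynomial (ℤ × ι) ℚ :=
    rename (fun x : ℤ × ι => (unfoldPos n r x.1, x.2)) with hS
  obtain ⟨D, hD, hDX⟩ : ∃ D : Derivation ℚ (MvPolynomial (ℤ × ι) ℚ) (MvPolynomial (ℤ × ι) ℚ),
      foldFamily r (fun j => (shiftDer (n + 1) ι 1 j : Module.End ℚ (MvPolynomial (ℤ × ι) ℚ))) i =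
        (D : Module.End ℚ (MvPolynomial (ℤ × ι) ℚ)) ∧
      D = shiftDer (n + 1) ι (1 + if i.val = r then 1 else 0) (pos r i.val : ZMod (n + 1)) := by
    refine ⟨_, ?_, rfl⟩
    unfold foldFamily
    split_ifs with h
    · have h1 : (r : ZMod (n + 1)) + (1 : ℕ) = ((r + 1 : ℕ) : ZMod (n + 1)) := by push_cast; rfl
      have h2 : ((r + 1 : ℕ) : ZMod (n + 1)) + (1 : ℕ) ≠ (r : ZMod (n + 1)) := by
        intro h
        refine zmod_two_ne_zero (m := n + 1) (by omega) ?_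
        push_cast at h
        linear_combination h
      have h3 := lie_shiftDer (n := n + 1) (C := ι) 1 1 r ((r + 1 : ℕ) : ZMod (n + 1))
      rw [if_pos h1, if_neg h2, sub_zero] at h3
      have h4 : pos r i.val = r := by rw [h]; simp [pos]
      rw [h4, ← h3]
      rfl
    · rfl
  rw [hD]
  change S (shiftDer n ι 1 i f) = D (S f)
  have hX : ∀ x : ℤ × ι, S (shiftDer n ι 1 i (X x)) = D (S (X x)) := by
    rintro ⟨J, c⟩
    obtain ⟨q, t, ht, hJ⟩ := exists_decomp (n := n) (by omega) (J - 1)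
    have hJ' : J = n * q + t + 1 := by omega
    have hit : ((J : ZMod n) = i + (1 : ℕ)) ↔ t = i.val := by
      rw [← natCast_eq_iff ht (ZMod.val_lt i), ZMod.natCast_zmod_val, hJ']
      push_cast
      rw [ZMod.natCast_self, zero_mul, zero_add, add_left_inj]
    have hp : ∀ t, t < n → pos r t + (if t = r then 1 else 0) < n + 1 := fun t ht => by
      unfold pos; split_ifs <;> omega
    have hit' : ((unfoldPos n r J : ℤ) : ZMod (n + 1)) = (pos r i.val : ZMod (n + 1)) +
        ((1 + if i.val = r then 1 else 0 : ℕ) : ZMod (n + 1)) ↔ t = i.val := by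
      have e : (((n + 1 : ℤ)) : ZMod (n + 1)) = 0 := by
        exact_mod_cast ZMod.natCast_self (n + 1)
      have e1 : t = i.val ↔
          pos r t + (if t = r then 1 else 0) = pos r i.val + if i.val = r then 1 else 0 := by
        have := ZMod.val_lt i
        unfold pos
        split_ifs <;> omega
      rw [e1, ← natCast_eq_iff (hp t ht) (hp _ (ZMod.val_lt i)), hJ', unfoldPos_succ ht hr]
      rw [← add_left_inj (1 : ZMod (n + 1))]
      have e2 : (((n + 1) * q + pos r t + 1 + if t = r then 1 else 0 : ℤ) : ZMod (n + 1)) =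
          ((pos r t + (if t = r then 1 else 0) : ℕ) : ZMod (n + 1)) + 1 := by
        rw [Int.cast_add, Int.cast_add, Int.cast_add, Int.cast_mul, e]
        push_cast
        ring
      rw [e2]
      push_cast
      constructor <;> intro h <;> linear_combination h
    rw [hS, rename_X, hDX, shiftDer_X, shiftDer_X, apply_ite (rename _), map_zero, rename_X]
    simp only [hit, hit']
    refine if_ctx_congr Iff.rfl (fun h => ?_) fun _ => rfl
    rw [show J - ((1 : ℕ) : ℤ) = n * q + t by push_cast; omega, unfoldPos_eq ht, hJ',
      unfoldPos_succ ht hr, h]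
    congr 2
    push_cast
    ring
  induction f using MvPolynomial.induction_on with
  | C a => rw [derivation_C, hS, rename_C, derivation_C, map_zero]
  | add p q hp hq => simp only [map_add, hp, hq]
  | mul_X p x hp =>
    rw [Derivation.leibniz, map_add, map_mul, Derivation.leibniz, smul_eq_mul, smul_eq_mul, map_mul,
      map_mul, hp, hX, smul_eq_mul, smul_eq_mul]

theorem polynomial_eq_zero_of_tensor [Nonempty ι] (hn : 2 ≤ n) (hr : r < n) (s : Finset (List (ZMod n)))
    (c : List (ZMod n) → ℚ)
    (h : ∀ a : ℕ, ∑ w ∈ s, c w • wordProd (foldFamily r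
      fun j => ∑ k ∈ Finset.range a, siteE ι ℚ (n + 1) k j) w = 0) :
    ∑ w ∈ s, c w • wordProd
      (fun i => (shiftDer n ι 1 i : Module.End ℚ (MvPolynomial (ℤ × ι) ℚ))) w = 0 := by
  have h1 : ∑ w ∈ s, c w • wordProd (foldFamily r fun j =>
      (shiftDer (n + 1) ι 1 j : Module.End ℚ (MvPolynomial (ℤ × ι) ℚ))) w = 0 := by
    refine LinearMap.ext fun p => ?_
    rw [LinearMap.zero_apply]
    induction span_toPoly p using Submodule.span_induction with
    | zero => rw [map_zero]
    | add p q _ _ hp hq => rw [map_add, hp, hq, add_zero]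
    | smul a p _ hp => rw [map_smul, hp, smul_zero]
    | mem p hp =>
      obtain ⟨a, x, rfl⟩ := hp
      rw [← intertwine_sum (toPoly ι a)
        (intertwine_foldFamily (toPoly ι a) fun i x => toPoly_siteE a i x), h, LinearMap.zero_apply,
        map_zero]
  refine LinearMap.ext fun p => ?_
  have hinj : Function.Injective fun x : ℤ × ι => (unfoldPos n r x.1, x.2) := fun x y hxy => by
    rw [Prod.mk.injEq] at hxy
    exact Prod.ext ((unfoldPos_strictMono (by omega) hr).injective hxy.1) hxy.2
  refine MvPolynomial.rename_injective _ hinj ?_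
  have := intertwine_sum (MvPolynomial.rename (R := ℚ)
    fun x : ℤ × ι => (unfoldPos n r x.1, x.2)).toLinearMap (rename_unfold hn hr) s c p
  rw [h1, LinearMap.zero_apply] at this
  rw [LinearMap.zero_apply, map_zero]
  exact this

end Unfold

/-! ### Specialization at `v = 1` -/

section EvalQuotient

open Polynomial

variable (A : Type) [Ring A] [Algebra ℚ[X] A]

/-- The ideal generated by the central element `X - 1`. -/
def evalIdeal : Ideal A where
  carrier := {x | ∃ y, x = (X - 1 : ℚ[X]) • y}
  add_mem' := by
    rintro _ _ ⟨x, rfl⟩ ⟨y, rfl⟩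
    exact ⟨x + y, (smul_add _ _ _).symm⟩
  zero_mem' := ⟨0, (smul_zero _).symm⟩
  smul_mem' := by
    rintro a _ ⟨x, rfl⟩
    exact ⟨a * x, by rw [smul_eq_mul, mul_smul_comm]⟩

instance : (evalIdeal A).IsTwoSided where
  mul_mem_of_left := by
    rintro _ b ⟨x, rfl⟩
    exact ⟨x * b, by rw [smul_mul_assoc]⟩

/-- The specialization of a `ℚ[X]`-algebra at `X = 1`. -/
def EvalQuot : Type := A ⧸ evalIdeal A

instance : Ring (EvalQuot A) := inferInstanceAs (Ring (A ⧸ evalIdeal A))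

/-- The specialization map. -/
def evalMk : A →+* EvalQuot A := Ideal.Quotient.mk (evalIdeal A)

variable {A}

theorem evalMk_surjective : Function.Surjective (evalMk A) := Ideal.Quotient.mk_surjective

theorem evalMk_eq_zero {x : A} : evalMk A x = 0 ↔ ∃ y, x = (X - 1 : ℚ[X]) • y :=
  Ideal.Quotient.eq_zero_iff_mem

instance : Algebra ℚ (EvalQuot A) :=
  RingHom.toAlgebra' (((evalMk A).comp (algebraMap ℚ[X] A)).comp C) fun c x => by
    obtain ⟨y, rfl⟩ := evalMk_surjective x
    simp only [RingHom.comp_apply, ← map_mul, Algebra.commutes]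

theorem evalMk_smul (p : ℚ[X]) (x : A) : evalMk A (p • x) = p.eval 1 • evalMk A x := by
  rw [Algebra.smul_def (p.eval 1), ← sub_eq_zero]
  change evalMk A (p • x) - evalMk A (algebraMap ℚ[X] A (C (p.eval 1))) * evalMk A x = 0
  rw [← map_mul, ← Algebra.smul_def, ← map_sub, ← sub_smul, evalMk_eq_zero]
  obtain ⟨q, hq⟩ := X_sub_C_dvd_sub_C_eval (a := (1 : ℚ)) (p := p)
  exact ⟨q • x, by rw [hq, smul_smul, map_one]⟩

/-- The quantum Serre relations with denominators cleared. -/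
structure ClearedSerre {n : ℕ} (E : ZMod n → A) : Prop where
  far : ∀ i j, j ≠ i → j ≠ i + 1 → i ≠ j + 1 → E i * E j = E j * E i
  near : 3 ≤ n → ∀ i j, j = i + 1 ∨ i = j + 1 →
    (X : ℚ[X]) • (E i * E i * E j) - (X ^ 2 + 1 : ℚ[X]) • (E i * E j * E i) +
      (X : ℚ[X]) • (E j * E i * E i) = 0
  cubic : n = 2 → ∀ i j, j = i + 1 →
    (X ^ 2 : ℚ[X]) • (E j * E i * E i * E i) -
      (X ^ 4 + X ^ 2 + 1 : ℚ[X]) • (E i * E j * E i * E i) +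
      (X ^ 4 + X ^ 2 + 1 : ℚ[X]) • (E i * E i * E j * E i) -
      (X ^ 2 : ℚ[X]) • (E i * E i * E i * E j) = 0

theorem ClearedSerre.of_injective {B : Type} [Ring B] [Algebra ℚ[X] B] (f : A →ₐ[ℚ[X]] B)
    (hf : Function.Injective f) {n : ℕ} {E : ZMod n → A} (h : ClearedSerre fun i => f (E i)) :
    ClearedSerre E := by
  refine ⟨fun i j h1 h2 h3 => hf ?_, fun h3 i j hij => hf ?_, fun h2 i j hij => hf ?_⟩
  · simpa only [map_mul] using h.far i j h1 h2 h3
  · simpa only [map_mul, map_add, map_sub, map_smul, map_zero] using h.near h3 i j hij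
  · simpa only [map_mul, map_add, map_sub, map_smul, map_zero] using h.cubic h2 i j hij

theorem lie_two {Q : Type} [Ring Q] (x y : Q) (h : x * x * y - (2 : ℤ) • (x * y * x) + y * x * x = 0) :
    ⁅x, ⁅x, y⁆⁆ = 0 := by
  rw [← h]
  simp only [Ring.lie_def]
  noncomm_ring

theorem lie_three {Q : Type} [Ring Q] (x y : Q)
    (h : y * x * x * x - (3 : ℤ) • (x * y * x * x) + (3 : ℤ) • (x * x * y * x) - x * x * x * y = 0) :
    ⁅x, ⁅x, ⁅x, y⁆⁆⁆ = 0 := by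
  rw [← neg_zero, ← h]
  simp only [Ring.lie_def]
  noncomm_ring

theorem ClearedSerre.clSerre {n : ℕ} {E : ZMod n → A} (hE : ClearedSerre E) :
    ClSerre n fun i => evalMk A (E i) := by
  have e2 : ∀ x : EvalQuot A, (2 : ℤ) • x = (2 : ℚ) • x := fun x => by
    rw [← Int.cast_smul_eq_zsmul ℚ]; norm_num
  have e3 : ∀ x : EvalQuot A, (3 : ℤ) • x = (3 : ℚ) • x := fun x => by
    rw [← Int.cast_smul_eq_zsmul ℚ]; norm_num
  have two : 3 ≤ n → ∀ i j, j = i + 1 ∨ i = j + 1 →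
      ⁅evalMk A (E i), ⁅evalMk A (E i), evalMk A (E j)⁆⁆ = 0 := fun h i j hij => by
    refine lie_two _ _ ?_
    have := congrArg (evalMk A) (hE.near h i j hij)
    simp only [map_add, map_sub, evalMk_smul, map_mul, map_zero, eval_add, eval_pow, eval_X,
      eval_one, one_pow, one_smul] at this
    rw [e2, ← this]
    norm_num
  refine ⟨fun i j h1 h2 h3 => ?_, fun h i => two h _ _ (Or.inl rfl), fun h i => ?_, fun h i => ?_⟩
  · rw [Ring.lie_def, ← map_mul, ← map_mul, hE.far i j h1 h2 h3, sub_self]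
  · rw [← lie_skew (evalMk A (E i)), lie_neg, two h _ _ (Or.inr rfl), neg_zero]
  · refine lie_three _ _ ?_
    have := congrArg (evalMk A) (hE.cubic h i _ rfl)
    simp only [map_add, map_sub, evalMk_smul, map_mul, map_zero, eval_add, eval_pow, eval_X,
      eval_one, one_pow, one_smul] at this
    rw [e3, e3, ← this]
    norm_num

theorem lift_words {R B X : Type} [CommSemiring R] [Ring B] [Algebra R B] (E : X → B)
    (s : Finset (List X)) (c : List X → R) :
    FreeAlgebra.lift R E (∑ w ∈ s, c w • wordProd (FreeAlgebra.ι R) w) =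
      ∑ w ∈ s, c w • wordProd E w := by
  simp only [map_sum, map_smul, wordProd, map_list_prod, List.map_map, Function.comp_def,
    FreeAlgebra.lift_ι_apply]

theorem exists_smul_of_polynomial {n : ℕ} (hn : 2 ≤ n) {E : ZMod n → A} (hE : ClearedSerre E)
    (s : Finset (List (ZMod n))) (c : List (ZMod n) → ℚ[X])
    (h : ∑ w ∈ s, (c w).eval 1 • wordProd
      (fun i => (shiftDer n (RootIdx n) 1 i : Module.End ℚ (SymP n))) w = 0) :
    ∃ y, ∑ w ∈ s, c w • wordProd E w = (X - 1 : ℚ[X]) • y := by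
  rw [← evalMk_eq_zero, map_sum]
  have := lift_eq_zero_of_polynomial hn hE.clSerre
    (∑ w ∈ s, (c w).eval 1 • wordProd (FreeAlgebra.ι ℚ) w) (by rw [lift_words]; exact h)
  rw [lift_words] at this
  rw [← this]
  refine Finset.sum_congr rfl fun w _ => ?_
  rw [evalMk_smul]
  simp only [wordProd, map_list_prod, List.map_map, Function.comp_def]

end EvalQuotient

section Lattice

open Polynomial

theorem algebraMap_X : algebraMap ℚ[X] Qv X = vv := RatFunc.algebraMap_X

variable {n : ℕ} {A : Type} [Ring A] [Algebra Qv A] [Algebra ℚ[X] A] [IsScalarTower ℚ[X] Qv A]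

theorem URep.clearedSerre (hn : 2 ≤ n) {E F K K' : ZMod n → A} (h : URep n E F K K') :
    ClearedSerre E := by
  have hv := vv_ne_zero
  refine ⟨fun i j h1 h2 h3 => ?_, fun h3 i j hij => ?_, fun h2 i j hij => ?_⟩
  · have hc : cartan i j = 0 := by
      unfold cartan
      rw [if_neg (Ne.symm h1), if_neg h3, if_neg (fun h => h2 (by rw [h, sub_add_cancel]))]
      rfl
    have := h.serreE i j (Ne.symm h1)
    rw [hc] at this
    exact serreSum_one_eq_zero.mp this
  · have hij' : i ≠ j := by
      have := zmod_one_ne_zero (m := n) (by omega)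
      rintro rfl
      rcases hij with hij | hij <;> exact this (left_eq_add.mp hij)
    have hc : cartan i j = -1 := by
      rcases cartan_cases h3 hij' with hc | hc
      · exfalso
        revert hc
        have h2 := zmod_two_ne_zero (m := n) (by omega)
        unfold cartan
        rw [if_neg hij']
        rcases hij with rfl | rfl
        · rw [if_neg fun h => h2 (by linear_combination -h), if_pos (add_sub_cancel_right i 1).symm]
          decide
        · rw [if_pos rfl, if_neg fun h => h2 (by linear_combination h)]
          decide
      · exact hc
    have := h.serreE i j hij'
    rw [hc] at this
    have := congrArg (vv • ·) (serreSum_two_eq_zero.mp this)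
    simp only [smul_add, smul_sub, smul_smul, smul_zero] at this
    rw [← this, algebra_compatible_smul Qv (X : ℚ[X]), algebra_compatible_smul Qv (X : ℚ[X]),
      algebra_compatible_smul Qv (X ^ 2 + 1 : ℚ[X]), map_add, map_pow, map_one, algebraMap_X]
    congr 4
    field_simp
  · have hij' : i ≠ j := by
      have := zmod_one_ne_zero (m := n) (by omega)
      rintro rfl
      exact this (left_eq_add.mp hij)
    have hc : cartan i j = -2 := by
      subst h2
      subst hij
      revert i
      decide
    have := h.serreE i j hij'
    rw [hc] at this
    have := congrArg (vv ^ 2 • ·) (serreSum_three_eq_zero.mp this)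
    simp only [smul_add, smul_sub, smul_smul, smul_zero] at this
    rw [← this]
    simp only [algebra_compatible_smul Qv (_ : ℚ[X]), map_add, map_pow, map_one, algebraMap_X]
    have e : vv ^ 4 + vv ^ 2 + 1 = vv ^ 2 * (vv ^ 2 + 1 + (vv⁻¹) ^ 2) := by
      field_simp
    rw [e]

end Lattice

/-! ### Injectivity on the positive part -/

section Grading

variable {m : ℕ}

/-- The `ℤ`-grading of `U m` in which `E i` has degree `wt i`, as a coaction. -/
def gradeHom (m : ℕ) (wt : ZMod m → ℤ) : U m →ₐ[Qv] LaurentPolynomial (U m) :=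
  ulift ((U_urep m).twist_laurent wt)

/-- The component of degree `ℓ`. -/
def gradeComp (m : ℕ) (wt : ZMod m → ℤ) (ℓ : ℤ) : U m →ₗ[Qv] U m :=
  Finsupp.lapply ℓ ∘ₗ (AddMonoidAlgebra.coeffLinearEquiv Qv).toLinearMap ∘ₗ
    (gradeHom m wt).toLinearMap

theorem gradeComp_of_eq {wt : ZMod m → ℤ} {x : U m} {d : ℤ}
    (h : gradeHom m wt x = LaurentPolynomial.T d * LaurentPolynomial.C x) (ℓ : ℤ) :
    gradeComp m wt ℓ x = if d = ℓ then x else 0 := by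
  change (gradeHom m wt x).coeff ℓ = _
  rw [h, LaurentPolynomial.T_mul, ← LaurentPolynomial.single_eq_C_mul_T,
    AddMonoidAlgebra.coeff_single, Finsupp.single_apply]

theorem gradeHom_wordProd {X : Type} {wt : ZMod m → ℤ} {e : X → U m} {d : X → ℤ}
    (h : ∀ x, gradeHom m wt (e x) = LaurentPolynomial.T (d x) * LaurentPolynomial.C (e x))
    (w : List X) : gradeHom m wt (wordProd e w) =
      LaurentPolynomial.T (w.map d).sum * LaurentPolynomial.C (wordProd e w) := by
  induction w with
  | nil =>
    change gradeHom m wt 1 = LaurentPolynomial.T 0 * LaurentPolynomial.C 1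
    rw [map_one, map_one, LaurentPolynomial.T_zero, mul_one]
  | cons i w ih =>
    simp only [wordProd, List.map_cons, List.prod_cons, List.sum_cons] at ih ⊢
    rw [map_mul, h, ih, LaurentPolynomial.T_add, map_mul, mul_assoc, mul_assoc]
    congr 1
    rw [← mul_assoc, ← mul_assoc, LaurentPolynomial.T_mul]

theorem gradeComp_wordProd {X : Type} {wt : ZMod m → ℤ} {e : X → U m}
    (h : ∀ x, gradeHom m wt (e x) = LaurentPolynomial.T 1 * LaurentPolynomial.C (e x))
    (w : List X) (ℓ : ℕ) :
    gradeComp m wt ℓ (wordProd e w) = if w.length = ℓ then wordProd e w else 0 := by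
  rw [gradeComp_of_eq (gradeHom_wordProd h w)]
  simp

end Grading

section PositivePart

open Polynomial

theorem map_wordProd {X A B F : Type} [Monoid A] [Monoid B] [FunLike F A B] [MonoidHomClass F A B]
    (f : F) (E : X → A) (w : List X) : f (wordProd E w) = wordProd (fun i => f (E i)) w := by
  simp only [wordProd, map_list_prod, List.map_map, Function.comp_def]

theorem wordProd_mem_adjoin {R A X : Type} [CommSemiring R] [Ring A] [Algebra R A] (E : X → A)
    {y : A} (hy : y ∈ Algebra.adjoin R (Set.range E)) :
    y ∈ Submodule.span R (Set.range (wordProd E)) := by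
  rw [← Subalgebra.mem_toSubmodule, Algebra.adjoin_eq_span] at hy
  refine Submodule.span_mono ?_ hy
  intro x hx
  induction hx using Submonoid.closure_induction with
  | one => exact ⟨[], rfl⟩
  | mem x hx =>
    obtain ⟨i, rfl⟩ := hx
    exact ⟨[i], List.prod_singleton⟩
  | mul x y _ _ hx hy =>
    obtain ⟨u, rfl⟩ := hx
    obtain ⟨w, rfl⟩ := hy
    exact ⟨u ++ w, by rw [wordProd, List.map_append, List.prod_append]; rfl⟩

theorem U_gradeHom_E (n : ℕ) (i : ZMod n) :
    gradeHom n 1 (UE i) = LaurentPolynomial.T 1 * LaurentPolynomial.C (UE i) :=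
  ulift_E _ i

theorem U_clearedSerre {n : ℕ} (hn : 2 ≤ n) : ClearedSerre (UE (m := n)) :=
  (U_urep n).clearedSerre hn

/-- The `ℚ[X]`-lattice of positive elements of length `ℓ`. -/
def wordLattice (n ℓ : ℕ) : Submodule ℚ[X] (U n) :=
  Submodule.span ℚ[X] (wordProd UE '' {w : List (ZMod n) | w.length = ℓ})

theorem wordLattice_fg (n ℓ : ℕ) [NeZero n] : (wordLattice n ℓ).FG :=
  Submodule.fg_span ((List.finite_length_eq _ ℓ).image _)

theorem gradeComp_mem_wordLattice {n : ℕ} (ℓ : ℕ) {y : U n}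
    (hy : y ∈ Algebra.adjoin ℚ[X] (Set.range (UE (m := n)))) :
    gradeComp n 1 ℓ y ∈ wordLattice n ℓ := by
  replace hy := wordProd_mem_adjoin _ hy
  induction hy using Submodule.span_induction with
  | zero => rw [map_zero]; exact Submodule.zero_mem _
  | add x y _ _ hx hy => rw [map_add]; exact Submodule.add_mem _ hx hy
  | smul c x _ hx =>
    rw [algebra_compatible_smul Qv c x, map_smul, ← algebra_compatible_smul]
    exact Submodule.smul_mem _ _ hx
  | mem x hx =>
    obtain ⟨w, rfl⟩ := hx
    rw [gradeComp_wordProd (U_gradeHom_E n)]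
    split_ifs with h
    · exact Submodule.subset_span ⟨w, h, rfl⟩
    · exact Submodule.zero_mem _

theorem gradeComp_of_mem_wordLattice {n ℓ : ℕ} {y : U n} (hy : y ∈ wordLattice n ℓ) :
    gradeComp n 1 ℓ y = y := by
  induction hy using Submodule.span_induction with
  | zero => rw [map_zero]
  | add x y _ _ hx hy => rw [map_add, hx, hy]
  | smul c x _ hx => rw [algebra_compatible_smul Qv c x, map_smul, hx]
  | mem x hx =>
    obtain ⟨w, hw, rfl⟩ := hx
    rw [gradeComp_wordProd (U_gradeHom_E n), if_pos (by exact hw)]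

/-- A linear map out of `U n` vanishes on no nonzero positive lattice element as soon as its
relations specialize to relations of the polynomial representation. -/
theorem eq_zero_of_specialization {n : ℕ} (hn : 2 ≤ n) {B : Type} [AddCommGroup B] [Module Qv B]
    (Φ : U n →ₗ[Qv] B)
    (h : ∀ (s : Finset (List (ZMod n))) (c : List (ZMod n) → ℚ[X]),
      Φ (∑ w ∈ s, c w • wordProd UE w) = 0 → ∑ w ∈ s, (c w).eval 1 • wordProd
        (fun i => (shiftDer n (RootIdx n) 1 i : Module.End ℚ (SymP n))) w = 0)
    {ℓ : ℕ} {z : U n} (hz : z ∈ wordLattice n ℓ) (hΦ : Φ z = 0) : z = 0 := by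
  have : NeZero n := ⟨by omega⟩
  let Z : Submodule ℚ[X] (U n) :=
    { carrier := {z | z ∈ wordLattice n ℓ ∧ Φ z = 0}
      add_mem' := fun hx hy => ⟨Submodule.add_mem _ hx.1 hy.1, by rw [map_add, hx.2, hy.2, add_zero]⟩
      zero_mem' := ⟨Submodule.zero_mem _, map_zero _⟩
      smul_mem' := fun c x hx => ⟨Submodule.smul_mem _ _ hx.1, by
        rw [algebra_compatible_smul Qv c x, map_smul, hx.2, smul_zero]⟩ }
  have hfg : Z.FG := by
    have := isNoetherian_of_fg_of_noetherian _ (wordLattice_fg n ℓ)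
    exact (isNoetherian_submodule.mp this) Z fun x hx => hx.1
  have hX : algebraMap ℚ[X] Qv (X - 1) ≠ 0 := by
    rw [Ne, FaithfulSMul.algebraMap_eq_zero_iff]
    exact X_sub_C_ne_zero 1
  have hle : Z ≤ Ideal.span {(X - 1 : ℚ[X])} • Z := by
    intro z hz
    obtain ⟨c, hc, hcz⟩ := (Finsupp.mem_span_image_iff_linearCombination ℚ[X]).mp hz.1
    rw [Finsupp.linearCombination_apply, Finsupp.sum] at hcz
    let E' : ZMod n → Algebra.adjoin ℚ[X] (Set.range (UE (m := n))) :=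
      fun i => ⟨UE i, Algebra.subset_adjoin ⟨i, rfl⟩⟩
    have hE' : ClearedSerre E' :=
      ClearedSerre.of_injective (Subalgebra.val _) Subtype.val_injective (U_clearedSerre hn)
    obtain ⟨y, hy⟩ := exists_smul_of_polynomial hn hE' c.support c
      (h _ _ (by rw [hcz]; exact hz.2))
    have hy' := congrArg (Subalgebra.val _) hy
    simp only [map_sum, map_smul, map_wordProd] at hy'
    change ∑ w ∈ c.support, c w • wordProd UE w = (X - 1 : ℚ[X]) • (y : U n) at hy'
    rw [hcz] at hy'
    have hzy : z = (X - 1 : ℚ[X]) • gradeComp n 1 ℓ (y : U n) := by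
      rw [algebra_compatible_smul Qv, ← map_smul, ← algebra_compatible_smul, ← hy',
        gradeComp_of_mem_wordLattice hz.1]
    rw [Submodule.ideal_span_singleton_smul, Submodule.mem_smul_pointwise_iff_exists]
    refine ⟨_, ⟨gradeComp_mem_wordLattice ℓ y.2, ?_⟩, hzy.symm⟩
    have := hz.2
    rw [hzy, algebra_compatible_smul Qv, map_smul] at this
    exact (smul_eq_zero_iff_right hX).mp this
  obtain ⟨p, hp, hpZ⟩ := Submodule.exists_sub_one_mem_and_smul_eq_zero_of_fg_of_le_smul _ Z hfg hle
  have hp0 : algebraMap ℚ[X] Qv p ≠ 0 := by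
    rw [Ne, FaithfulSMul.algebraMap_eq_zero_iff]
    rintro rfl
    obtain ⟨q, hq⟩ := Ideal.mem_span_singleton.mp hp
    have := congrArg (eval 1) hq
    norm_num at this
  have := hpZ z ⟨hz, hΦ⟩
  rw [algebra_compatible_smul Qv] at this
  exact (smul_eq_zero_iff_right hp0).mp this

/-- Clearing denominators in `eq_zero_of_specialization`. -/
theorem eq_zero_of_specialization_of_length {n : ℕ} (hn : 2 ≤ n) {B : Type} [AddCommGroup B]
    [Module Qv B] (Φ : U n →ₗ[Qv] B)
    (h : ∀ (s : Finset (List (ZMod n))) (c : List (ZMod n) → ℚ[X]),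
      Φ (∑ w ∈ s, c w • wordProd UE w) = 0 → ∑ w ∈ s, (c w).eval 1 • wordProd
        (fun i => (shiftDer n (RootIdx n) 1 i : Module.End ℚ (SymP n))) w = 0)
    {ℓ : ℕ} (s : Finset (List (ZMod n))) (hs : ∀ w ∈ s, w.length = ℓ) (c : List (ZMod n) → Qv)
    (hΦ : Φ (∑ w ∈ s, c w • wordProd UE w) = 0) : ∑ w ∈ s, c w • wordProd UE w = 0 := by
  classical
  obtain ⟨b, hb⟩ := IsLocalization.exist_integer_multiples_of_finset (nonZeroDivisors ℚ[X])
    (s.image c)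
  have hb0 : algebraMap ℚ[X] Qv b ≠ 0 := by
    rw [Ne, FaithfulSMul.algebraMap_eq_zero_iff]
    exact nonZeroDivisors.ne_zero b.2
  rw [← smul_eq_zero_iff_right hb0]
  refine eq_zero_of_specialization hn Φ h (ℓ := ℓ) ?_ (by rw [map_smul, hΦ, smul_zero])
  rw [Finset.smul_sum]
  refine Submodule.sum_mem _ fun w hw => ?_
  obtain ⟨p, hp⟩ := hb (c w) (Finset.mem_image_of_mem c hw)
  rw [smul_smul, ← Algebra.smul_def]
  change algebraMap ℚ[X] Qv p = (b : ℚ[X]) • c w at hp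
  rw [← hp, ← algebra_compatible_smul]
  exact Submodule.smul_mem _ _ (Submodule.subset_span ⟨w, hs w hw, rfl⟩)

end PositivePart

section FoldHom

open Polynomial

variable {n r : ℕ} {ε : ℤ} (hn : 2 ≤ n) (hr : r ≤ n - 1) (hε : ε = 1 ∨ ε = -1)

/-- The homomorphism `E_i ↦ e_i`, `F_i ↦ f_i`, `K_i ↦ k_i`. -/
def foldHom : U n →ₐ[Qv] U (n + 1) := ulift (fold_urep hn hr hε)

theorem compat_fold (ι : Type) (hn : 3 ≤ n + 1) (a : ℕ) (i : ZMod n) :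
    Compat (ulift (fam_urep (ι := ι) hn a) (eElt n r ε i))
      (foldFamily r (fun j => ∑ k ∈ Finset.range a, siteE ι ℚ (n + 1) k j) i) := by
  unfold foldFamily
  split_ifs with h
  · have h1 := (compat_famE (ι := ι) (m := n + 1) a r).mul
      (compat_famE (ι := ι) a ((r + 1 : ℕ) : ZMod (n + 1)))
    have h2 := (compat_famE (ι := ι) (m := n + 1) a ((r + 1 : ℕ) : ZMod (n + 1))).mul
      (compat_famE (ι := ι) a (r : ZMod (n + 1)))
    have h3 := h2.smul (LaurentPolynomial.T ε)
    rw [lauEv_T, lauToQv_T, one_smul] at h3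
    rw [eElt_fold h, map_sub, map_smul, map_mul, map_mul, ulift_E, ulift_E]
    exact h1.sub h3
  · rw [eElt_of_ne h, ulift_E]
    exact compat_famE a _

include hn hr in
theorem foldHom_specialization (s : Finset (List (ZMod n))) (c : List (ZMod n) → ℚ[X])
    (h : foldHom hn hr hε (∑ w ∈ s, c w • wordProd UE w) = 0) :
    ∑ w ∈ s, (c w).eval 1 • wordProd
      (fun i => (shiftDer n (RootIdx n) 1 i : Module.End ℚ (SymP n))) w = 0 := by
  have : Nonempty (RootIdx n) := ⟨⟨(0, 1), le_rfl, fun h => zmod_one_ne_zero hn (by simpa using h.1)⟩⟩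
  refine polynomial_eq_zero_of_tensor (r := r) hn (by omega) s (fun w => (c w).eval 1) fun a => ?_
  have e := congrArg (ulift (fam_urep (ι := RootIdx n) (m := n + 1) (by omega) a)) h
  simp only [algebra_compatible_smul Qv (_ : ℚ[X]), map_sum, map_smul, map_wordProd, map_zero,
    foldHom, ulift_E] at e
  refine Compat.eq_zero ?_ e
  exact Compat.sum (fun w => ((Compat.wordProd (compat_fold (RootIdx n) (Nat.succ_le_succ hn) a) w).smul_polynomial _)) s

/-- The grading of `U (n + 1)` in which all `e_i` have degree `1`. -/
def foldWeight (n r : ℕ) (j : ZMod (n + 1)) : ℤ := if j = ((r + 1 : ℕ) : ZMod (n + 1)) then 0 else 1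

theorem twisted_commutator {B : Type} [Ring B] [Algebra Qv B] {t a b : B} {q : Qv}
    (h : t * b = b * t) : t * a * b - q • (b * (t * a)) = t * (a * b - q • (b * a)) := by
  rw [← mul_assoc, ← h, mul_sub, mul_smul_comm, mul_assoc, mul_assoc]

include hn hr in
theorem gradeHom_eElt (i : ZMod n) :
    gradeHom (n + 1) (foldWeight n r) (eElt n r ε i) =
      LaurentPolynomial.T 1 * LaurentPolynomial.C (eElt n r ε i) := by
  have : NeZero n := ⟨by omega⟩
  by_cases h : i.val = r
  · have h1 : (r : ZMod (n + 1)) ≠ ((r + 1 : ℕ) : ZMod (n + 1)) := by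
      rw [Ne, natCast_eq_iff (by omega) (show r + 1 < n + 1 by omega)]
      omega
    rw [eElt_fold h]
    simp only [gradeHom, foldWeight, map_sub, map_mul, map_smul, ulift_E, if_neg h1, if_true,
      LaurentPolynomial.T_zero, one_mul]
    have e : ∀ (c : Qv) (x : U (n + 1)),
        (LaurentPolynomial.C (c • x)) = c • LaurentPolynomial.C x := fun c x =>
      map_smul (AddMonoidAlgebra.singleZeroAlgHom (R := Qv) (A := U (n + 1)) (M := ℤ)) c x
    rw [e, map_mul]
    exact twisted_commutator (B := LaurentPolynomial (U (n + 1))) (LaurentPolynomial.T_mul 1 _)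
  · rw [eElt_of_ne h, gradeHom, ulift_E, foldWeight,
      if_neg (pos_cast_ne (n := n) (r := r) hn hr (ZMod.val_lt i) h).2.symm]

theorem foldHom_eq_zero (x : U n) (hx : x ∈ Submodule.span Qv (Set.range (wordProd (UE (m := n)))))
    (h : foldHom hn hr hε x = 0) : x = 0 := by
  obtain ⟨c, rfl⟩ := (Finsupp.mem_span_range_iff_exists_finsupp).mp hx
  rw [Finsupp.sum] at h ⊢
  have e : ∀ ℓ : ℕ, ∑ w ∈ c.support with w.length = ℓ, c w • wordProd UE w = 0 := fun ℓ => by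
    refine eq_zero_of_specialization_of_length hn (foldHom hn hr hε).toLinearMap
      (foldHom_specialization hn hr hε) (ℓ := ℓ) _ (fun w hw => (Finset.mem_filter.mp hw).2) c ?_
    have := congrArg (gradeComp (n + 1) (foldWeight n r) ℓ) h
    simp only [map_sum, map_smul, map_wordProd, map_zero, foldHom, ulift_E,
      gradeComp_wordProd (gradeHom_eElt hn hr)] at this
    simp only [AlgHom.toLinearMap_apply, map_sum, foldHom, Finset.sum_filter]
    rw [← this]
    refine Finset.sum_congr rfl fun w _ => ?_
    split_ifs
    · simp only [map_smul, map_wordProd, ulift_E]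
    · rw [smul_zero, map_zero]
  rw [← Finset.sum_fiberwise_of_maps_to (t := c.support.image List.length)
    (g := List.length) fun w hw => Finset.mem_image_of_mem _ hw]
  exact Finset.sum_eq_zero fun ℓ _ => e ℓ

end FoldHom

/-! ### Verma modules -/

theorem cartan_self {m : ℕ} (hm : 2 ≤ m) (i : ZMod m) : cartan i i = 2 := by
  have h := zmod_one_ne_zero hm
  unfold cartan
  rw [if_pos rfl, if_neg (by simpa using h), if_neg (by simpa [eq_sub_iff_add_eq] using h)]
  rfl

/-- The relations of `U m` other than the Serre relations. -/
structure UPre (m : ℕ) {A : Type} [Ring A] [Algebra Qv A] (E F K K' : ZMod m → A) : Prop where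
  KK : ∀ i j, K i * K j = K j * K i
  KK' : ∀ i, K i * K' i = 1
  K'K : ∀ i, K' i * K i = 1
  KE : ∀ i j, K i * E j = vv ^ cartan i j • (E j * K i)
  KF : ∀ i j, K i * F j = vv ^ (-cartan i j) • (F j * K i)
  EF : ∀ i j, E i * F j - F j * E i = if i = j then (vv - vv⁻¹)⁻¹ • (K i - K' i) else 0

section SerreCommute

variable {m : ℕ} {A : Type} [Ring A] [Algebra Qv A] {E F K K' : ZMod m → A}

theorem UPre.Kinv_comm (h : UPre m E F K K') (i j : ZMod m) : K' i * K' j = K' j * K' i := by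
  have h1 : ∀ i j, K' i * K j = K j * K' i := fun i j =>
    calc K' i * K j = K' i * (K j * K i) * K' i := by rw [mul_assoc, mul_assoc, h.KK', mul_one]
      _ = K j * K' i := by rw [h.KK, ← mul_assoc (K' i), h.K'K, one_mul]
  calc K' i * K' j = K' i * (K' j * K i) * K' i := by rw [mul_assoc, mul_assoc, h.KK', mul_one]
    _ = K' j * K' i := by rw [h1 j i, ← mul_assoc (K' i), h.K'K, one_mul]

theorem UPre.qK'E (h : UPre m E F K K') (i j : ZMod m) : QComm (-cartan i j) (K' i) (E j) :=
  QComm.inv (h.KE i j) (h.KK' i) (h.K'K i)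

theorem UPre.qK'F (h : UPre m E F K K') (i j : ZMod m) : QComm (cartan i j) (K' i) (F j) :=
  (QComm.inv (h.KF i j) (h.KK' i) (h.K'K i)).cast (neg_neg _)

/-- The relations are symmetric under exchanging `E` and `F`, `K` and `K⁻¹`. -/
theorem UPre.swap (h : UPre m E F K K') : UPre m F E K' K where
  KK := h.Kinv_comm
  KK' := h.K'K
  K'K := h.KK'
  KE := h.qK'F
  KF := h.qK'E
  EF i j := by
    rw [← neg_sub, h.EF, ← neg_sub (K i), smul_neg]
    by_cases hij : i = j
    · rw [if_pos hij, if_pos hij.symm, hij]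
    · rw [if_neg hij, if_neg (Ne.symm hij), neg_zero]

theorem URep.pre (h : URep m E F K K') : UPre m E F K K' := ⟨h.1, h.2, h.3, h.4, h.5, h.6⟩

/-- The Chevalley involution of the relations. -/
theorem URep.swap (h : URep m E F K K') : URep m F E K' K :=
  let p := h.pre.swap
  ⟨p.1, p.2, p.3, p.4, p.5, p.6, h.serreF, h.serreE⟩

end SerreCommute

section SerreCommuteAbstract

variable {k A : Type} [Field k] [Ring A] [Algebra k A]

theorem serre_two_commute_left {q d : k} (hq : q ≠ 0) {x y f K K' : A}
    (hx : x * f = f * x + d • (K - K')) (hy : y * f = f * y)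
    (hKx : K * x = (q * q) • (x * K)) (hK'x : K' * x = (q⁻¹ * q⁻¹) • (x * K'))
    (hKy : K * y = q⁻¹ • (y * K)) (hK'y : K' * y = q • (y * K')) :
    (x * x * y - (q + q⁻¹) • (x * y * x) + y * x * x) * f =
      f * (x * x * y - (q + q⁻¹) • (x * y * x) + y * x * x) := by
  have e1 : x * x * y * f = f * x * x * y + d • ((K - K') * x * y) + d • (x * (K - K') * y) := by
    rw [mul_assoc, hy, ← mul_assoc, mul_assoc x, hx, mul_add, ← mul_assoc x, hx]
    simp only [add_mul, mul_smul_comm, smul_mul_assoc, mul_assoc]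
  have e2 : x * y * x * f = f * x * y * x + d • ((K - K') * y * x) + d • (x * y * (K - K')) := by
    rw [mul_assoc, hx, mul_add, ← mul_assoc, mul_assoc x, hy, ← mul_assoc x, hx]
    simp only [add_mul, mul_smul_comm, smul_mul_assoc, mul_assoc]
  have e3 : y * x * x * f = f * y * x * x + d • (y * (K - K') * x) + d • (y * x * (K - K')) := by
    rw [mul_assoc, hx, mul_add, ← mul_assoc, mul_assoc y, hx, mul_add, ← mul_assoc y, hy]
    simp only [add_mul, mul_smul_comm, smul_mul_assoc, mul_assoc]
  rw [add_mul, sub_mul, smul_mul_assoc, e1, e2, e3]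
  simp only [mul_add, mul_sub, sub_mul, mul_smul_comm, smul_mul_assoc, mul_assoc, hKx, hK'x, hKy, hK'y]
  match_scalars <;> field_simp <;> ring

theorem serre_two_commute_right {q d : k} (hq : q ≠ 0) {x y f K K' : A}
    (hy : y * f = f * y + d • (K - K')) (hx : x * f = f * x)
    (hKx : K * x = q⁻¹ • (x * K)) (hK'x : K' * x = q • (x * K')) :
    (x * x * y - (q + q⁻¹) • (x * y * x) + y * x * x) * f =
      f * (x * x * y - (q + q⁻¹) • (x * y * x) + y * x * x) := by
  have hxl : ∀ z, x * (f * z) = f * (x * z) := fun z => by rw [← mul_assoc, hx, mul_assoc]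
  have hyl : ∀ z, y * (f * z) = f * (y * z) + d • (K * z - K' * z) := fun z => by
    rw [← mul_assoc, hy, add_mul, mul_assoc, smul_mul_assoc, sub_mul]
  have r1 : ∀ z, K * (x * z) = q⁻¹ • (x * (K * z)) := fun z => by
    rw [← mul_assoc, hKx, smul_mul_assoc, mul_assoc]
  have r2 : ∀ z, K' * (x * z) = q • (x * (K' * z)) := fun z => by
    rw [← mul_assoc, hK'x, smul_mul_assoc, mul_assoc]
  simp only [add_mul, sub_mul, smul_mul_assoc, mul_assoc, hx, hy, hxl, hyl, mul_add, mul_sub,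
    mul_smul_comm, r1, r2, hKx, hK'x]
  match_scalars <;> field_simp <;> ring

end SerreCommuteAbstract

section SerreCommute

variable {m : ℕ} {A : Type} [Ring A] [Algebra Qv A] {E F K K' : ZMod m → A}

theorem UPre.EF_ne (h : UPre m E F K K') {i j : ZMod m} (hij : i ≠ j) :
    E i * F j = F j * E i := by
  rw [← sub_eq_zero, h.EF, if_neg hij]

theorem UPre.EF_self (h : UPre m E F K K') (i : ZMod m) :
    E i * F i = F i * E i + (vv - vv⁻¹)⁻¹ • (K i - K' i) := by
  rw [← sub_eq_iff_eq_add', h.EF, if_pos rfl]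

/-- The positive Serre elements commute with the negative generators. -/
theorem UPre.serre_commute (hm : 3 ≤ m) (h : UPre m E F K K') {i j : ZMod m} (hij : i ≠ j)
    (k : ZMod m) : serreSum (E i) (E j) (1 - cartan i j).toNat * F k =
      F k * serreSum (E i) (E j) (1 - cartan i j).toNat := by
  have hci : cartan i i = 2 := cartan_self (by omega) i
  have hcj : cartan j j = 2 := cartan_self (by omega) j
  have hcomm : cartan j i = cartan i j := cartan_comm _ _
  rcases cartan_cases hm hij with hc | hc
  · have e : (1 - cartan i j).toNat = 1 := by rw [hc]; rfl
    have c1 : ∀ a b, cartan a b = 0 → K a * E b = E b * K a := fun a b hab => by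
      rw [h.KE, hab, zpow_zero, one_smul]
    have c2 : ∀ a b, cartan a b = 0 → K' a * E b = E b * K' a := fun a b hab => by
      have := h.qK'E a b
      rwa [hab, neg_zero, QComm, zpow_zero, one_smul] at this
    have key : ∀ a b, a ≠ b → cartan a b = 0 →
        E a * E b * F a - F a * (E a * E b) = E b * E a * F a - F a * (E b * E a) := by
      intro a b hab hc
      rw [mul_assoc, h.EF_ne hab.symm, mul_assoc, h.EF_self, ← mul_assoc, h.EF_self, mul_add,
        ← mul_assoc (E b), h.EF_ne hab.symm, add_mul, smul_mul_assoc, mul_smul_comm, sub_mul,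
        mul_sub, c1 _ _ hc, c2 _ _ hc]
      simp only [mul_assoc]
      abel
    rw [e, serreSum_one, ← sub_eq_zero, sub_mul, mul_sub]
    by_cases hi : k = i
    · subst hi
      rw [← neg_eq_zero, ← sub_eq_zero.mpr (key _ _ hij hc)]
      abel
    · by_cases hj : k = j
      · subst hj
        rw [← sub_eq_zero.mpr (key _ _ hij.symm (hcomm.trans hc))]
        abel
      · rw [mul_assoc, h.EF_ne (Ne.symm hi), ← mul_assoc, h.EF_ne (Ne.symm hj), mul_assoc (E i),
          h.EF_ne (Ne.symm hj), ← mul_assoc (E i), h.EF_ne (Ne.symm hi)]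
        simp only [mul_assoc]
        abel
  · have e : (1 - cartan i j).toNat = 2 := by rw [hc]; rfl
    have two : vv ^ (2 : ℤ) = vv * vv := by rw [zpow_ofNat, pow_two]
    have ntwo : vv ^ (-2 : ℤ) = vv⁻¹ * vv⁻¹ := by rw [zpow_neg, two, mul_inv]
    rw [e]
    apply smul_right_injective A (qint_ne_zero (show 0 < 2 by norm_num))
    dsimp only
    rw [← smul_mul_assoc, ← mul_smul_comm, serreSum_two]
    have q1 := h.KE i i
    have q2 := h.KE i j
    have q3 : K' i * E i = _ := h.qK'E i i
    have q4 : K' i * E j = _ := h.qK'E i j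
    have q5 := h.KE j i
    have q6 : K' j * E i = _ := h.qK'E j i
    rw [hci] at q1 q3
    rw [hc] at q2 q4
    rw [hcomm, hc] at q5 q6
    rw [two] at q1
    rw [ntwo] at q3
    rw [zpow_neg_one] at q2 q5
    rw [neg_neg, zpow_one] at q4 q6
    by_cases hi : k = i
    · subst hi
      exact serre_two_commute_left vv_ne_zero (h.EF_self k) (h.EF_ne hij.symm) q1 q3 q2 q4
    · by_cases hj : k = j
      · subst hj
        exact serre_two_commute_right vv_ne_zero (h.EF_self k) (h.EF_ne hij) q5 q6
      · have c1 : Commute (E i) (F k) := h.EF_ne (Ne.symm hi)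
        have c2 : Commute (E j) (F k) := h.EF_ne (Ne.symm hj)
        exact ((((c1.mul_left c1).mul_left c2).sub_left
          (((c1.mul_left c2).mul_left c1).smul_left _)).add_left ((c2.mul_left c1).mul_left c1)).eq

end SerreCommute

section Verma

variable (m : ℕ)

/-- The free module on words, underlying the Verma module. -/
abbrev WordMod : Type := List (ZMod m) →₀ Qv

variable {m} (lam : ZMod m → Qvˣ)

/-- The weight of a word with respect to `K_i`. -/
def wordWeight (i : ZMod m) (w : List (ZMod m)) : Qv :=
  lam i * vv ^ (-(w.map (cartan i)).sum)

theorem wordWeight_ne_zero (i : ZMod m) (w : List (ZMod m)) : wordWeight lam i w ≠ 0 :=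
  mul_ne_zero (lam i).ne_zero (zpow_ne_zero _ vv_ne_zero)

theorem wordWeight_cons (i j : ZMod m) (w : List (ZMod m)) :
    wordWeight lam i (j :: w) = vv ^ (-cartan i j) * wordWeight lam i w := by
  rw [wordWeight, wordWeight, List.map_cons, List.sum_cons, neg_add, zpow_add₀ vv_ne_zero]
  ring

/-- The diagonal operator with given eigenvalues. -/
def diagOp (c : List (ZMod m) → Qv) : Module.End Qv (WordMod m) :=
  Finsupp.linearCombination Qv fun w => c w • Finsupp.single w 1

/-- The lowering operators. -/
def vermaF (i : ZMod m) : Module.End Qv (WordMod m) :=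
  Finsupp.linearCombination Qv fun w => Finsupp.single (i :: w) 1

/-- The raising operators on words. -/
def vermaEList (i : ZMod m) : List (ZMod m) → WordMod m
  | [] => 0
  | j :: w => vermaF j (vermaEList i w) + if i = j then
      ((vv - vv⁻¹)⁻¹ * (wordWeight lam i w - (wordWeight lam i w)⁻¹)) • Finsupp.single w 1 else 0

/-- The raising operators. -/
def vermaE (i : ZMod m) : Module.End Qv (WordMod m) :=
  Finsupp.linearCombination Qv (vermaEList lam i)

/-- The Cartan operators. -/
def vermaK (i : ZMod m) : Module.End Qv (WordMod m) := diagOp (wordWeight lam i)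

/-- The inverse Cartan operators. -/
def vermaK' (i : ZMod m) : Module.End Qv (WordMod m) := diagOp fun w => (wordWeight lam i w)⁻¹

theorem diagOp_single (c : List (ZMod m) → Qv) (w) :
    diagOp c (Finsupp.single w 1) = c w • Finsupp.single w 1 := by
  rw [diagOp, Finsupp.linearCombination_single, one_smul]

theorem vermaF_single (i : ZMod m) (w) :
    vermaF i (Finsupp.single w 1) = Finsupp.single (i :: w) 1 := by
  rw [vermaF, Finsupp.linearCombination_single, one_smul]

theorem vermaE_single (i : ZMod m) (w) :
    vermaE lam i (Finsupp.single w 1) = vermaEList lam i w := by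
  rw [vermaE, Finsupp.linearCombination_single, one_smul]

theorem wordMod_ext {f g : Module.End Qv (WordMod m)}
    (h : ∀ w, f (Finsupp.single w 1) = g (Finsupp.single w 1)) : f = g :=
  Finsupp.lhom_ext' fun w => LinearMap.ext_ring (h w)

theorem verma_KF (i j : ZMod m) :
    vermaK lam i * vermaF j = vv ^ (-cartan i j) • (vermaF j * vermaK lam i) := by
  refine wordMod_ext fun w => ?_
  rw [LinearMap.smul_apply, Module.End.mul_apply, Module.End.mul_apply, vermaF_single, vermaK,
    diagOp_single, diagOp_single, map_smul, vermaF_single, smul_smul, wordWeight_cons]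

theorem verma_EF (i j : ZMod m) : vermaE lam i * vermaF j - vermaF j * vermaE lam i =
    if i = j then (vv - vv⁻¹)⁻¹ • (vermaK lam i - vermaK' lam i) else 0 := by
  refine wordMod_ext fun w => ?_
  rw [LinearMap.sub_apply, Module.End.mul_apply, Module.End.mul_apply, vermaF_single,
    vermaE_single, vermaE_single, vermaEList, add_sub_cancel_left]
  split_ifs
  · rw [LinearMap.smul_apply, LinearMap.sub_apply, vermaK, vermaK', diagOp_single, diagOp_single,
      ← sub_smul, smul_smul]
  · rfl

theorem vermaE_nil (i : ZMod m) : vermaE lam i (Finsupp.single [] 1) = 0 :=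
  vermaE_single _ _ _

theorem verma_pre : UPre m (vermaE lam) vermaF (vermaK lam) (vermaK' lam) where
  KK i j := wordMod_ext fun w => by
    simp only [Module.End.mul_apply, vermaK, diagOp_single, map_smul, smul_smul, mul_comm]
  KK' i := wordMod_ext fun w => by
    simp only [Module.End.mul_apply, vermaK, vermaK', diagOp_single, map_smul, smul_smul,
      inv_mul_cancel₀ (wordWeight_ne_zero lam i w), one_smul, Module.End.one_apply]
  K'K i := wordMod_ext fun w => by
    simp only [Module.End.mul_apply, vermaK, vermaK', diagOp_single, map_smul, smul_smul,
      mul_inv_cancel₀ (wordWeight_ne_zero lam i w), one_smul, Module.End.one_apply]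
  KE i j := wordMod_ext fun w => by
    rw [LinearMap.smul_apply]
    simp only [Module.End.mul_apply]
    induction w with
    | nil =>
      rw [vermaE_single, vermaEList, vermaK, diagOp_single, map_smul, vermaE_single, vermaEList,
        map_zero, smul_zero, smul_zero]
    | cons k w ih =>
      have hk := LinearMap.congr_fun (verma_KF lam i k)
      simp only [LinearMap.smul_apply, Module.End.mul_apply] at hk
      rw [vermaE_single, vermaEList, map_add, hk, ← vermaE_single, ih]
      rw [vermaK, diagOp_single, diagOp_single, wordWeight_cons]
      simp only [map_smul, vermaE_single, vermaEList, smul_add, smul_smul]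
      congr 1
      · congr 1
        ring
      · split_ifs with hjk
        · rw [map_smul, diagOp_single, smul_smul, smul_smul, hjk]
          congr 1
          have := zpow_ne_zero (cartan i k) vv_ne_zero
          rw [zpow_neg]
          field_simp
        · rw [map_zero, smul_zero]
  KF := verma_KF lam
  EF := verma_EF lam

end Verma

section SerreOperators

variable {A : Type} [Ring A] [Algebra Qv A]

theorem SemiconjBy.serreSum {k x x' y y' : A} (hx : SemiconjBy k x x') (hy : SemiconjBy k y y')
    (s : ℕ) : SemiconjBy k (serreSum x y s) (serreSum x' y' s) := by
  have hd : ∀ p, SemiconjBy k (dp x p) (dp x' p) := fun p => by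
    have := hx.pow_right p
    unfold SemiconjBy at this ⊢
    rw [dp, dp, mul_smul_comm, smul_mul_assoc, this]
  unfold SemiconjBy
  rw [_root_.serreSum, _root_.serreSum, Finset.mul_sum, Finset.sum_mul]
  refine Finset.sum_congr rfl fun p _ => ?_
  rw [mul_smul_comm, smul_mul_assoc, (((hd p).mul_right hy).mul_right (hd _)).eq]

theorem QComm.semiconj {c : ℤ} {k e : A} (h : QComm c k e) : SemiconjBy k e (vv ^ c • e) := by
  unfold SemiconjBy
  rw [h, smul_mul_assoc]

theorem QComm.serreSum {c d : ℤ} {k x y : A} (hx : QComm c k x) (hy : QComm d k y) (s : ℕ) :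
    k * serreSum x y s = ((vv ^ c) ^ s * vv ^ d) • (serreSum x y s * k) := by
  rw [(hx.semiconj.serreSum hy.semiconj s).eq, serreSum_smul, smul_mul_assoc]

variable {M : Type} [AddCommGroup M] [Module Qv M]

theorem dp_apply_eq_zero {x : Module.End Qv M} {v : M} (hx : x v = 0) {p : ℕ} (hp : p ≠ 0) :
    dp x p v = 0 := by
  obtain ⟨p, rfl⟩ := Nat.exists_eq_succ_of_ne_zero hp
  rw [dp, LinearMap.smul_apply, pow_succ, Module.End.mul_apply, hx, map_zero, smul_zero]

theorem serreSum_apply_eq_zero {x y : Module.End Qv M} {v : M} (hx : x v = 0) (hy : y v = 0)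
    (s : ℕ) : serreSum x y s v = 0 := by
  rw [serreSum, LinearMap.sum_apply]
  refine Finset.sum_eq_zero fun p _ => ?_
  rw [LinearMap.smul_apply, Module.End.mul_apply, Module.End.mul_apply]
  by_cases h : s - p = 0
  · rw [h, dp_zero, Module.End.one_apply, hy, map_zero, smul_zero]
  · rw [dp_apply_eq_zero hx h, map_zero, map_zero, smul_zero]

theorem functional_serreSum {x y : Module.End Qv M} {f : M →ₗ[Qv] Qv} (hx : ∀ v, f (x v) = 0)
    (hy : ∀ v, f (y v) = 0) (s : ℕ) (v : M) : f (serreSum x y s v) = 0 := by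
  rw [serreSum, LinearMap.sum_apply, map_sum]
  refine Finset.sum_eq_zero fun p _ => ?_
  rw [LinearMap.smul_apply, Module.End.mul_apply, Module.End.mul_apply, map_smul]
  cases p with
  | zero => rw [dp_zero, Module.End.one_apply, hy, smul_zero]
  | succ p =>
    rw [dp, LinearMap.smul_apply, map_smul, pow_succ' x p, Module.End.mul_apply, hx, smul_zero,
      smul_zero]

end SerreOperators

section Stabilizer

variable {M : Type} [AddCommGroup M] [Module Qv M] (N : Submodule Qv M)

/-- The algebra of operators preserving a submodule. -/
def stabilizerAlg : Subalgebra Qv (Module.End Qv M) where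
  carrier := {f | N ≤ N.comap f}
  mul_mem' hf hg _ hx := hf (hg hx)
  add_mem' hf hg _ hx := N.add_mem (hf hx) (hg hx)
  algebraMap_mem' c _ hx := N.smul_mem c hx

/-- The action on the quotient of the operators preserving a submodule. -/
def stabilizerQuot : stabilizerAlg N →ₐ[Qv] Module.End Qv (M ⧸ N) where
  toFun f := N.mapQ N f f.2
  map_one' := Submodule.linearMap_qext _ (LinearMap.ext fun _ => rfl)
  map_mul' _ _ := Submodule.linearMap_qext _ (LinearMap.ext fun _ => rfl)
  map_zero' := Submodule.linearMap_qext _ (LinearMap.ext fun _ => rfl)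
  map_add' _ _ := Submodule.linearMap_qext _ (LinearMap.ext fun _ => rfl)
  commutes' _ := Submodule.linearMap_qext _ (LinearMap.ext fun _ => rfl)

theorem stabilizerQuot_mk (f : stabilizerAlg N) (x : M) :
    stabilizerQuot N f (N.mkQ x) = N.mkQ (f.1 x) := rfl

theorem stabilizerQuot_eq_zero {f : stabilizerAlg N} (h : ∀ x, f.1 x ∈ N) :
    stabilizerQuot N f = 0 :=
  Submodule.linearMap_qext _ (LinearMap.ext fun x =>
    ((stabilizerQuot_mk N f x).trans ((Submodule.Quotient.mk_eq_zero N).mpr (h x))))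

/-- Operators satisfying the relations up to a stable submodule act on the quotient. -/
theorem UPre.quotient {m : ℕ} {E F K K' : ZMod m → Module.End Qv M} (h : UPre m E F K K')
    (hE : ∀ i, E i ∈ stabilizerAlg N) (hF : ∀ i, F i ∈ stabilizerAlg N)
    (hK : ∀ i, K i ∈ stabilizerAlg N) (hK' : ∀ i, K' i ∈ stabilizerAlg N)
    (sE : ∀ i j, i ≠ j → ∀ x, serreSum (E i) (E j) (1 - cartan i j).toNat x ∈ N)
    (sF : ∀ i j, i ≠ j → ∀ x, serreSum (F i) (F j) (1 - cartan i j).toNat x ∈ N) :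
    URep m (fun i => stabilizerQuot N ⟨E i, hE i⟩) (fun i => stabilizerQuot N ⟨F i, hF i⟩)
      (fun i => stabilizerQuot N ⟨K i, hK i⟩) (fun i => stabilizerQuot N ⟨K' i, hK' i⟩) where
  KK i j := by rw [← map_mul, ← map_mul]; exact congrArg _ (Subtype.ext (h.KK i j))
  KK' i := by rw [← map_mul, ← map_one (stabilizerQuot N)]; exact congrArg _ (Subtype.ext (h.KK' i))
  K'K i := by rw [← map_mul, ← map_one (stabilizerQuot N)]; exact congrArg _ (Subtype.ext (h.K'K i))
  KE i j := by
    rw [← map_mul, ← map_mul, ← map_smul]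
    exact congrArg _ (Subtype.ext (h.KE i j))
  KF i j := by
    rw [← map_mul, ← map_mul, ← map_smul]
    exact congrArg _ (Subtype.ext (h.KF i j))
  EF i j := by
    have := h.EF i j
    split_ifs at this ⊢
    · rw [← map_mul, ← map_mul, ← map_sub, ← map_sub, ← map_smul]
      exact congrArg _ (Subtype.ext this)
    · rw [← map_mul, ← map_mul, ← map_sub, ← map_zero (stabilizerQuot N)]
      exact congrArg _ (Subtype.ext this)
  serreE i j hij := by
    rw [← serreSum_map]
    refine stabilizerQuot_eq_zero N fun x => ?_
    have := serreSum_map (stabilizerAlg N).val ⟨E i, hE i⟩ ⟨E j, hE j⟩ (1 - cartan i j).toNat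
    rw [Subalgebra.val_apply] at this
    rw [this]
    exact sE i j hij x
  serreF i j hij := by
    rw [← serreSum_map]
    refine stabilizerQuot_eq_zero N fun x => ?_
    have := serreSum_map (stabilizerAlg N).val ⟨F i, hF i⟩ ⟨F j, hF j⟩ (1 - cartan i j).toNat
    rw [Subalgebra.val_apply] at this
    rw [this]
    exact sF i j hij x

end Stabilizer

section VermaQuotient

variable {m : ℕ} (hm : 3 ≤ m) (lam : ZMod m → Qvˣ)

include hm in
theorem verma_serreE {i j : ZMod m} (hij : i ≠ j) :
    serreSum (vermaE lam i) (vermaE lam j) (1 - cartan i j).toNat = 0 := by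
  refine wordMod_ext fun w => ?_
  induction w with
  | nil => exact serreSum_apply_eq_zero (vermaE_nil lam i) (vermaE_nil lam j) _
  | cons k w ih =>
    rw [← vermaF_single]
    have := LinearMap.congr_fun ((verma_pre lam).serre_commute hm hij k) (Finsupp.single w 1)
    rw [Module.End.mul_apply, Module.End.mul_apply, ih] at this
    rw [this, LinearMap.zero_apply, LinearMap.zero_apply, map_zero]

variable (m) in
/-- The submodule generated by the negative Serre relations. -/
def serreSubmodule : Submodule Qv (WordMod m) :=
  Submodule.span Qv {x | ∃ (w : List (ZMod m)) (i j : ZMod m) (y : WordMod m), i ≠ j ∧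
    x = wordProd vermaF w (serreSum (vermaF i) (vermaF j) (1 - cartan i j).toNat y)}

theorem mem_serreSubmodule (w : List (ZMod m)) {i j : ZMod m} (hij : i ≠ j) (y : WordMod m) :
    wordProd vermaF w (serreSum (vermaF i) (vermaF j) (1 - cartan i j).toNat y) ∈
      serreSubmodule m := Submodule.subset_span ⟨w, i, j, y, hij, rfl⟩

theorem mem_stabilizer_serreSubmodule {f : Module.End Qv (WordMod m)}
    (h : ∀ w i j y, i ≠ j → f (wordProd vermaF w
      (serreSum (vermaF i) (vermaF j) (1 - cartan i j).toNat y)) ∈ serreSubmodule m) :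
    f ∈ stabilizerAlg (serreSubmodule m) :=
  Submodule.span_le.mpr fun _ ⟨w, i, j, y, hij, hx⟩ => hx ▸ h w i j y hij

theorem vermaF_stable (k : ZMod m) : vermaF k ∈ stabilizerAlg (serreSubmodule m) :=
  mem_stabilizer_serreSubmodule fun w _ _ y hij => mem_serreSubmodule (k :: w) hij y

theorem stable_of_qcomm {f : Module.End Qv (WordMod m)} {c : ZMod m → ℤ}
    (h : ∀ i, QComm (c i) f (vermaF i)) : f ∈ stabilizerAlg (serreSubmodule m) := by
  refine mem_stabilizer_serreSubmodule fun w i j y hij => ?_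
  induction w with
  | nil =>
    have := LinearMap.congr_fun (QComm.serreSum (h i) (h j) (1 - cartan i j).toNat) y
    rw [LinearMap.smul_apply, Module.End.mul_apply, Module.End.mul_apply] at this
    exact this ▸ Submodule.smul_mem _ _ (mem_serreSubmodule [] hij _)
  | cons k w ih =>
    have := LinearMap.congr_fun (h k)
      (wordProd vermaF w (serreSum (vermaF i) (vermaF j) (1 - cartan i j).toNat y))
    rw [LinearMap.smul_apply, Module.End.mul_apply, Module.End.mul_apply] at this
    exact this ▸ Submodule.smul_mem _ _ (vermaF_stable k ih)

theorem vermaK_stable (k : ZMod m) : vermaK lam k ∈ stabilizerAlg (serreSubmodule m) :=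
  stable_of_qcomm fun i => verma_KF lam k i

theorem vermaK'_stable (k : ZMod m) : vermaK' lam k ∈ stabilizerAlg (serreSubmodule m) :=
  stable_of_qcomm fun i => (verma_pre lam).qK'F k i

include hm in
theorem vermaE_stable (k : ZMod m) : vermaE lam k ∈ stabilizerAlg (serreSubmodule m) := by
  refine mem_stabilizer_serreSubmodule fun w i j y hij => ?_
  induction w with
  | nil =>
    have := LinearMap.congr_fun ((verma_pre lam).swap.serre_commute hm hij k) y
    rw [Module.End.mul_apply, Module.End.mul_apply] at this
    exact this ▸ mem_serreSubmodule [] hij _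
  | cons l w ih =>
    have := LinearMap.congr_fun (verma_EF lam k l)
      (wordProd vermaF w (serreSum (vermaF i) (vermaF j) (1 - cartan i j).toNat y))
    rw [LinearMap.sub_apply, Module.End.mul_apply, Module.End.mul_apply, sub_eq_iff_eq_add] at this
    refine this ▸ Submodule.add_mem _ ?_ (vermaF_stable l ih)
    split_ifs
    · exact Submodule.smul_mem _ _ (Submodule.sub_mem _
        (vermaK_stable lam k (mem_serreSubmodule w hij y))
        (vermaK'_stable lam k (mem_serreSubmodule w hij y)))
    · exact Submodule.zero_mem _

theorem vermaF_apply_nil (i : ZMod m) (x : WordMod m) :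
    Finsupp.lapply (R := Qv) (M := Qv) [] (vermaF i x) = 0 := by
  have : (Finsupp.lapply (R := Qv) (M := Qv) []).comp (vermaF i) = (0 : WordMod m →ₗ[Qv] Qv) := by
    refine Finsupp.lhom_ext' fun w => LinearMap.ext_ring ?_
    change (vermaF i (Finsupp.single w 1)) [] = 0
    rw [vermaF_single, Finsupp.single_apply, if_neg (List.cons_ne_nil _ _)]
  exact LinearMap.congr_fun this x

theorem serreSubmodule_le_ker :
    serreSubmodule m ≤ LinearMap.ker (Finsupp.lapply (R := Qv) (M := Qv) ([] : List (ZMod m))) := by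
  refine Submodule.span_le.mpr ?_
  rintro _ ⟨w, i, j, y, hij, rfl⟩
  cases w with
  | nil => exact functional_serreSum (vermaF_apply_nil i) (vermaF_apply_nil j) _ y
  | cons k w => exact vermaF_apply_nil k _

include hm in
/-- There is a representation with a vector of prescribed weight. -/
theorem exists_weight_vector : ∃ (V : Type) (_ : AddCommGroup V) (_ : Module Qv V)
    (θ : U m →ₐ[Qv] Module.End Qv V) (v : V), v ≠ 0 ∧ ∀ i, θ (UK i) v = (lam i : Qv) • v := by
  refine ⟨WordMod m ⧸ serreSubmodule m, inferInstance, inferInstance,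
    ulift ((verma_pre lam).quotient (serreSubmodule m) (vermaE_stable hm lam) vermaF_stable
      (vermaK_stable lam) (vermaK'_stable lam)
      (fun i j hij x => by rw [verma_serreE hm lam hij]; exact Submodule.zero_mem _)
      (fun i j hij x => mem_serreSubmodule [] hij x)),
    (serreSubmodule m).mkQ (Finsupp.single [] 1), ?_, fun i => ?_⟩
  · intro h
    have := serreSubmodule_le_ker ((Submodule.Quotient.mk_eq_zero _).mp h)
    rw [LinearMap.mem_ker, Finsupp.lapply_apply, Finsupp.single_eq_same] at this
    exact one_ne_zero this
  · rw [ulift_K, stabilizerQuot_mk, ← map_smul]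
    refine congrArg _ ?_
    change vermaK lam i _ = _
    rw [vermaK, diagOp_single, wordWeight, List.map_nil, List.sum_nil, neg_zero, zpow_zero, mul_one]

end VermaQuotient

section KMonomials

/-- The exponent lattice of the monomials in the `K_i`. -/
abbrev KLattice (n : ℕ) : Type := ZMod n → Multiplicative ℤ

variable {n : ℕ} [NeZero n]

/-- The exponent of `K_i`. -/
def kGen (i : ZMod n) : KLattice n := Pi.mulSingle i (Multiplicative.ofAdd 1)

theorem KLattice_induction {P : KLattice n → Prop} (one : P 1) (mul : ∀ a b, P a → P b → P (a * b))
    (inv : ∀ a, P a → P a⁻¹) (gen : ∀ i, P (kGen i)) (μ : KLattice n) : P μ := by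
  let S : Subgroup (KLattice n) :=
    { carrier := {a | P a}, one_mem' := one, mul_mem' := fun ha hb => mul _ _ ha hb,
      inv_mem' := fun ha => inv _ ha }
  change μ ∈ S
  rw [← Finset.univ_prod_mulSingle μ]
  refine S.prod_mem fun i _ => ?_
  have : Pi.mulSingle i (μ i) = kGen i ^ (Multiplicative.toAdd (μ i)) := by
    rw [kGen, ← Pi.mulSingle_zpow, ← ofAdd_zsmul, smul_eq_mul, mul_one, ofAdd_toAdd]
  rw [this]
  exact S.zpow_mem (gen i) _

theorem KLattice_hom_ext {B : Type} [Monoid B] {f g : KLattice n →* B}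
    (h : ∀ i, f (kGen i) = g (kGen i)) : f = g := by
  refine MonoidHom.ext fun μ => KLattice_induction (P := fun μ => f μ = g μ) (by rw [map_one, map_one])
    (fun a b ha hb => by rw [map_mul, map_mul, ha, hb]) (fun a ha => ?_) h μ
  refine left_inv_eq_right_inv (a := f a) (by rw [← map_mul, inv_mul_cancel, map_one]) ?_
  rw [ha, ← map_mul, mul_inv_cancel, map_one]

/-- `K_i` as a unit. -/
def kUnit (i : ZMod n) : (U n)ˣ := ⟨UK i, UKinv i, (U_urep n).KK' i, (U_urep n).K'K i⟩

omit [NeZero n] in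
theorem kUnit_commute (i j : ZMod n) (x y : Multiplicative ℤ) :
    Commute ((Units.coeHom (U n)).comp (zpowersHom _ (kUnit i)) x)
      ((Units.coeHom (U n)).comp (zpowersHom _ (kUnit j)) y) := by
  have h : Commute (kUnit i) (kUnit j) := Units.ext ((U_urep n).KK i j)
  exact congrArg Units.val ((h.zpow_zpow (Multiplicative.toAdd x) (Multiplicative.toAdd y)).eq)

/-- The monomials in the `K_i`. -/
def kMon (n : ℕ) [NeZero n] : KLattice n →* U n :=
  MonoidHom.noncommPiCoprod (fun i => (Units.coeHom (U n)).comp (zpowersHom _ (kUnit i)))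
    fun i j _ => kUnit_commute i j

theorem kMon_gen (i : ZMod n) : kMon n (kGen i) = UK i := by
  refine (MonoidHom.noncommPiCoprod_mulSingle _ i _).trans ?_
  rw [MonoidHom.comp_apply, zpowersHom_apply, toAdd_ofAdd, zpow_one]
  rfl

theorem kMon_inv_mul (μ : KLattice n) : kMon n μ⁻¹ * kMon n μ = 1 := by
  rw [← map_mul, inv_mul_cancel, map_one]

theorem kMon_gen_inv (i : ZMod n) : kMon n (kGen i)⁻¹ = UKinv i :=
  left_inv_eq_right_inv (kMon_inv_mul _) (by rw [kMon_gen]; exact (U_urep n).KK' i)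

/-- The character of the exponent lattice with prescribed values, as a homomorphism in the
values. -/
def kChar (μ : KLattice n) : (ZMod n → Qvˣ) →* Qv where
  toFun t := ((∏ i, t i ^ Multiplicative.toAdd (μ i) : Qvˣ) : Qv)
  map_one' := by simp
  map_mul' s t := by simp [mul_zpow, Finset.prod_mul_distrib]

theorem kChar_mul (μ ν : KLattice n) (t) : kChar (μ * ν) t = kChar μ t * kChar ν t := by
  simp only [kChar, MonoidHom.coe_mk, OneHom.coe_mk, Pi.mul_apply, toAdd_mul, zpow_add,
    Finset.prod_mul_distrib, Units.val_mul]

theorem kChar_one (t) : kChar (1 : KLattice n) t = 1 := by simp [kChar]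

theorem kChar_mulSingle (μ : KLattice n) (i : ZMod n) (u : Qvˣ) :
    kChar μ (Pi.mulSingle i u) = ((u ^ Multiplicative.toAdd (μ i) : Qvˣ) : Qv) := by
  refine congrArg Units.val ?_
  rw [Finset.prod_eq_single i]
  · rw [Pi.mulSingle_eq_same]
  · intro j _ hj
    rw [Pi.mulSingle_eq_of_ne hj, one_zpow]
  · exact fun h => absurd (Finset.mem_univ _) h

theorem kChar_gen (i : ZMod n) (t : ZMod n → Qvˣ) : kChar (kGen i) t = t i := by
  refine congrArg Units.val ?_
  rw [Finset.prod_eq_single i]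
  · rw [kGen, Pi.mulSingle_eq_same, toAdd_ofAdd, zpow_one]
  · intro j _ hj
    rw [kGen, Pi.mulSingle_eq_of_ne hj, toAdd_one, zpow_zero]
  · exact fun h => absurd (Finset.mem_univ _) h

theorem kChar_injective : Function.Injective (kChar (n := n)) := by
  intro μ ν h
  funext i
  have hi := DFunLike.congr_fun h (Pi.mulSingle i (Units.mk0 vv vv_ne_zero))
  rw [kChar_mulSingle, kChar_mulSingle, Units.val_zpow_eq_zpow_val, Units.val_zpow_eq_zpow_val,
    Units.val_mk0] at hi
  by_contra hne
  refine vv_zpow_ne_one (k := Multiplicative.toAdd (μ i) - Multiplicative.toAdd (ν i))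
    (sub_ne_zero.mpr fun h => hne (Multiplicative.toAdd.injective h)) ?_
  rw [zpow_sub₀ vv_ne_zero, hi, div_self (zpow_ne_zero _ vv_ne_zero)]

theorem kMon_apply_weight {V : Type} [AddCommGroup V] [Module Qv V]
    {f : KLattice n →* Module.End Qv V} {v : V} {t : ZMod n → Qvˣ}
    (h : ∀ i, f (kGen i) v = (t i : Qv) • v) (μ : KLattice n) : f μ v = kChar μ t • v := by
  refine KLattice_induction (P := fun μ => f μ v = kChar μ t • v) ?_ (fun a b ha hb => ?_)
    (fun a ha => ?_) (fun i => by rw [h, kChar_gen]) μ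
  · rw [map_one, kChar_one, one_smul, Module.End.one_apply]
  · rw [map_mul, Module.End.mul_apply, hb, map_smul, ha, smul_smul, kChar_mul, mul_comm]
  · have h1 : kChar a⁻¹ t * kChar a t = 1 := by rw [← kChar_mul, inv_mul_cancel, kChar_one]
    have h2 : f a⁻¹ (f a v) = v := by
      rw [← Module.End.mul_apply, ← map_mul, inv_mul_cancel, map_one, Module.End.one_apply]
    rw [ha, map_smul] at h2
    calc f a⁻¹ v = kChar a⁻¹ t • kChar a t • f a⁻¹ v := by rw [smul_smul, h1, one_smul]
      _ = kChar a⁻¹ t • v := by rw [h2]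

/-- Monomials separated by characters are linearly independent. -/
theorem linearIndependent_of_characters {A : Type} [Ring A] [Algebra Qv A] (k : KLattice n →* A)
    (h : ∀ t : ZMod n → Qvˣ, ∃ (V : Type) (_ : AddCommGroup V) (_ : Module Qv V)
      (θ : A →ₐ[Qv] Module.End Qv V) (v : V), v ≠ 0 ∧ ∀ i, θ (k (kGen i)) v = (t i : Qv) • v) :
    LinearIndependent Qv k := by
  have hL := (linearIndependent_monoidHom (ZMod n → Qvˣ) Qv).comp _ (kChar_injective (n := n))
  rw [linearIndependent_iff'] at hL ⊢
  intro s c hc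
  refine hL s c (funext fun t => ?_)
  obtain ⟨V, _, _, θ, v, hv, hθ⟩ := h t
  have e := LinearMap.congr_fun (congrArg θ hc) v
  rw [map_sum, LinearMap.sum_apply, map_zero, LinearMap.zero_apply] at e
  have e2 : ∀ μ, θ (c μ • k μ) v = (c μ * kChar μ t) • v := fun μ => by
    rw [map_smul, LinearMap.smul_apply, mul_smul]
    exact congrArg _ (kMon_apply_weight (f := (θ : A →* Module.End Qv V).comp k) hθ μ)
  rw [Finset.sum_congr rfl fun μ _ => e2 μ, ← Finset.sum_smul] at e
  rw [Finset.sum_apply]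
  exact (smul_eq_zero.mp e).resolve_right hv

variable {r : ℕ} {ε : ℤ} (hn : 2 ≤ n) (hr : r ≤ n - 1) (hε : ε = 1 ∨ ε = -1)

/-- The images of distinct monomials in the `K_i` are linearly independent. -/
theorem foldHom_kMon_linearIndependent :
    LinearIndependent Qv fun μ => foldHom hn hr hε (kMon n μ) := by
  refine linearIndependent_of_characters ((foldHom hn hr hε : U n →* U (n + 1)).comp (kMon n))
    fun t => ?_
  have hp : Function.Injective fun i : ZMod n => (pos r i.val : ZMod (n + 1)) := fun i j h =>
    ZMod.val_injective n ((pos_cast_inj (ZMod.val_lt i) (ZMod.val_lt j)).mp h)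
  have hp' : ¬ ∃ i : ZMod n, (pos r i.val : ZMod (n + 1)) = ((r + 1 : ℕ) : ZMod (n + 1)) := by
    rintro ⟨i, hi⟩
    have := ZMod.val_lt i
    have hb : pos r i.val < n + 1 := by unfold pos; split_ifs <;> omega
    rw [natCast_eq_iff hb (by omega)] at hi
    unfold pos at hi
    split_ifs at hi <;> omega
  obtain ⟨V, i1, i2, θ, v, hv, hθ⟩ := exists_weight_vector (m := n + 1) (by omega)
    (Function.extend (fun i : ZMod n => (pos r i.val : ZMod (n + 1))) t 1)
  refine ⟨V, i1, i2, θ, v, hv, fun i => ?_⟩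
  have hθi := hθ (pos r i.val : ZMod (n + 1))
  rw [hp.extend_apply] at hθi
  change θ (foldHom hn hr hε (kMon n (kGen i))) v = _
  rw [kMon_gen, foldHom, ulift_K]
  by_cases h : i.val = r
  · rw [h, pos, if_pos le_rfl] at hθi
    rw [kElt_fold h, map_mul, Module.End.mul_apply, hθ, Function.extend_apply' _ _ _ hp',
      Pi.one_apply, Units.val_one, one_smul, hθi]
  · rw [kElt_of_ne h, hθi]

end KMonomials

section Involution

variable {m : ℕ}

theorem URep.scale {A : Type} [Ring A] [Algebra Qv A] {E F K K' : ZMod m → A}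
    (h : URep m E F K K') {c : ZMod m → Qv} (hc : ∀ i, c i ≠ 0) :
    URep m (fun i => c i • E i) (fun i => (c i)⁻¹ • F i) K K' where
  KK := h.KK
  KK' := h.KK'
  K'K := h.K'K
  KE i j := by rw [mul_smul_comm, h.KE, smul_mul_assoc, smul_comm]
  KF i j := by rw [mul_smul_comm, h.KF, smul_mul_assoc, smul_comm]
  EF i j := by
    have h1 : c i • E i * (c j)⁻¹ • F j - (c j)⁻¹ • F j * c i • E i =
        (c i * (c j)⁻¹) • (E i * F j - F j * E i) := by
      rw [smul_mul_smul_comm, smul_mul_smul_comm, mul_comm (c j)⁻¹, smul_sub]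
    rw [h1, h.EF]
    split_ifs with hij
    · rw [hij, mul_inv_cancel₀ (hc j), one_smul]
    · rw [smul_zero]
  serreE i j hij := by rw [serreSum_smul, h.serreE i j hij, smul_zero]
  serreF i j hij := by rw [serreSum_smul, h.serreF i j hij, smul_zero]

/-- The Chevalley involution. -/
def chevalley (m : ℕ) : U m →ₐ[Qv] U m := ulift (U_urep m).swap

theorem chevalley_chevalley (x : U m) : chevalley m (chevalley m x) = x := by
  have : (chevalley m).comp (chevalley m) = AlgHom.id Qv (U m) := by
    apply U_hom_ext <;> intro i <;>
      simp only [AlgHom.comp_apply, chevalley, ulift_E, ulift_F, ulift_K, ulift_Kinv, AlgHom.id_apply]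
  exact DFunLike.congr_fun this x

variable {n r : ℕ} {ε : ℤ} (hn : 2 ≤ n) (hr : r ≤ n - 1) (hε : ε = 1 ∨ ε = -1)

/-- The scalars relating `Φ` and the Chevalley involutions. -/
def foldScalar (r : ℕ) (ε : ℤ) (i : ZMod n) : Qv := if i.val = r then -vv ^ ε else 1

theorem foldScalar_ne_zero (i : ZMod n) : foldScalar r ε i ≠ 0 := by
  unfold foldScalar
  split_ifs
  · exact neg_ne_zero.mpr (zpow_ne_zero _ vv_ne_zero)
  · exact one_ne_zero

theorem commutator_scale {k A : Type} [Field k] [Ring A] [Algebra k A] {q q' : k}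
    (h : q * q' = 1) (a b : A) : a * b - q • (b * a) = (-q) • (b * a - q' • (a * b)) := by
  rw [smul_sub, smul_smul, neg_mul, h, neg_smul, neg_smul, one_smul]
  abel

theorem chevalley_eElt (i : ZMod n) :
    chevalley (n + 1) (eElt n r ε i) = foldScalar r ε i • fElt n r ε i := by
  unfold foldScalar chevalley
  split_ifs with h
  · rw [eElt_fold h, fElt_fold h, map_sub, map_smul, map_mul, map_mul, ulift_E, ulift_E]
    exact commutator_scale (by rw [← zpow_add₀ vv_ne_zero, add_neg_cancel, zpow_zero]) _ _
  · rw [eElt_of_ne h, fElt_of_ne h, ulift_E, one_smul]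

/-- The scaled Chevalley involution intertwined by `Φ` with the Chevalley involution. -/
def chevalleyScaled (n r : ℕ) (ε : ℤ) : U n →ₐ[Qv] U n :=
  ulift ((U_urep n).swap.scale (foldScalar_ne_zero (r := r) (ε := ε)))

theorem foldHom_chevalleyScaled {x : U n}
    (hx : x ∈ Submodule.span Qv (Set.range (wordProd (UE (m := n))))) :
    foldHom hn hr hε (chevalleyScaled n r ε x) = chevalley (n + 1) (foldHom hn hr hε x) := by
  induction hx using Submodule.span_induction with
  | zero => simp only [map_zero]
  | add x y _ _ hx hy => simp only [map_add, hx, hy]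
  | smul c x _ hx => simp only [map_smul, hx]
  | mem x hx =>
    obtain ⟨w, rfl⟩ := hx
    simp only [map_wordProd]
    congr 1
    funext i
    rw [foldHom, ulift_E, chevalley_eElt, chevalleyScaled, ulift_E, map_smul, ulift_F]

theorem mem_map_chevalleyScaled (n r : ℕ) (ε : ℤ) :
    Submodule.span Qv (Set.range (wordProd (UF (m := n)))) ≤
      (Submodule.span Qv (Set.range (wordProd (UE (m := n))))).map
        (chevalleyScaled n r ε).toLinearMap := by
  refine Submodule.span_le.mpr ?_
  rintro _ ⟨w, rfl⟩
  have key : ∃ c : Qv, c ≠ 0 ∧ chevalleyScaled n r ε (wordProd UE w) = c • wordProd UF w := by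
    induction w with
    | nil => exact ⟨1, one_ne_zero, by rw [one_smul]; exact map_one _⟩
    | cons i w ih =>
      obtain ⟨c, hc, h⟩ := ih
      refine ⟨foldScalar r ε i * c, mul_ne_zero (foldScalar_ne_zero i) hc, ?_⟩
      change chevalleyScaled n r ε (UE i * wordProd UE w) = _ • (UF i * wordProd UF w)
      rw [map_mul, h, chevalleyScaled, ulift_E, smul_mul_smul_comm]
  obtain ⟨c, hc, h⟩ := key
  refine ⟨c⁻¹ • wordProd UE w, Submodule.smul_mem _ _ (Submodule.subset_span ⟨w, rfl⟩), ?_⟩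
  rw [AlgHom.toLinearMap_apply, map_smul, h, smul_smul, inv_mul_cancel₀ hc, one_smul]

/-- `Φ` is injective on the negative part. -/
theorem foldHom_eq_zero_neg {y : U n}
    (hy : y ∈ Submodule.span Qv (Set.range (wordProd (UF (m := n)))))
    (h : foldHom hn hr hε y = 0) : y = 0 := by
  obtain ⟨x, hx, rfl⟩ := mem_map_chevalleyScaled n r ε hy
  rw [AlgHom.toLinearMap_apply] at h ⊢
  rw [foldHom_chevalleyScaled hn hr hε hx] at h
  have h0 := chevalley_chevalley (foldHom hn hr hε x)
  rw [h, map_zero] at h0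
  rw [foldHom_eq_zero hn hr hε x hx h0.symm, map_zero]

end Involution

section Spanning

variable {n : ℕ} [NeZero n]

theorem U_induction {m : ℕ} (S : Subalgebra Qv (U m)) (hE : ∀ i, UE i ∈ S) (hF : ∀ i, UF i ∈ S)
    (hK : ∀ i, UK i ∈ S) (hK' : ∀ i, UKinv i ∈ S) (x : U m) : x ∈ S := by
  obtain ⟨y, rfl⟩ := RingQuot.mkAlgHom_surjective Qv (URel m) x
  induction y using FreeAlgebra.induction with
  | grade0 c => rw [AlgHom.commutes]; exact S.algebraMap_mem c
  | grade1 g =>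
    cases g with
    | E i => exact hE i
    | F i => exact hF i
    | K i => exact hK i
    | Kinv i => exact hK' i
  | mul a b ha hb => rw [map_mul]; exact S.mul_mem ha hb
  | add a b ha hb => rw [map_add]; exact S.add_mem ha hb

/-- The triangular monomials. -/
def triMon (p : List (ZMod n) × KLattice n × List (ZMod n)) : U n :=
  wordProd UF p.1 * kMon n p.2.1 * wordProd UE p.2.2

theorem kMon_mul_E (μ : KLattice n) (i : ZMod n) :
    ∃ c : Qv, c ≠ 0 ∧ UE i * kMon n μ = c • (kMon n μ * UE i) := by
  refine KLattice_induction (P := fun μ => ∃ c : Qv, c ≠ 0 ∧ UE i * kMon n μ =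
    c • (kMon n μ * UE i)) ⟨1, one_ne_zero, by rw [map_one, one_mul, mul_one, one_smul]⟩
    ?_ ?_ (fun j => ?_) μ
  · rintro a b ⟨c, hc, ha⟩ ⟨d, hd, hb⟩
    refine ⟨c * d, mul_ne_zero hc hd, ?_⟩
    rw [map_mul, ← mul_assoc, ha, smul_mul_assoc, mul_assoc, hb, mul_smul_comm, smul_smul,
      mul_assoc]
  · rintro a ⟨c, hc, ha⟩
    refine ⟨c⁻¹, inv_ne_zero hc, ?_⟩
    have h1 := kMon_inv_mul a
    have h2 : kMon n a * kMon n a⁻¹ = 1 := by rw [← map_mul, mul_inv_cancel, map_one]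
    calc UE i * kMon n a⁻¹ = c⁻¹ • (kMon n a⁻¹ * (c • (kMon n a * UE i)) * kMon n a⁻¹) := by
          rw [mul_smul_comm, smul_mul_assoc, smul_smul, inv_mul_cancel₀ hc, one_smul, ← mul_assoc,
            h1, one_mul]
      _ = _ := by rw [← ha, mul_assoc, mul_assoc, h2, mul_one]
  · refine ⟨vv ^ (-cartan j i), zpow_ne_zero _ vv_ne_zero, ?_⟩
    rw [kMon_gen, (U_urep n).KE, smul_smul, ← zpow_add₀ vv_ne_zero, neg_add_cancel, zpow_zero,
      one_smul]

variable (n) in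
/-- The span of the triangular monomials. -/
def triSpan : Submodule Qv (U n) := Submodule.span Qv (Set.range triMon)

theorem triMon_mem (w : List (ZMod n)) (μ : KLattice n) (w' : List (ZMod n)) :
    wordProd UF w * (kMon n μ * wordProd UE w') ∈ triSpan n :=
  Submodule.subset_span ⟨(w, μ, w'), mul_assoc _ _ _⟩

theorem mul_mem_triSpan {g : U n}
    (h : ∀ w μ w', g * (wordProd UF w * (kMon n μ * wordProd UE w')) ∈ triSpan n) {x : U n}
    (hx : x ∈ triSpan n) : g * x ∈ triSpan n := by
  induction hx using Submodule.span_induction with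
  | zero => rw [mul_zero]; exact Submodule.zero_mem _
  | add x y _ _ hx hy => rw [mul_add]; exact Submodule.add_mem _ hx hy
  | smul c x _ hx => rw [mul_smul_comm]; exact Submodule.smul_mem _ _ hx
  | mem x hx =>
    obtain ⟨⟨w, μ, w'⟩, rfl⟩ := hx
    rw [triMon, mul_assoc (wordProd UF w)]
    exact h w μ w'

theorem UF_mul_mem (i : ZMod n) {x : U n} (hx : x ∈ triSpan n) : UF i * x ∈ triSpan n :=
  mul_mem_triSpan (fun w μ w' => mul_assoc (UF i) _ _ ▸ triMon_mem (i :: w) μ w') hx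

theorem kMon_mul_mem (ν : KLattice n) {c : ZMod n → Qv}
    (h : ∀ i, kMon n ν * UF i = c i • (UF i * kMon n ν)) {x : U n} (hx : x ∈ triSpan n) :
    kMon n ν * x ∈ triSpan n := by
  refine mul_mem_triSpan (fun w μ w' => ?_) hx
  induction w with
  | nil =>
    have := triMon_mem [] (ν * μ) w'
    rw [show wordProd (UF (m := n)) [] = 1 from rfl, one_mul] at this ⊢
    rwa [map_mul, mul_assoc] at this
  | cons i w ih =>
    change kMon n ν * (UF i * wordProd UF w * _) ∈ _
    rw [mul_assoc (UF i), ← mul_assoc, h, smul_mul_assoc, mul_assoc]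
    exact Submodule.smul_mem _ _ (UF_mul_mem i ih)

theorem UK_mul_mem (i : ZMod n) {x : U n} (hx : x ∈ triSpan n) : UK i * x ∈ triSpan n := by
  have := kMon_mul_mem (kGen i) (c := fun j => vv ^ (-cartan i j))
    (fun j => by rw [kMon_gen]; exact (U_urep n).KF i j) hx
  rwa [kMon_gen] at this

theorem UKinv_mul_mem (i : ZMod n) {x : U n} (hx : x ∈ triSpan n) : UKinv i * x ∈ triSpan n := by
  have := kMon_mul_mem (kGen i)⁻¹ (c := fun j => vv ^ (cartan i j))
    (fun j => by rw [kMon_gen_inv]; exact (U_urep n).qK'F i j) hx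
  rwa [kMon_gen_inv] at this

theorem UE_mul_mem (i : ZMod n) {x : U n} (hx : x ∈ triSpan n) : UE i * x ∈ triSpan n := by
  refine mul_mem_triSpan (fun w μ w' => ?_) hx
  induction w with
  | nil =>
    obtain ⟨c, -, hc⟩ := kMon_mul_E μ i
    rw [show wordProd (UF (m := n)) [] = 1 from rfl, one_mul, ← mul_assoc, hc, smul_mul_assoc,
      mul_assoc]
    have := triMon_mem [] μ (i :: w')
    rw [show wordProd (UF (m := n)) [] = 1 from rfl, one_mul] at this
    exact Submodule.smul_mem _ _ this
  | cons j w ih =>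
    change UE i * (UF j * wordProd UF w * _) ∈ _
    have h := (U_urep n).EF i j
    rw [sub_eq_iff_eq_add] at h
    rw [mul_assoc (UF j), ← mul_assoc, h, add_mul, mul_assoc (UF j)]
    refine Submodule.add_mem _ ?_ (UF_mul_mem j ih)
    split_ifs
    · rw [smul_mul_assoc, sub_mul]
      exact Submodule.smul_mem _ _ (Submodule.sub_mem _ (UK_mul_mem i (triMon_mem w μ w'))
        (UKinv_mul_mem i (triMon_mem w μ w')))
    · rw [zero_mul]
      exact Submodule.zero_mem _

/-- The triangular monomials span. -/
theorem mem_triSpan (x : U n) : x ∈ triSpan n := by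
  let S : Subalgebra Qv (U n) :=
    { carrier := {g | ∀ y ∈ triSpan n, g * y ∈ triSpan n}
      mul_mem' := fun ha hb y hy => (mul_assoc _ _ y).symm ▸ ha _ (hb y hy)
      add_mem' := fun ha hb y hy => (add_mul _ _ y).symm ▸ Submodule.add_mem _ (ha y hy) (hb y hy)
      algebraMap_mem' := fun c y hy => by
        rw [Algebra.algebraMap_eq_smul_one, smul_mul_assoc, one_mul]
        exact Submodule.smul_mem _ _ hy }
  have h1 : (1 : U n) ∈ triSpan n := by
    have := triMon_mem (n := n) [] 1 []
    rwa [map_one, show wordProd (UF (m := n)) [] = 1 from rfl,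
      show wordProd (UE (m := n)) [] = 1 from rfl, one_mul, one_mul] at this
  have := U_induction S (fun i y hy => UE_mul_mem i hy) (fun i y hy => UF_mul_mem i hy)
    (fun i y hy => UK_mul_mem i hy) (fun i y hy => UKinv_mul_mem i hy) x 1 h1
  rwa [mul_one] at this

end Spanning

section LeadingTerm

open LaurentPolynomial

/-- `b` is a Laurent polynomial of order at least `-d` with coefficient `c` at `T (-d)`. -/
def HasLead {R : Type} [Ring R] (b : LaurentPolynomial R) (d : ℕ) (c : R) : Prop :=
  ∃ q : Polynomial R, T (d : ℤ) * b = Polynomial.toLaurent q ∧ q.coeff 0 = c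

variable {R : Type} [Ring R] {b b' : LaurentPolynomial R} {d d' : ℕ} {c c' : R}

theorem HasLead.const (c : R) : HasLead (C c) 0 c :=
  ⟨Polynomial.C c, by rw [Nat.cast_zero, T_zero, one_mul, Polynomial.toLaurent_C],
    Polynomial.coeff_C_zero⟩

theorem HasLead.mul (h : HasLead b d c) (h' : HasLead b' d' c') :
    HasLead (b * b') (d + d') (c * c') := by
  obtain ⟨q, hq, rfl⟩ := h
  obtain ⟨q', hq', rfl⟩ := h'
  refine ⟨q * q', ?_, Polynomial.mul_coeff_zero _ _⟩
  rw [map_mul, ← hq, ← hq', Nat.cast_add, T_add, mul_assoc, mul_assoc, ← mul_assoc b,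
    ← (commute_T (d' : ℤ) b).eq, mul_assoc]

theorem HasLead.sub (h : HasLead b d c) (h' : HasLead b' d c') : HasLead (b - b') d (c - c') := by
  obtain ⟨q, hq, rfl⟩ := h
  obtain ⟨q', hq', rfl⟩ := h'
  exact ⟨q - q', by rw [map_sub, ← hq, ← hq']; exact mul_sub _ _ _, Polynomial.coeff_sub _ _ _⟩

theorem HasLead.smul [Algebra Qv R] (x : Qv) (h : HasLead b d c) : HasLead (x • b) d (x • c) := by
  have := (HasLead.const (algebraMap Qv R x)).mul h
  rwa [zero_add, ← Algebra.smul_def, ← LaurentPolynomial.algebraMap_apply, ← Algebra.smul_def] at this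

theorem HasLead.of_lt (h : HasLead b d c) (hd : d < d') : HasLead b d' 0 := by
  obtain ⟨q, hq, -⟩ := h
  obtain ⟨k, rfl⟩ := Nat.exists_eq_add_of_lt hd
  refine ⟨Polynomial.X ^ (k + 1) * q, ?_, ?_⟩
  · rw [map_mul, ← hq, Polynomial.toLaurent_X_pow, ← mul_assoc, ← T_add]
    congr 2
    push_cast
    ring
  · rw [pow_succ', mul_assoc, Polynomial.mul_coeff_zero, Polynomial.coeff_X_zero, zero_mul]

theorem HasLead.sum {ι : Type} (s : Finset ι) {b : ι → LaurentPolynomial R} {c : ι → R}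
    (h : ∀ i ∈ s, HasLead (b i) d (c i)) : HasLead (∑ i ∈ s, b i) d (∑ i ∈ s, c i) := by
  choose! q hq hc using h
  refine ⟨∑ i ∈ s, q i, ?_, ?_⟩
  · rw [Finset.mul_sum, map_sum]
    exact Finset.sum_congr rfl hq
  · rw [Polynomial.finsetSum_coeff]
    exact Finset.sum_congr rfl hc

theorem HasLead.eq_zero (h : HasLead (0 : LaurentPolynomial R) d c) : c = 0 := by
  obtain ⟨q, hq, rfl⟩ := h
  rw [mul_zero, eq_comm, Polynomial.toLaurent_eq_zero] at hq
  rw [hq, Polynomial.coeff_zero]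

theorem HasLead.first (x y z : R) :
    HasLead (T (-1) * C x + C y + T 1 * C z) 1 x := by
  refine ⟨Polynomial.C x + Polynomial.X * Polynomial.C y + Polynomial.X ^ 2 * Polynomial.C z, ?_, ?_⟩
  · rw [map_add, map_add, map_mul, map_mul, Polynomial.toLaurent_X_pow, Polynomial.toLaurent_X,
      Polynomial.toLaurent_C, Polynomial.toLaurent_C, Polynomial.toLaurent_C, mul_add, mul_add,
      ← mul_assoc, ← mul_assoc, ← T_add, ← T_add]
    norm_num
  · simp [pow_two, mul_assoc]

end LeadingTerm

section TripleCoproduct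

open LaurentPolynomial

variable {m : ℕ} {A R : Type} [Ring A] [Algebra Qv A] [Ring R] [Algebra Qv R]
  {E F K K' : ZMod m → A}

/-- Degree-twisted image of a family under `j`. -/
def twistFam (X : ZMod m → A) (j : A →ₐ[Qv] R) (d : ℤ) (i : ZMod m) : LaurentPolynomial R :=
  T d * C (j (X i))

theorem twistFam_commute {j j' : A →ₐ[Qv] R} (h : ∀ a b, Commute (j a) (j' b)) (X Y : ZMod m → A)
    (d d' : ℤ) (i i' : ZMod m) : Commute (twistFam X j d i) (twistFam Y j' d' i') := by
  have h1 : Commute (C (j (X i)) : LaurentPolynomial R) (C (j' (Y i'))) := (h _ _).map C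
  have h2 : ∀ (e : ℤ) (f : LaurentPolynomial R), Commute f (T e) := fun e f => (commute_T e f).symm
  exact Commute.mul_left ((h2 _ _).mul_right (commute_T _ _)) ((h2 _ _).mul_right h1)

theorem URep.map_twist (h : URep m E F K K') (j : A →ₐ[Qv] R) (d : ℤ) :
    URep m (twistFam E j d) (twistFam F j (-d)) (twistFam K j 0) (twistFam K' j 0) := by
  have := (h.map j).twist_laurent fun _ => d
  unfold twistFam
  simpa only [T_zero, one_mul] using this

theorem genMap_twistFam_commute {j j' : A →ₐ[Qv] R} (h : ∀ a b, Commute (j a) (j' b)) (d d' : ℤ)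
    (s t : Gen m) :
    Commute (genMap (twistFam E j d) (twistFam F j (-d)) (twistFam K j 0) (twistFam K' j 0) s)
      (genMap (twistFam E j' d') (twistFam F j' (-d')) (twistFam K j' 0) (twistFam K' j' 0) t) := by
  cases s <;> cases t <;> exact twistFam_commute h _ _ _ _ _ _

theorem URep.triple (hm : 3 ≤ m) (h : URep m E F K K') {j₁ j₂ j₃ : A →ₐ[Qv] R}
    (h12 : ∀ a b, Commute (j₁ a) (j₂ b)) (h13 : ∀ a b, Commute (j₁ a) (j₃ b))
    (h23 : ∀ a b, Commute (j₂ a) (j₃ b)) :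
    URep m
      (fun i => T (-1) * C (j₁ (E i)) + C (j₁ (K i) * j₂ (E i)) +
        T 1 * C (j₁ (K i) * j₂ (K i) * j₃ (E i)))
      (fun i => T (-1) * C (j₃ (F i)) + C (j₃ (K' i) * j₂ (F i)) +
        T 1 * C (j₃ (K' i) * j₂ (K' i) * j₁ (F i)))
      (fun i => C (j₁ (K i) * j₂ (K i) * j₃ (K i)))
      (fun i => C (j₁ (K' i) * j₂ (K' i) * j₃ (K' i))) := by
  have c13 := genMap_twistFam_commute (E := E) (F := F) (K := K) (K' := K') h13 (-1) 1
  have c23 := genMap_twistFam_commute (E := E) (F := F) (K := K) (K' := K') h23 0 1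
  have r12 := (h.map_twist j₁ (-1)).coprod hm (h.map_twist j₂ 0)
    (genMap_twistFam_commute h12 _ _)
  have r := r12.coprod hm (h.map_twist j₃ 1) fun s t => by
    cases s with
    | E i =>
      exact Commute.add_left (c13 (Gen.E i) t) (Commute.mul_left (c13 (Gen.K i) t) (c23 (Gen.E i) t))
    | F i =>
      exact Commute.add_left (c23 (Gen.F i) t)
        (Commute.mul_left (c23 (Gen.Kinv i) t) (c13 (Gen.F i) t))
    | K i => exact Commute.mul_left (c13 (Gen.K i) t) (c23 (Gen.K i) t)
    | Kinv i => exact Commute.mul_left (c13 (Gen.Kinv i) t) (c23 (Gen.Kinv i) t)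
  have hT : ∀ (x : R) (y : LaurentPolynomial R), C x * (T 1 * y) = T 1 * (C x * y) := fun x y => by
    rw [← mul_assoc, ← (commute_T 1 (C x)).eq, mul_assoc]
  simp only [twistFam, T_zero, one_mul, neg_neg, neg_zero, mul_add] at r
  simpa only [map_mul, mul_assoc, hT, add_assoc] using r

end TripleCoproduct

section Triangular

open LaurentPolynomial TensorProduct

variable {m : ℕ} {R : Type} [Ring R] [Algebra Qv R] {j₁ j₂ j₃ : U m →ₐ[Qv] R}

/-- The twisted iterated coproduct attached to three commuting homomorphisms. -/
def tripleHom (hm : 3 ≤ m) (h12 : ∀ a b, Commute (j₁ a) (j₂ b))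
    (h13 : ∀ a b, Commute (j₁ a) (j₃ b)) (h23 : ∀ a b, Commute (j₂ a) (j₃ b)) :
    U m →ₐ[Qv] LaurentPolynomial R :=
  ulift ((U_urep m).triple hm h12 h13 h23)

variable (hm : 3 ≤ m) (h12 : ∀ a b, Commute (j₁ a) (j₂ b))
  (h13 : ∀ a b, Commute (j₁ a) (j₃ b)) (h23 : ∀ a b, Commute (j₂ a) (j₃ b))

theorem tripleHom_E (i : ZMod m) :
    HasLead (tripleHom hm h12 h13 h23 (UE i)) 1 (j₁ (UE i)) := by
  rw [tripleHom, ulift_E]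
  exact HasLead.first _ _ _

theorem tripleHom_F (i : ZMod m) :
    HasLead (tripleHom hm h12 h13 h23 (UF i)) 1 (j₃ (UF i)) := by
  rw [tripleHom, ulift_F]
  exact HasLead.first _ _ _

theorem tripleHom_K (i : ZMod m) :
    tripleHom hm h12 h13 h23 (UK i) = C (j₁ (UK i) * j₂ (UK i) * j₃ (UK i)) := by
  rw [tripleHom, ulift_K]

/-- The product of three commuting homomorphisms. -/
def tripleMonoidHom (h12 : ∀ a b, Commute (j₁ a) (j₂ b)) (h13 : ∀ a b, Commute (j₁ a) (j₃ b))
    (h23 : ∀ a b, Commute (j₂ a) (j₃ b)) : U m →* R where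
  toFun k := j₁ k * j₂ k * j₃ k
  map_one' := by rw [map_one, map_one, map_one, one_mul, one_mul]
  map_mul' a b := by
    rw [map_mul, map_mul, map_mul, ((h12 b a).mul_mul_mul_comm _ _),
      (((h13 b a).mul_left (h23 b a)).mul_mul_mul_comm _ _)]

theorem map_qcomm {A B : Type} [Ring A] [Algebra Qv A] [Ring B] [Algebra Qv B] (f : A →ₐ[Qv] B)
    (x y : A) (c : Qv) : f (x * y - c • (y * x)) = f x * f y - c • (f y * f x) := by
  rw [map_sub, map_smul, map_mul, map_mul]

theorem HasLead.qcomm {A R : Type} [Ring A] [Algebra Qv A] [Ring R] [Algebra Qv R]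
    (f : A →ₐ[Qv] LaurentPolynomial R) (g : A →ₐ[Qv] R) {x y : A} (hx : HasLead (f x) 1 (g x))
    (hy : HasLead (f y) 1 (g y)) (c : Qv) :
    HasLead (f (x * y - c • (y * x))) 2 (g (x * y - c • (y * x))) := by
  rw [map_qcomm (B := LaurentPolynomial R), map_qcomm]
  exact (hx.mul hy).sub ((hy.mul hx).smul c)

theorem HasLead.sum_smul_eq_zero {A R ι : Type} [Ring A] [Algebra Qv A] [Ring R] [Algebra Qv R]
    (τ : A →ₐ[Qv] LaurentPolynomial R) {d : ℕ} (s : Finset ι) {x : ι → A} {e : ι → ℕ} {g : ι → R}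
    (hs : ∀ i ∈ s, e i ≤ d) (hx : ∀ i ∈ s, HasLead (τ (x i)) (e i) (g i)) (c : ι → Qv)
    (h : ∑ i ∈ s, c i • x i = 0) : ∑ i ∈ s with e i = d, c i • g i = 0 := by
  have h1 : ∀ i ∈ s, HasLead (τ (c i • x i)) d (if e i = d then c i • g i else 0) := fun i hi => by
    have h2 := (hx i hi).smul (c i)
    rw [map_smul]
    split_ifs with hd
    · rwa [hd] at h2
    · exact h2.of_lt (lt_of_le_of_ne (hs i hi) hd)
  have h2 := HasLead.sum s h1
  rw [← map_sum τ, h, map_zero τ] at h2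
  rw [Finset.sum_filter]
  exact h2.eq_zero

section Fold

variable {n r : ℕ} {ε : ℤ} (hn : 2 ≤ n) (hr : r ≤ n - 1) (hε : ε = 1 ∨ ε = -1)
  {R : Type} [Ring R] [Algebra Qv R] {j₁ j₂ j₃ : U (n + 1) →ₐ[Qv] R}
  (hm : 3 ≤ n + 1) (h12 : ∀ a b, Commute (j₁ a) (j₂ b))
  (h13 : ∀ a b, Commute (j₁ a) (j₃ b)) (h23 : ∀ a b, Commute (j₂ a) (j₃ b))

/-- Degree of the image of a letter. -/
def foldDegree (r : ℕ) (i : ZMod n) : ℕ := if i.val = r then 2 else 1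

theorem tripleHom_foldHom_E (i : ZMod n) :
    HasLead (tripleHom hm h12 h13 h23 (foldHom hn hr hε (UE i))) (foldDegree r i)
      (j₁ (foldHom hn hr hε (UE i))) := by
  rw [foldHom, ulift_E, foldDegree]
  split_ifs with h
  · rw [eElt_fold h]
    exact HasLead.qcomm _ _ (tripleHom_E hm h12 h13 h23 _) (tripleHom_E hm h12 h13 h23 _) _
  · rw [eElt_of_ne h]
    exact tripleHom_E hm h12 h13 h23 _

theorem tripleHom_foldHom_F (i : ZMod n) :
    HasLead (tripleHom hm h12 h13 h23 (foldHom hn hr hε (UF i))) (foldDegree r i)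
      (j₃ (foldHom hn hr hε (UF i))) := by
  rw [foldHom, ulift_F, foldDegree]
  split_ifs with h
  · rw [fElt_fold h]
    exact HasLead.qcomm _ _ (tripleHom_F hm h12 h13 h23 _) (tripleHom_F hm h12 h13 h23 _) _
  · rw [fElt_of_ne h]
    exact tripleHom_F hm h12 h13 h23 _

/-- Degree of the image of a word. -/
def wordDegree (r : ℕ) (w : List (ZMod n)) : ℕ := (w.map (foldDegree r)).sum

theorem HasLead.wordProd {R A : Type} [Ring R] [Ring A] (f : A →+* LaurentPolynomial R)
    {X : ZMod n → A} (g : A →* R) (h : ∀ i, HasLead (f (X i)) (foldDegree r i) (g (X i)))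
    (w : List (ZMod n)) : HasLead (f (wordProd X w)) (wordDegree r w) (g (_root_.wordProd X w)) := by
  induction w with
  | nil =>
    have := HasLead.const (1 : R)
    rw [show _root_.wordProd X [] = 1 from rfl, map_one, map_one]
    rwa [map_one] at this
  | cons i w ih =>
    rw [show _root_.wordProd X (i :: w) = X i * _root_.wordProd X w from rfl, map_mul, map_mul]
    exact (h i).mul ih

variable [NeZero n]

theorem tripleHom_foldHom_kMon (μ : KLattice n) :
    tripleHom hm h12 h13 h23 (foldHom hn hr hε (kMon n μ)) =
      C (tripleMonoidHom h12 h13 h23 (foldHom hn hr hε (kMon n μ))) := by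
  have hK := tripleHom_K hm h12 h13 h23
  have key : ((tripleHom hm h12 h13 h23 : U (n + 1) →* LaurentPolynomial R).comp
      (foldHom hn hr hε : U n →* U (n + 1))).comp (kMon n) =
      (((C : R →+* LaurentPolynomial R) : R →* LaurentPolynomial R).comp
        (tripleMonoidHom h12 h13 h23)).comp
        ((foldHom hn hr hε : U n →* U (n + 1)).comp (kMon n)) := by
    refine KLattice_hom_ext fun i => ?_
    change tripleHom hm h12 h13 h23 (foldHom hn hr hε (kMon n (kGen i))) =
      C (tripleMonoidHom h12 h13 h23 (foldHom hn hr hε (kMon n (kGen i))))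
    rw [kMon_gen, foldHom, ulift_K]
    by_cases h : i.val = r
    · rw [kElt_fold h, map_mul, map_mul (tripleMonoidHom h12 h13 h23), hK, hK]
      exact (map_mul C _ _).symm
    · rw [kElt_of_ne h, hK]
      rfl
  exact DFunLike.congr_fun key μ

/-- Degree of a triangular monomial. -/
def triDegree (r : ℕ) (p : List (ZMod n) × KLattice n × List (ZMod n)) : ℕ :=
  wordDegree r p.1 + wordDegree r p.2.2

theorem tripleHom_foldHom_triMon (p : List (ZMod n) × KLattice n × List (ZMod n)) :
    HasLead (tripleHom hm h12 h13 h23 (foldHom hn hr hε (triMon p))) (triDegree r p)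
      (j₃ (foldHom hn hr hε (wordProd UF p.1)) *
        tripleMonoidHom h12 h13 h23 (foldHom hn hr hε (kMon n p.2.1)) *
        j₁ (foldHom hn hr hε (wordProd UE p.2.2))) := by
  have hE := HasLead.wordProd (((tripleHom hm h12 h13 h23).comp (foldHom hn hr hε)).toRingHom)
    ((j₁.comp (foldHom hn hr hε) : U n →ₐ[Qv] R) : U n →* R)
    (tripleHom_foldHom_E hn hr hε hm h12 h13 h23) p.2.2
  have hF := HasLead.wordProd (((tripleHom hm h12 h13 h23).comp (foldHom hn hr hε)).toRingHom)
    ((j₃.comp (foldHom hn hr hε) : U n →ₐ[Qv] R) : U n →* R)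
    (tripleHom_foldHom_F hn hr hε hm h12 h13 h23) p.1
  have hK := HasLead.const (tripleMonoidHom h12 h13 h23 (foldHom hn hr hε (kMon n p.2.1)))
  rw [← tripleHom_foldHom_kMon hn hr hε hm] at hK
  have := (hF.mul hK).mul hE
  rw [add_zero] at this
  rw [triMon, map_mul, map_mul, map_mul, map_mul]
  exact this

theorem sum_lead_eq_zero {d : ℕ} (s : Finset (List (ZMod n) × KLattice n × List (ZMod n)))
    (hs : ∀ p ∈ s, triDegree r p ≤ d) (c : List (ZMod n) × KLattice n × List (ZMod n) → Qv)
    (h : foldHom hn hr hε (∑ p ∈ s, c p • triMon p) = 0) :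
    ∑ p ∈ s with triDegree r p = d, c p • (j₃ (foldHom hn hr hε (wordProd UF p.1)) *
      tripleMonoidHom h12 h13 h23 (foldHom hn hr hε (kMon n p.2.1)) *
      j₁ (foldHom hn hr hε (wordProd UE p.2.2))) = 0 := by
  rw [map_sum] at h
  refine HasLead.sum_smul_eq_zero (tripleHom (by omega) h12 h13 h23) s
    (x := fun p => foldHom hn hr hε (triMon p)) (e := triDegree r) hs
    (fun p _ => tripleHom_foldHom_triMon hn hr hε (by omega) h12 h13 h23 p) c ?_
  rw [← h]
  exact Finset.sum_congr rfl fun p _ => (map_smul _ _ _).symm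

end Fold

/-- A threefold tensor power with its three embeddings, and contraction of the middle factor. -/
theorem exists_triple_tensor (A : Type) [Ring A] [Algebra Qv A] :
    ∃ (R : Type) (_ : Ring R) (_ : Algebra Qv R) (j₁ j₂ j₃ : A →ₐ[Qv] R),
      (∀ a b, Commute (j₁ a) (j₂ b)) ∧ (∀ a b, Commute (j₁ a) (j₃ b)) ∧
      (∀ a b, Commute (j₂ a) (j₃ b)) ∧
      ∀ (f : A →ₗ[Qv] Qv) (α β : A), ∃ L : R →ₗ[Qv] A ⊗[Qv] A, ∀ a b k,
        L (j₃ b * (j₁ k * j₂ k * j₃ k) * j₁ a) = f k • ((α * (k * a)) ⊗ₜ[Qv] (b * k * β)) := by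
  refine ⟨A ⊗[Qv] (A ⊗[Qv] A), inferInstance, inferInstance,
    Algebra.TensorProduct.includeLeft,
    Algebra.TensorProduct.includeRight.comp Algebra.TensorProduct.includeLeft,
    Algebra.TensorProduct.includeRight.comp Algebra.TensorProduct.includeRight,
    fun a b => by simp [Commute, SemiconjBy], fun a b => by simp [Commute, SemiconjBy],
    fun a b => by simp [Commute, SemiconjBy], fun f α β =>
    ⟨TensorProduct.map (LinearMap.mulLeft Qv α) ((TensorProduct.lid Qv A).toLinearMap.comp
      (TensorProduct.map f (LinearMap.mulRight Qv β))), fun a b k => ?_⟩⟩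
  simp

/-- A relation between images of tensors of two subspaces on which `Φ` is injective gives a
relation between products. -/
theorem sum_mul_mul_eq_zero {k A B ι : Type} [Field k] [Ring A] [Algebra k A] [Ring B] [Algebra k B]
    (Φ : A →ₐ[k] B) {SE SF : Submodule k A} (hE : ∀ x ∈ SE, Φ x = 0 → x = 0)
    (hF : ∀ x ∈ SF, Φ x = 0 → x = 0) (s : Finset ι) (c : ι → k) (x : ι → A) (y : ι → A)
    (hx : ∀ i, x i ∈ SE) (hy : ∀ i, y i ∈ SF) (z : A)
    (h : ∑ i ∈ s, c i • (Φ (x i) ⊗ₜ[k] Φ (y i)) = 0) : ∑ i ∈ s, c i • (y i * z * x i) = 0 := by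
  have iE : Function.Injective (Φ.toLinearMap.comp SE.subtype) := by
    rw [injective_iff_map_eq_zero]
    exact fun x hx => Subtype.ext (hE x.1 x.2 hx)
  have iF : Function.Injective (Φ.toLinearMap.comp SF.subtype) := by
    rw [injective_iff_map_eq_zero]
    exact fun x hx => Subtype.ext (hF x.1 x.2 hx)
  have h5 : ∑ i ∈ s, c i • ((⟨x i, hx i⟩ : SE) ⊗ₜ[k] (⟨y i, hy i⟩ : SF)) = 0 := by
    refine TensorProduct.map_injective_of_flat_flat _ _ iE iF ?_
    rw [map_sum, map_zero, ← h]
    exact Finset.sum_congr rfl fun i _ => map_smul _ _ _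
  let M : SE ⊗[k] SF →ₗ[k] A := TensorProduct.lift
    (((LinearMap.mul k A).flip.comp SE.subtype).compl₂
      ((LinearMap.mulRight k z).comp SF.subtype))
  have h6 := congrArg M h5
  rw [map_sum, map_zero] at h6
  rw [← h6]
  exact Finset.sum_congr rfl fun i _ => by
    rw [map_smul]
    rfl

variable {n r : ℕ} {ε : ℤ} (hn : 2 ≤ n) (hr : r ≤ n - 1) (hε : ε = 1 ∨ ε = -1) [NeZero n]

theorem exists_dual_kMon (ν : KLattice n) : ∃ f : U (n + 1) →ₗ[Qv] Qv,
    f (foldHom hn hr hε (kMon n ν)) = 1 ∧ ∀ μ, μ ≠ ν → f (foldHom hn hr hε (kMon n μ)) = 0 := by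
  have hli := foldHom_kMon_linearIndependent hn hr hε
  obtain ⟨f, hf⟩ := ((Finsupp.lapply (R := Qv) (M := Qv) ν).comp hli.repr).exists_extend
  have key : ∀ μ, f (foldHom hn hr hε (kMon n μ)) = Finsupp.single μ (1 : Qv) ν := fun μ => by
    have := LinearMap.congr_fun hf
      ⟨foldHom hn hr hε (kMon n μ), Submodule.subset_span ⟨μ, rfl⟩⟩
    refine Eq.trans this ?_
    exact DFunLike.congr_fun (hli.repr_eq_single μ _ rfl) ν
  exact ⟨f, by rw [key, Finsupp.single_eq_same], fun μ h => by
    rw [key, Finsupp.single_apply, if_neg h]⟩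

theorem sum_triMon_eq_zero_of_top {d : ℕ}
    (s : Finset (List (ZMod n) × KLattice n × List (ZMod n)))
    (hs : ∀ p ∈ s, triDegree r p ≤ d) (c : List (ZMod n) × KLattice n × List (ZMod n) → Qv)
    (h : foldHom hn hr hε (∑ p ∈ s, c p • triMon p) = 0) :
    ∑ p ∈ s with triDegree r p = d, c p • triMon p = 0 := by
  classical
  obtain ⟨R, _, _, j₁, j₂, j₃, h12, h13, h23, hR⟩ := exists_triple_tensor (U (n + 1))
  have hlead := sum_lead_eq_zero hn hr hε h12 h13 h23 s hs c h
  rw [← Finset.sum_fiberwise_of_maps_to (g := fun p => p.2.1) (t := s.image fun p => p.2.1)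
    (fun p hp => Finset.mem_image_of_mem _ (Finset.mem_filter.mp hp).1)]
  refine Finset.sum_eq_zero fun ν _ => ?_
  obtain ⟨f, hf, hf'⟩ := exists_dual_kMon hn hr hε ν
  obtain ⟨L, hL⟩ := hR f (foldHom hn hr hε (kMon n ν⁻¹)) (foldHom hn hr hε (kMon n ν⁻¹))
  have h1 : foldHom hn hr hε (kMon n ν⁻¹) * foldHom hn hr hε (kMon n ν) = 1 := by
    rw [← map_mul, kMon_inv_mul, map_one]
  have h2 : foldHom hn hr hε (kMon n ν) * foldHom hn hr hε (kMon n ν⁻¹) = 1 := by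
    rw [← map_mul, ← map_mul, mul_inv_cancel, map_one, map_one]
  have h3 := congrArg L hlead
  rw [map_sum, map_zero] at h3
  have h4 := sum_mul_mul_eq_zero (foldHom hn hr hε)
    (SE := Submodule.span Qv (Set.range (wordProd (UE (m := n)))))
    (SF := Submodule.span Qv (Set.range (wordProd (UF (m := n)))))
    (fun x hx => foldHom_eq_zero hn hr hε x hx) (fun y hy => foldHom_eq_zero_neg hn hr hε hy)
    {p ∈ {p ∈ s | triDegree r p = d} | p.2.1 = ν} c (fun p => wordProd UE p.2.2)
    (fun p => wordProd UF p.1) (fun p => Submodule.subset_span ⟨_, rfl⟩)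
    (fun p => Submodule.subset_span ⟨_, rfl⟩) (kMon n ν) (by
      refine Eq.trans ?_ h3
      rw [Finset.sum_filter]
      refine Finset.sum_congr rfl fun p _ => ?_
      rw [map_smul]
      refine Eq.trans ?_ (congrArg (c p • ·) (hL _ _ _)).symm
      split_ifs with hp
      · rw [hp, hf, one_smul, ← mul_assoc, h1, one_mul, mul_assoc, h2, mul_one]
      · rw [hf' _ hp, zero_smul, smul_zero])
  rw [← h4]
  refine Finset.sum_congr rfl fun p hp => ?_
  rw [triMon, (Finset.mem_filter.mp hp).2]

theorem sum_triMon_eq_zero (d : ℕ) (s : Finset (List (ZMod n) × KLattice n × List (ZMod n)))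
    (hs : ∀ p ∈ s, triDegree r p < d) (c : List (ZMod n) × KLattice n × List (ZMod n) → Qv)
    (h : foldHom hn hr hε (∑ p ∈ s, c p • triMon p) = 0) : ∑ p ∈ s, c p • triMon p = 0 := by
  induction d generalizing s with
  | zero => exact Finset.sum_eq_zero fun p hp => absurd (hs p hp) (Nat.not_lt_zero _)
  | succ d ih =>
    have htop := sum_triMon_eq_zero_of_top hn hr hε s (fun p hp => Nat.le_of_lt_succ (hs p hp)) c h
    have hsplit := Finset.sum_filter_add_sum_filter_not s (fun p => triDegree r p = d)
      fun p => c p • triMon p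
    rw [htop, zero_add] at hsplit
    rw [← hsplit] at h ⊢
    refine ih _ (fun p hp => ?_) h
    obtain ⟨hp, hd⟩ := Finset.mem_filter.mp hp
    have := hs p hp
    omega

theorem foldHom_injective : Function.Injective (foldHom hn hr hε) := by
  rw [injective_iff_map_eq_zero]
  intro x hx
  obtain ⟨c, rfl⟩ := (Finsupp.mem_span_range_iff_exists_finsupp).mp (mem_triSpan x)
  exact sum_triMon_eq_zero hn hr hε (c.support.sup (triDegree r) + 1) c.support
    (fun p hp => Nat.lt_succ_of_le (Finset.le_sup hp)) c hx

end Triangular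

/-- For all integers n ≥ 2, 0 ≤ r ≤ n−1, ε ∈ {1,−1}, there is a unique
ℚ(v)-algebra homomorphism Φ_{r,ε} : U(ŝl_n) → U(ŝl_{n+1}) sending E_i ↦ e_i, F_i ↦ f_i,
K_i^{±1} ↦ k_i^{±1} for all i ∈ ℤ/nℤ; moreover it is injective. -/
theorem quantum_affine_sl_embedding
    (n r : ℕ) (hn : 2 ≤ n) (hr : r ≤ n - 1) (ε : ℤ) (hε : ε = 1 ∨ ε = -1) :
    (∃! Φ : U n →ₐ[Qv] U (n + 1),
      ∀ i : ZMod n,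
        Φ (UE i) = eElt n r ε i ∧ Φ (UF i) = fElt n r ε i ∧
        Φ (UK i) = kElt n r i ∧ Φ (UKinv i) = kinvElt n r i) ∧
    (∀ Φ : U n →ₐ[Qv] U (n + 1),
      (∀ i : ZMod n,
        Φ (UE i) = eElt n r ε i ∧ Φ (UF i) = fElt n r ε i ∧
        Φ (UK i) = kElt n r i ∧ Φ (UKinv i) = kinvElt n r i) →
      Function.Injective Φ) := by
  have : NeZero n := ⟨by omega⟩
  have key : ∀ Φ : U n →ₐ[Qv] U (n + 1),
      (∀ i : ZMod n,
        Φ (UE i) = eElt n r ε i ∧ Φ (UF i) = fElt n r ε i ∧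
        Φ (UK i) = kElt n r i ∧ Φ (UKinv i) = kinvElt n r i) → Φ = foldHom hn hr hε :=
    fun Φ h => U_hom_ext (fun i => by rw [(h i).1, foldHom, ulift_E])
      (fun i => by rw [(h i).2.1, foldHom, ulift_F])
      (fun i => by rw [(h i).2.2.1, foldHom, ulift_K])
      (fun i => by rw [(h i).2.2.2, foldHom, ulift_Kinv])
  refine ⟨⟨foldHom hn hr hε, fun i => ⟨ulift_E _ i, ulift_F _ i, ulift_K _ i, ulift_Kinv _ i⟩, key⟩,
    fun Φ h => ?_⟩
  rw [key Φ h]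
  exact foldHom_injective hn hr hε

end
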